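/- arXiv:1602.05948 — 3 statements merged into one kernel-verified Lean document; each statement's English description precedes it below -/
import Mathlib

section
/- Let γ₁ and γ₂ be rectifiable arcs in ℂ², each smooth at all of its points except possibly at the origin, such that γ₁ ∩ γ₂ = {0}. Then the union γ₁ ∪ γ₂ is polynomially convex, i.e., (γ₁ ∪ γ₂)^ = γ₁ ∪ γ₂. -/
noncomputable section

/-- The polynomial hull of a set `K ⊆ ℂ²`. -/
def polyHull2 (K : Set (ℂ × ℂ)) : Set (ℂ × ℂ) :=
  {z | ∀ P : MvPolynomial (Fin 2) ℂ,
    ‖MvPolynomial.eval ![z.1, z.2] P‖ ≤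
      sSup ((fun w => ‖MvPolynomial.eval ![w.1, w.2] P‖) '' K)}

/-- `γ` is a rectifiable arc in `ℂ²` parameterized by `f`: the homeomorphic
(i.e. injective, on the compact interval `[0,1]`) image of an interval under a
Lipschitz continuous map. -/
def IsRectifiableArc (γ : Set (ℂ × ℂ)) (f : ℝ → ℂ × ℂ) : Prop :=
  γ = f '' Set.Icc 0 1 ∧ Set.InjOn f (Set.Icc 0 1) ∧
    ∃ L : NNReal, LipschitzOnWith L f (Set.Icc 0 1)

open Topology Filter MeasureTheory

/-- The codimension of the principal ideal generated by `F` in the algebra `A`. -/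
def mulIndex {E : Type*} [CommRing E] [Algebra ℂ E] (A : Subalgebra ℂ E) (F : A) : ℕ∞ :=
  Module.length ℂ (A ⧸ LinearMap.range (LinearMap.mulLeft ℂ F))

theorem length_quotient_range_comp {M : Type*} [AddCommGroup M] [Module ℂ M] (S T : M →ₗ[ℂ] M)
    (hS : Function.Injective S) :
    Module.length ℂ (M ⧸ LinearMap.range (S ∘ₗ T)) =
      Module.length ℂ (M ⧸ LinearMap.range T) + Module.length ℂ (M ⧸ LinearMap.range S) := by
  have h1 : LinearMap.range T ≤ (LinearMap.range (S ∘ₗ T)).comap S := by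
    rintro _ ⟨x, rfl⟩
    exact ⟨x, rfl⟩
  have h2 : LinearMap.range (S ∘ₗ T) ≤ LinearMap.range S := LinearMap.range_comp_le_range T S
  refine Module.length_eq_add_of_exact (Submodule.mapQ _ _ S h1) (Submodule.factor h2) ?_
    (Submodule.factor_surjective h2) ?_
  · rw [← LinearMap.ker_eq_bot, LinearMap.ker_eq_bot']
    intro x
    obtain ⟨x, rfl⟩ := Submodule.mkQ_surjective _ x
    intro h
    simp only [Submodule.mkQ_apply, Submodule.mapQ_apply, Submodule.Quotient.mk_eq_zero] at h ⊢
    obtain ⟨y, hy⟩ := h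
    exact ⟨y, hS hy⟩
  · intro x
    obtain ⟨x, rfl⟩ := Submodule.mkQ_surjective _ x
    have hx : Submodule.factor h2 (Submodule.mkQ _ x) = 0 ↔ x ∈ LinearMap.range S := by
      exact Submodule.Quotient.mk_eq_zero _
    rw [hx]
    constructor
    · rintro ⟨y, rfl⟩
      exact ⟨Submodule.Quotient.mk y, rfl⟩
    · rintro ⟨y, hy⟩
      obtain ⟨y, rfl⟩ := Submodule.mkQ_surjective _ y
      simp only [Submodule.mkQ_apply, Submodule.mapQ_apply] at hy
      rw [Submodule.Quotient.eq] at hy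
      obtain ⟨z, hz⟩ := hy
      exact ⟨y - T z, by simp at hz ⊢; rw [hz]; abel⟩

section Index

variable {E : Type*} [CommRing E] [Algebra ℂ E] {A : Subalgebra ℂ E}

theorem mulLeft_injective_of_isUnit {F : A} (hF : IsUnit (F : E)) :
    Function.Injective (LinearMap.mulLeft ℂ F) := by
  intro x y h
  apply Subtype.ext
  have : (F : E) * x = F * y := congrArg Subtype.val h
  exact hF.mul_left_cancel this

theorem mulIndex_mul {F G : A} (hF : IsUnit (F : E)) :
    mulIndex A (F * G) = mulIndex A F + mulIndex A G := by
  unfold mulIndex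
  rw [LinearMap.mulLeft_mul, length_quotient_range_comp _ _ (mulLeft_injective_of_isUnit hF),
    add_comm]

theorem mulIndex_one : mulIndex A 1 = 0 := by
  unfold mulIndex
  rw [Module.length_eq_zero_iff, Submodule.Quotient.subsingleton_iff, LinearMap.range_eq_top]
  intro x
  exact ⟨x, by simp⟩

theorem mulIndex_pow {F : A} (hF : IsUnit (F : E)) (n : ℕ) :
    mulIndex A (F ^ n) = n * mulIndex A F := by
  induction n with
  | zero => simp [mulIndex_one]
  | succ n ih =>
    rw [pow_succ', mulIndex_mul hF, ih]
    push_cast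
    ring

theorem mulIndex_eq_zero_iff {F : A} : mulIndex A F = 0 ↔ ∃ G : A, F * G = 1 := by
  unfold mulIndex
  rw [Module.length_eq_zero_iff, Submodule.Quotient.subsingleton_iff, LinearMap.range_eq_top]
  constructor
  · intro h
    exact h 1
  · rintro ⟨G, hG⟩ x
    exact ⟨G * x, by simp [← mul_assoc, hG]⟩

theorem det_eq_zero_of_mulIndex_le {F : A} {n : ℕ} (hn : mulIndex A F ≤ n) {Finv : E}
    (hF : Finv * F = 1) (σ : Fin (n + 1) → E →ₗ[ℂ] ℂ) (hσ : ∀ i, ∀ g : A, σ i g = 0)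
    (f : Fin (n + 1) → A) : (Matrix.of fun i j => σ i (f j * Finv)).det = 0 := by
  have hdep : ¬ LinearIndependent ℂ
      (fun j => (LinearMap.range (LinearMap.mulLeft ℂ F)).mkQ (f j)) := by
    intro h
    have h1 := h.cardinal_lift_le_rank
    have h2 : mulIndex A F = _ := Module.length_eq_rank ..
    have h3 : ((n + 1 : ℕ) : ℕ∞) ≤ n := by
      refine le_trans ?_ hn
      rw [h2]
      simpa using Cardinal.toENat.monotone' h1
    have := Nat.cast_le.1 h3
    omega
  rw [Fintype.not_linearIndependent_iff] at hdep
  obtain ⟨c, hc, hne⟩ := hdep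
  apply Matrix.exists_mulVec_eq_zero_iff.1
  refine ⟨c, fun h => ?_, ?_⟩
  · obtain ⟨i, hi⟩ := hne
    exact hi (congrFun h i)
  · simp only [← map_smul, ← map_sum] at hc
    rw [Submodule.mkQ_apply, Submodule.Quotient.mk_eq_zero] at hc
    obtain ⟨g, hg⟩ := hc
    have hg' : (F : E) * g = ∑ j, c j • (f j : E) := by
      have := congrArg Subtype.val hg
      simpa using this
    ext i
    have : σ i (∑ j, c j • ((f j : E) * Finv)) = 0 := by
      have : ∑ j, c j • ((f j : E) * Finv) = g := by
        simp_rw [← smul_mul_assoc, ← Finset.sum_mul, ← hg']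
        linear_combination (g : E) * hF
      rw [this, hσ]
    simp only [map_sum, map_smul, smul_eq_mul] at this
    simp only [Matrix.mulVec, dotProduct, Matrix.of_apply, Pi.zero_apply]
    rw [← this]
    exact Finset.sum_congr rfl fun j _ => mul_comm _ _

end Index

section Banach

variable {E : Type*} [NormedCommRing E] [NormedAlgebra ℂ E] {A : Subalgebra ℂ E}

/-- If the index exceeds `n`, this is detected by a determinant, whose first column may be chosen
to come from the constant function `1`. -/
theorem exists_det_ne_zero_of_lt_mulIndex (hA : IsClosed (A : Set E)) {F : A} {n : ℕ}
    (hn : (n : ℕ∞) < mulIndex A F) {Finv : E} (hF : Finv * F = 1) :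
    ∃ (σ : Fin (n + 1) → E →L[ℂ] ℂ) (f : Fin (n + 1) → A), (∀ i, ∀ g : A, σ i g = 0) ∧ f 0 = 1 ∧
      (Matrix.of fun i j => σ i (f j * Finv)).det ≠ 0 := by
  set R := LinearMap.range (LinearMap.mulLeft ℂ F) with hR
  have hlen : mulIndex A F = _ := Module.length_eq_rank ..
  have h1R : R.mkQ 1 ≠ 0 := by
    intro h
    rw [Submodule.mkQ_apply, Submodule.Quotient.mk_eq_zero] at h
    obtain ⟨G, hG⟩ := h
    have := mulIndex_eq_zero_iff.2 ⟨G, hG⟩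
    rw [this] at hn
    exact absurd hn (by simp)
  have key : ∀ k : ℕ, k ≤ n → ∃ v : Fin (k + 1) → A ⧸ R, LinearIndependent ℂ v ∧ v 0 = R.mkQ 1 := by
    intro k
    induction k with
    | zero =>
      intro _
      exact ⟨fun _ => R.mkQ 1, .of_subsingleton (ι := Fin 1) 0 h1R, rfl⟩
    | succ k ih =>
      intro hk
      obtain ⟨v, hv, hv0⟩ := ih (by omega)
      have : ((k + 1 : ℕ) : Cardinal) < Module.rank ℂ (A ⧸ R) := by
        by_contra! hle
        have h2 := Cardinal.toENat.monotone' hle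
        have h3 : mulIndex A F ≤ ((k + 1 : ℕ) : ℕ∞) := by
          rw [hlen]; simpa using h2
        have h4 := lt_of_lt_of_le hn h3
        have := Nat.cast_lt.1 h4
        omega
      obtain ⟨x, hx⟩ := exists_linearIndependent_snoc_of_lt_rank hv this
      refine ⟨_, hx, ?_⟩
      rw [← hv0]
      exact Fin.snoc_castSucc (α := fun _ => A ⧸ R) x v 0
  obtain ⟨v, hv, hv0⟩ := key n le_rfl
  have hlift : ∃ f : Fin (n + 1) → A, (∀ j, R.mkQ (f j) = v j) ∧ f 0 = 1 := by
    choose g hg using fun j => R.mkQ_surjective (v j)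
    refine ⟨Function.update g 0 1, fun j => ?_, by simp⟩
    by_cases hj : j = 0
    · subst hj; simpa using hv0.symm
    · simpa [hj] using hg j
  obtain ⟨f, hf, hf0⟩ := hlift
  let W : Submodule ℂ E := (Subalgebra.toSubmodule A).comap (LinearMap.mulRight ℂ Finv)
  have hW : IsClosed (W : Set E) := hA.preimage (continuous_id.mul continuous_const)
  have : IsClosed (W : Set E) := hW
  let φ : (Fin (n + 1) → ℂ) →ₗ[ℂ] E ⧸ W := Fintype.linearCombination ℂ (fun j => W.mkQ (f j))
  have hφ : Function.Injective φ := by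
    rw [← LinearMap.ker_eq_bot, LinearMap.ker_eq_bot']
    intro c hc
    simp only [φ, Fintype.linearCombination_apply, ← map_smul, ← map_sum] at hc
    rw [Submodule.mkQ_apply, Submodule.Quotient.mk_eq_zero] at hc
    have hc' : (∑ j, c j • (f j : E)) * Finv ∈ A := hc
    have : ∑ j, c j • v j = 0 := by
      simp only [← hf, ← map_smul, ← map_sum]
      rw [Submodule.mkQ_apply, Submodule.Quotient.mk_eq_zero]
      refine ⟨⟨_, hc'⟩, Subtype.ext ?_⟩
      simp only [LinearMap.mulLeft_apply, MulMemClass.coe_mul, AddSubmonoidClass.coe_finsetSum,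
        SetLike.val_smul]
      linear_combination (∑ j, c j • (f j : E)) * hF
    exact funext (Fintype.linearIndependent_iff.1 hv c this)
  have hsurj := (SeparatingDual.dualMap_surjective_iff (R := ℂ) (f := φ)).2 hφ
  choose τ hτ using fun i : Fin (n + 1) => hsurj (LinearMap.proj i)
  have hτ' : ∀ i j, τ i (W.mkQ (f j)) = if i = j then 1 else 0 := by
    intro i j
    have := LinearMap.congr_fun (hτ i) (Pi.single j 1)
    simp [φ, Fintype.linearCombination_apply_single] at this
    simpa [Pi.single_apply] using this
  let mq : E →L[ℂ] E ⧸ W := W.mkQL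
  refine ⟨fun i => (τ i).comp (mq.comp (ContinuousLinearMap.mul ℂ E (F : E))), f, ?_, hf0, ?_⟩
  · intro i g
    have : mq ((F : E) * g) = 0 := by
      change W.mkQ _ = 0
      rw [Submodule.mkQ_apply, Submodule.Quotient.mk_eq_zero]
      change (F : E) * g * Finv ∈ A
      convert g.2 using 1
      linear_combination (g : E) * hF
    simp [this]
  · have : (Matrix.of fun i j => ((τ i).comp (mq.comp (ContinuousLinearMap.mul ℂ E (F : E))))
        (f j * Finv)) = 1 := by
      ext i j
      have h : (F : E) * (f j * Finv) = f j := by linear_combination (f j : E) * hF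
      simp only [Matrix.of_apply, ContinuousLinearMap.comp_apply, ContinuousLinearMap.mul_apply',
        h, Matrix.one_apply]
      exact hτ' i j
    rw [this]
    simp

end Banach

section Complete

variable {E : Type*} [NormedCommRing E] [NormedAlgebra ℂ E] [CompleteSpace E] {A : Subalgebra ℂ E}

theorem eventually_surjective_coprod {B V : Type*} [NormedAddCommGroup B] [NormedSpace ℂ B]
    [CompleteSpace B] [NormedAddCommGroup V] [NormedSpace ℂ V] [CompleteSpace V] (S : B →L[ℂ] B)
    (ι : V →L[ℂ] B) (hbij : Function.Bijective (S.coprod ι)) :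
    ∀ᶠ S' in 𝓝 S, Function.Surjective (S'.coprod ι) := by
  let T : (B →L[ℂ] B) → (B × V →L[ℂ] B) := fun S' => S'.coprod ι
  have hT : Continuous T := by
    have : T = fun S' => S'.comp (ContinuousLinearMap.fst ℂ B V)
        + ι.comp (ContinuousLinearMap.snd ℂ B V) := by
      ext1 F'
      refine ContinuousLinearMap.ext fun x => ?_
      simp [T]
    rw [this]
    fun_prop
  let e0 : (B × V) ≃L[ℂ] B := ContinuousLinearEquiv.ofBijective (T S)
    (LinearMap.ker_eq_bot.2 hbij.1) (LinearMap.range_eq_top.2 hbij.2)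
  have hnhds : Set.range ((↑) : ((B × V) ≃L[ℂ] B) → (B × V →L[ℂ] B)) ∈ 𝓝 (T S) := by
    have := ContinuousLinearEquiv.nhds e0
    rwa [show (e0 : B × V →L[ℂ] B) = T S from
      ContinuousLinearEquiv.coe_ofBijective _ _ _] at this
  filter_upwards [hT.continuousAt.eventually_mem hnhds] with F' hF'
  obtain ⟨e', he'⟩ := hF'
  change Function.Surjective (T F')
  rw [← he']
  exact e'.surjective

theorem eventually_mulIndex_le (hA : IsClosed (A : Set E)) {F : A} (hF : IsUnit (F : E))
    (hfin : mulIndex A F ≠ ⊤) : ∀ᶠ F' in 𝓝 F, mulIndex A F' ≤ mulIndex A F := by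
  have : CompleteSpace A := hA.completeSpace_coe
  set R := LinearMap.range (LinearMap.mulLeft ℂ F) with hR
  obtain ⟨V, hV⟩ := Submodule.exists_isCompl R
  have e : (A ⧸ R) ≃ₗ[ℂ] V := Submodule.quotientEquivOfIsCompl R V hV
  have hlenV : Module.length ℂ V = mulIndex A F := (e.length_eq).symm
  have hVfin : Module.Finite ℂ V := by
    have h1 : Module.length ℂ V ≠ ⊤ := by rwa [hlenV]
    have := (isFiniteLength_iff_isNoetherian_isArtinian.1 (Module.length_ne_top_iff.1 h1)).1
    infer_instance
  have hbij : Function.Bijective ((ContinuousLinearMap.mul ℂ A F).coprod V.subtypeL) := by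
    constructor
    · rw [← LinearMap.coe_coe, ← LinearMap.ker_eq_bot, LinearMap.ker_eq_bot']
      rintro ⟨x, v⟩ h
      have h' : F * x + v = 0 := by simpa using h
      have hv : (v : A) ∈ R ⊓ V := by
        refine ⟨⟨-x, ?_⟩, v.2⟩
        have : (v : A) = -(F * x) := by linear_combination h'
        simp [this]
      rw [hV.inf_eq_bot, Submodule.mem_bot] at hv
      rw [hv, add_zero] at h'
      have hx : x = 0 := by
        apply mulLeft_injective_of_isUnit hF
        simpa using h'
      exact Prod.ext hx (Subtype.ext hv)
    · intro y
      have hy : y ∈ R ⊔ V := by rw [hV.sup_eq_top]; trivial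
      obtain ⟨_, ⟨x, rfl⟩, v, hv, h⟩ := Submodule.mem_sup.1 hy
      exact ⟨(x, ⟨v, hv⟩), by simpa using h⟩
  filter_upwards [(ContinuousLinearMap.mul ℂ A).continuous.continuousAt.eventually
    (eventually_surjective_coprod _ _ hbij)] with F' hF'
  rw [← hlenV]
  unfold mulIndex
  refine Module.length_le_of_surjective
    ((LinearMap.range (LinearMap.mulLeft ℂ F')).mkQ ∘ₗ V.subtype) ?_
  intro y
  obtain ⟨y, rfl⟩ := Submodule.mkQ_surjective _ y
  obtain ⟨⟨x, v⟩, h⟩ 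
    := hF' y
  refine ⟨v, ?_⟩
  have h2 : F' * x + v = y := by simpa using h
  simp only [LinearMap.comp_apply, Submodule.subtype_apply, Submodule.mkQ_apply]
  rw [Submodule.Quotient.eq]
  exact ⟨-x, by simp [← h2]⟩

theorem mulIndex_le_of_preconnected (hA : IsClosed (A : Set E)) {F G : A} {U : Set ℂ}
    (hU : IsOpen U) (hU' : IsPreconnected U) (hunit : ∀ w ∈ U, IsUnit ((F : E) + w • (G : E)))
    {w₀ : ℂ} (hw₀ : w₀ ∈ U) {n : ℕ} (hn : mulIndex A (F + w₀ • G) ≤ n) {w : ℂ} (hw : w ∈ U) :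
    mulIndex A (F + w • G) ≤ n := by
  by_contra! hlt
  obtain ⟨σ, f, hσ, -, hdet⟩ := exists_det_ne_zero_of_lt_mulIndex hA hlt
    (Finv := Ring.inverse ((F : E) + w • (G : E)))
    (by simpa using Ring.inverse_mul_cancel _ (hunit w hw))
  let D : ℂ → ℂ := fun z =>
    (Matrix.of fun i j => σ i (f j * Ring.inverse ((F : E) + z • (G : E)))).det
  have hD : AnalyticOnNhd ℂ D U := by
    apply DifferentiableOn.analyticOnNhd _ hU
    have hinv : ∀ z ∈ U, DifferentiableAt ℂ (fun z => Ring.inverse ((F : E) + z • (G : E))) z := by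
      intro z hz
      refine DifferentiableAt.comp (f := fun z : ℂ => (F : E) + z • (G : E)) z
        (differentiableAt_inverse (𝕜 := ℂ) (hunit z hz)) ?_
      fun_prop
    intro z hz
    apply DifferentiableAt.differentiableWithinAt
    have := hinv z hz
    simp only [D, Matrix.det_apply, Matrix.of_apply]
    fun_prop
  have hev : D =ᶠ[𝓝 w₀] 0 := by
    have hop := eventually_mulIndex_le hA (F := F + w₀ • G) (by simpa using hunit w₀ hw₀)
      (ne_top_of_le_ne_top (by simp) hn)
    have hcont : ContinuousAt (fun z : ℂ => F + z • G) w₀ := by fun_prop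
    filter_upwards [hcont.eventually hop, hU.mem_nhds hw₀] with z hz hzU
    exact det_eq_zero_of_mulIndex_le (hz.trans hn)
      (by simpa using Ring.inverse_mul_cancel _ (hunit z hzU)) (fun i => (σ i).toLinearMap) hσ f
  exact hdet (hD.eqOn_zero_of_preconnected_of_eventuallyEq_zero hU' hw₀ hev hw)

theorem mulIndex_eq_of_preconnected (hA : IsClosed (A : Set E)) {F G : A} {U : Set ℂ}
    (hU : IsOpen U) (hU' : IsPreconnected U) (hunit : ∀ w ∈ U, IsUnit ((F : E) + w • (G : E)))
    {w₀ : ℂ} (hw₀ : w₀ ∈ U) {w : ℂ} (hw : w ∈ U) :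
    mulIndex A (F + w • G) = mulIndex A (F + w₀ • G) := by
  apply le_antisymm
  · by_cases h : mulIndex A (F + w₀ • G) = ⊤
    · simp [h]
    · lift mulIndex A (F + w₀ • G) to ℕ using h with n hn
      exact mulIndex_le_of_preconnected hA hU hU' hunit hw₀ hn.ge hw
  · by_cases h : mulIndex A (F + w • G) = ⊤
    · simp [h]
    · lift mulIndex A (F + w • G) to ℕ using h with n hn
      exact mulIndex_le_of_preconnected hA hU hU' hunit hw hn.ge hw₀

end Complete

section ContinuousMap

variable {X : Type*} [TopologicalSpace X]

theorem isUnit_continuousMap_of_ne_zero {F : C(X, ℂ)} (h : ∀ x, F x ≠ 0) : IsUnit F :=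
  ContinuousMap.isUnit_iff_forall_ne_zero F |>.2 h

variable [CompactSpace X] {A : Subalgebra ℂ C(X, ℂ)}

theorem mulIndex_eq_of_norm_sub_lt (hA : IsClosed (A : Set C(X, ℂ))) {F G : A}
    (h : ∀ x, ‖(G : C(X, ℂ)) x - (F : C(X, ℂ)) x‖ < ‖(F : C(X, ℂ)) x‖) :
    mulIndex A G = mulIndex A F := by
  obtain ⟨q, hq1, hq⟩ : ∃ q : ℝ, 1 < q ∧
      ∀ x, q * ‖(G : C(X, ℂ)) x - (F : C(X, ℂ)) x‖ < ‖(F : C(X, ℂ)) x‖ := by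
    have hF : ∀ x, 0 < ‖(F : C(X, ℂ)) x‖ := fun x => (norm_nonneg _).trans_lt (h x)
    have hcont : Continuous fun x => ‖(G : C(X, ℂ)) x - (F : C(X, ℂ)) x‖ / ‖(F : C(X, ℂ)) x‖ := by
      refine Continuous.div (by fun_prop) (by fun_prop) fun x => (hF x).ne'
    rcases isEmpty_or_nonempty X with hX | hX
    · exact ⟨2, by norm_num, fun x => hX.elim x⟩
    obtain ⟨x₀, hx₀⟩ := isCompact_univ.exists_isMaxOn Set.univ_nonempty hcont.continuousOn
    set m := ‖(G : C(X, ℂ)) x₀ - (F : C(X, ℂ)) x₀‖ / ‖(F : C(X, ℂ)) x₀‖ with hm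
    have hm1 : m < 1 := (div_lt_one (hF x₀)).2 (h x₀)
    have hm0 : 0 ≤ m := by positivity
    refine ⟨2 / (1 + m), by rw [lt_div_iff₀ (by positivity)]; linarith, fun x => ?_⟩
    have hx : ‖(G : C(X, ℂ)) x - (F : C(X, ℂ)) x‖ ≤ m * ‖(F : C(X, ℂ)) x‖ := by
      have := hx₀.2 (Set.mem_univ x)
      exact (div_le_iff₀ (hF x)).1 this
    rw [div_mul_eq_mul_div, div_lt_iff₀ (by positivity)]
    nlinarith [hF x]
  have hunit : ∀ w ∈ Metric.ball (0 : ℂ) q,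
      IsUnit ((F : C(X, ℂ)) + w • ((G - F : A) : C(X, ℂ))) := by
    intro w hw
    apply isUnit_continuousMap_of_ne_zero
    intro x hx
    rw [mem_ball_zero_iff] at hw
    have h1 : (F : C(X, ℂ)) x = -(w * ((G : C(X, ℂ)) x - (F : C(X, ℂ)) x)) := by
      simp at hx
      linear_combination hx
    have h2 := hq x
    have h3 : ‖(F : C(X, ℂ)) x‖ = ‖w‖ * ‖(G : C(X, ℂ)) x - (F : C(X, ℂ)) x‖ := by
      rw [h1, norm_neg, norm_mul, ← h1]
    nlinarith [norm_nonneg ((G : C(X, ℂ)) x - (F : C(X, ℂ)) x)]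
  have := mulIndex_eq_of_preconnected hA (F := F) (G := G - F) Metric.isOpen_ball
    (convex_ball (0 : ℂ) q).isPreconnected hunit (w₀ := 0) (by simp; linarith) (w := 1)
    (by simpa using hq1)
  simpa using this

end ContinuousMap

section Taylor

theorem norm_le_pow_succ_of_hasDerivAt {k k' : ℝ → ℂ} {S : Set ℝ} (hS : Convex ℝ S) {t : ℝ}
    (ht : t ∈ S) (hk : ∀ u ∈ S, HasDerivAt k (k' u) u) (h0 : k t = 0) {C : ℝ} {n : ℕ}
    (hb : ∀ u ∈ S, ‖k' u‖ ≤ C * |u - t| ^ n) : ∀ u ∈ S, ‖k u‖ ≤ C * |u - t| ^ (n + 1) := by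
  intro u hu
  have hseg : segment ℝ t u ⊆ S := hS.segment_subset ht hu
  have hC : 0 ≤ C * |u - t| ^ n := (norm_nonneg _).trans (hb u hu)
  have h := (convex_segment (𝕜 := ℝ) t u).norm_image_sub_le_of_norm_hasDerivWithin_le
    (f := k) (f' := k') (C := C * |u - t| ^ n)
    (fun v hv => (hk v (hseg hv)).hasDerivWithinAt) ?_ (left_mem_segment ℝ t u)
    (right_mem_segment ℝ t u)
  · rw [h0, sub_zero, Real.norm_eq_abs] at h
    rw [pow_succ, ← mul_assoc]
    exact h
  · intro v hv
    refine (hb v (hseg hv)).trans ?_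
    have hvt : |v - t| ≤ |u - t| := by
      rw [segment_eq_uIcc] at hv
      exact Set.abs_sub_left_of_mem_uIcc hv
    rcases eq_or_ne u t with rfl | hne
    · have : |v - u| = 0 := le_antisymm (by simpa using hvt) (abs_nonneg _)
      rw [this]; simp
    · have hpos : 0 < |u - t| ^ n := by
        have := abs_pos.2 (sub_ne_zero.2 hne)
        positivity
      have hC' : 0 ≤ C := nonneg_of_mul_nonneg_left hC hpos
      gcongr

theorem hasDerivAt_of_contDiffAt {F : ℝ → ℂ} {t : ℝ} (h : ContDiffAt ℝ (⊤ : ℕ∞) F t) :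
    HasDerivAt F (deriv F t) t :=
  (h.differentiableAt (by simp)).hasDerivAt

theorem contDiffAt_deriv {F : ℝ → ℂ} {t : ℝ} (h : ContDiffAt ℝ (⊤ : ℕ∞) F t) :
    ContDiffAt ℝ (⊤ : ℕ∞) (deriv F) t :=
  h.derivWithin (m := (⊤ : ℕ∞)) (by simp) |>.congr_of_eventuallyEq (by simp)

theorem exists_bound_on_ball {F : ℝ → ℂ} {t₀ ρ ε : ℝ} (hε : ε < ρ)
    (h : ∀ t ∈ Metric.ball t₀ ρ, ContDiffAt ℝ (⊤ : ℕ∞) F t) :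
    ∃ M, ∀ t ∈ Metric.ball t₀ ε, ‖F t‖ ≤ M := by
  obtain ⟨M, hM⟩ := (isCompact_closedBall t₀ ε).exists_bound_of_continuousOn (f := F)
    fun t ht => (h t (Metric.closedBall_subset_ball hε ht)).continuousAt.continuousWithinAt
  exact ⟨M, fun t ht => hM t (Metric.ball_subset_closedBall ht)⟩

/-- A function along a smooth immersed plane curve agrees to third order with a quadratic
polynomial in the position on the curve. -/
theorem exists_quadratic_approx {F ζ : ℝ → ℂ} {t₀ ρ ε κ : ℝ} (hε : ε < ρ) (hκ : 0 < κ)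
    (hF : ∀ t ∈ Metric.ball t₀ ρ, ContDiffAt ℝ (⊤ : ℕ∞) F t)
    (hζ : ∀ t ∈ Metric.ball t₀ ρ, ContDiffAt ℝ (⊤ : ℕ∞) ζ t)
    (hζ' : ∀ t ∈ Metric.ball t₀ ε, κ ≤ ‖deriv ζ t‖) :
    ∃ (c₁ c₂ : ℝ → ℂ) (C : ℝ), ∀ t ∈ Metric.ball t₀ ε, ‖F t‖ ≤ C ∧ ‖c₁ t‖ ≤ C ∧ ‖c₂ t‖ ≤ C ∧
      ∀ t' ∈ Metric.ball t₀ ε,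
        ‖F t' - F t - c₁ t * (ζ t' - ζ t) - c₂ t * (ζ t' - ζ t) ^ 2‖ ≤ C * |t' - t| ^ 3 := by
  have hF1 := fun t ht => contDiffAt_deriv (hF t ht)
  have hF2 := fun t ht => contDiffAt_deriv (hF1 t ht)
  have hF3 := fun t ht => contDiffAt_deriv (hF2 t ht)
  have hζ1 := fun t ht => contDiffAt_deriv (hζ t ht)
  have hζ2 := fun t ht => contDiffAt_deriv (hζ1 t ht)
  have hζ3 := fun t ht => contDiffAt_deriv (hζ2 t ht)
  have hsub : Metric.ball t₀ ε ⊆ Metric.ball t₀ ρ := Metric.ball_subset_ball hε.le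
  obtain ⟨M, hM0, hMF, hM1, hM2, hM3, hN, hN1, hN2, hN3⟩ : ∃ M : ℝ, 0 ≤ M ∧
      (∀ t ∈ Metric.ball t₀ ε, ‖F t‖ ≤ M) ∧ (∀ t ∈ Metric.ball t₀ ε, ‖deriv F t‖ ≤ M) ∧
      (∀ t ∈ Metric.ball t₀ ε, ‖deriv (deriv F) t‖ ≤ M) ∧
      (∀ t ∈ Metric.ball t₀ ε, ‖deriv (deriv (deriv F)) t‖ ≤ M) ∧
      (∀ t ∈ Metric.ball t₀ ε, ‖ζ t‖ ≤ M) ∧ (∀ t ∈ Metric.ball t₀ ε, ‖deriv ζ t‖ ≤ M) ∧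
      (∀ t ∈ Metric.ball t₀ ε, ‖deriv (deriv ζ) t‖ ≤ M) ∧
      (∀ t ∈ Metric.ball t₀ ε, ‖deriv (deriv (deriv ζ)) t‖ ≤ M) := by
    obtain ⟨m0, h0⟩ := exists_bound_on_ball hε hF
    obtain ⟨m1, h1⟩ := exists_bound_on_ball hε hF1
    obtain ⟨m2, h2⟩ := exists_bound_on_ball hε hF2
    obtain ⟨m3, h3⟩ := exists_bound_on_ball hε hF3
    obtain ⟨m4, h4⟩ := exists_bound_on_ball hε hζ
    obtain ⟨m5, h5⟩ := exists_bound_on_ball hε hζ1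
    obtain ⟨m6, h6⟩ := exists_bound_on_ball hε hζ2
    obtain ⟨m7, h7⟩ := exists_bound_on_ball hε hζ3
    refine ⟨|m0| + |m1| + |m2| + |m3| + |m4| + |m5| + |m6| + |m7|, by positivity, ?_, ?_, ?_, ?_,
      ?_, ?_, ?_, ?_⟩ <;> intro t ht
    · linarith [h0 t ht, le_abs_self m0, abs_nonneg m1, abs_nonneg m2, abs_nonneg m3,
        abs_nonneg m4, abs_nonneg m5, abs_nonneg m6, abs_nonneg m7]
    · linarith [h1 t ht, le_abs_self m1, abs_nonneg m0, abs_nonneg m2, abs_nonneg m3,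
        abs_nonneg m4, abs_nonneg m5, abs_nonneg m6, abs_nonneg m7]
    · linarith [h2 t ht, le_abs_self m2, abs_nonneg m1, abs_nonneg m0, abs_nonneg m3,
        abs_nonneg m4, abs_nonneg m5, abs_nonneg m6, abs_nonneg m7]
    · linarith [h3 t ht, le_abs_self m3, abs_nonneg m1, abs_nonneg m2, abs_nonneg m0,
        abs_nonneg m4, abs_nonneg m5, abs_nonneg m6, abs_nonneg m7]
    · linarith [h4 t ht, le_abs_self m4, abs_nonneg m1, abs_nonneg m2, abs_nonneg m3,
        abs_nonneg m0, abs_nonneg m5, abs_nonneg m6, abs_nonneg m7]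
    · linarith [h5 t ht, le_abs_self m5, abs_nonneg m1, abs_nonneg m2, abs_nonneg m3,
        abs_nonneg m4, abs_nonneg m0, abs_nonneg m6, abs_nonneg m7]
    · linarith [h6 t ht, le_abs_self m6, abs_nonneg m1, abs_nonneg m2, abs_nonneg m3,
        abs_nonneg m4, abs_nonneg m5, abs_nonneg m0, abs_nonneg m7]
    · linarith [h7 t ht, le_abs_self m7, abs_nonneg m1, abs_nonneg m2, abs_nonneg m3,
        abs_nonneg m4, abs_nonneg m5, abs_nonneg m6, abs_nonneg m0]
  let c₁ : ℝ → ℂ := fun t => deriv F t / deriv ζ t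
  let c₂ : ℝ → ℂ := fun t =>
    (deriv (deriv F) t - c₁ t * deriv (deriv ζ) t) / (2 * deriv ζ t ^ 2)
  set M1 : ℝ := M / κ
  set M2 : ℝ := (M + M1 * M) / (2 * κ ^ 2)
  have hM1' : 0 ≤ M1 := by positivity
  have hM2' : 0 ≤ M2 := by positivity
  have hc1 : ∀ t ∈ Metric.ball t₀ ε, ‖c₁ t‖ ≤ M1 := by
    intro t ht
    simp only [c₁, norm_div]
    exact div_le_div₀ hM0 (hM1 t ht) hκ (hζ' t ht)
  have hc2 : ∀ t ∈ Metric.ball t₀ ε, ‖c₂ t‖ ≤ M2 := by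
    intro t ht
    simp only [c₂, norm_div, norm_mul, norm_pow, Complex.norm_ofNat]
    have h1 := hζ' t ht
    refine div_le_div₀ (by positivity) ?_ (by positivity) (by gcongr)
    refine (norm_sub_le _ _).trans ?_
    rw [norm_mul]
    exact add_le_add (hM2 t ht) (mul_le_mul (hc1 t ht) (hN2 t ht) (norm_nonneg _) hM1')
  set C3 : ℝ := M + M1 * M + M2 * (6 * M * M + 2 * (2 * M) * M)
  have hC3 : 0 ≤ C3 := by positivity
  refine ⟨c₁, c₂, C3 + M + M1 + M2, fun t ht => ⟨by linarith [hMF t ht], by linarith [hc1 t ht],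
    by linarith [hc2 t ht], fun t' ht' => ?_⟩⟩
  have hζt : deriv ζ t ≠ 0 := norm_pos_iff.1 (hκ.trans_le (hζ' t ht))
  have hconv := convex_ball t₀ ε
  let k0 : ℝ → ℂ := fun u => F u - F t - c₁ t * (ζ u - ζ t) - c₂ t * (ζ u - ζ t) ^ 2
  let k1 : ℝ → ℂ := fun u =>
    deriv F u - c₁ t * deriv ζ u - c₂ t * (2 * (ζ u - ζ t) * deriv ζ u)
  let k2 : ℝ → ℂ := fun u => deriv (deriv F) u - c₁ t * deriv (deriv ζ) u -
    c₂ t * (2 * (deriv ζ u) * deriv ζ u + 2 * (ζ u - ζ t) * deriv (deriv ζ) u)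
  let k3 : ℝ → ℂ := fun u => deriv (deriv (deriv F)) u - c₁ t * deriv (deriv (deriv ζ)) u -
    c₂ t * (6 * (deriv ζ u) * deriv (deriv ζ) u + 2 * (ζ u - ζ t) * deriv (deriv (deriv ζ)) u)
  have d0 : ∀ u ∈ Metric.ball t₀ ε, HasDerivAt k0 (k1 u) u := by
    intro u hu
    have a := hasDerivAt_of_contDiffAt (hF u (hsub hu))
    have b := hasDerivAt_of_contDiffAt (hζ u (hsub hu))
    have := ((a.sub_const (F t)).sub ((b.sub_const (ζ t)).const_mul (c₁ t))).sub
      (((b.sub_const (ζ t)).pow 2).const_mul (c₂ t))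
    refine this.congr_deriv ?_
    simp [k1]
  have d1 : ∀ u ∈ Metric.ball t₀ ε, HasDerivAt k1 (k2 u) u := by
    intro u hu
    have a := hasDerivAt_of_contDiffAt (hF1 u (hsub hu))
    have b := hasDerivAt_of_contDiffAt (hζ u (hsub hu))
    have b' := hasDerivAt_of_contDiffAt (hζ1 u (hsub hu))
    have := (a.sub (b'.const_mul (c₁ t))).sub
      ((((b.sub_const (ζ t)).const_mul 2).mul b').const_mul (c₂ t))
    exact this
  have d2 : ∀ u ∈ Metric.ball t₀ ε, HasDerivAt k2 (k3 u) u := by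
    intro u hu
    have a := hasDerivAt_of_contDiffAt (hF2 u (hsub hu))
    have b := hasDerivAt_of_contDiffAt (hζ u (hsub hu))
    have b' := hasDerivAt_of_contDiffAt (hζ1 u (hsub hu))
    have b'' := hasDerivAt_of_contDiffAt (hζ2 u (hsub hu))
    have := (a.sub (b''.const_mul (c₁ t))).sub
      ((((b'.const_mul 2).mul b').add
        (((b.sub_const (ζ t)).const_mul 2).mul b'')).const_mul (c₂ t))
    refine this.congr_deriv ?_
    simp only [k3]
    ring
  have z0 : k0 t = 0 := by simp [k0]
  have z1 : k1 t = 0 := by simp [k1, c₁, hζt]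
  have z2 : k2 t = 0 := by
    simp only [k2, c₂, sub_self]
    field_simp
    ring
  have b3 : ∀ u ∈ Metric.ball t₀ ε, ‖k3 u‖ ≤ C3 * |u - t| ^ 0 := by
    intro u hu
    rw [pow_zero, mul_one]
    have e1 : ‖c₁ t * deriv (deriv (deriv ζ)) u‖ ≤ M1 * M := by
      rw [norm_mul]
      exact mul_le_mul (hc1 t ht) (hN3 u hu) (norm_nonneg _) hM1'
    have e0 : ‖ζ u - ζ t‖ ≤ 2 * M := (norm_sub_le _ _).trans (by linarith [hN u hu, hN t ht])
    have e2 : ‖6 * (deriv ζ u) * deriv (deriv ζ) u‖ ≤ 6 * M * M := by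
      simp only [norm_mul, Complex.norm_ofNat]
      gcongr
      exacts [hN1 u hu, hN2 u hu]
    have e3 : ‖2 * (ζ u - ζ t) * deriv (deriv (deriv ζ)) u‖ ≤ 2 * (2 * M) * M := by
      simp only [norm_mul, Complex.norm_ofNat]
      gcongr
      exact hN3 u hu
    have e4 : ‖c₂ t * (6 * (deriv ζ u) * deriv (deriv ζ) u +
        2 * (ζ u - ζ t) * deriv (deriv (deriv ζ)) u)‖ ≤ M2 * (6 * M * M + 2 * (2 * M) * M) := by
      rw [norm_mul]
      exact mul_le_mul (hc2 t ht) ((norm_add_le _ _).trans (add_le_add e2 e3)) (norm_nonneg _) hM2'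
    exact (norm_sub_le _ _).trans (add_le_add ((norm_sub_le _ _).trans
      (add_le_add (hM3 u hu) e1)) e4)
  have b2 := norm_le_pow_succ_of_hasDerivAt hconv ht d2 z2 b3
  have b1 := norm_le_pow_succ_of_hasDerivAt hconv ht d1 z1 b2
  have b0 := norm_le_pow_succ_of_hasDerivAt hconv ht d0 z0 b1
  refine (b0 t' ht').trans ?_
  gcongr
  linarith

end Taylor

section Triples

/-- Bounded triples of functions `(g₁, g₂, g₃)` which behave to second order in `δ` like the values
of a function at `δ`, `-δ`, `-2δ`. -/
def extrapolationSubring {ι : Type*} (δ : ι → ℝ) (hδ : ∀ i, 0 ≤ δ i) :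
    Subring (ι → ℂ × ℂ × ℂ) where
  carrier := {g | ∃ C : ℝ, 0 ≤ C ∧ ∀ i, ‖(g i).1‖ ≤ C ∧ ‖(g i).2.1‖ ≤ C ∧ ‖(g i).2.2‖ ≤ C ∧
    ‖(g i).2.1 - (g i).2.2‖ ≤ C * δ i ∧
    ‖(g i).1 - 3 * (g i).2.1 + 2 * (g i).2.2‖ ≤ C * δ i ^ 2}
  zero_mem' := ⟨0, le_rfl, fun i => by simp⟩
  one_mem' := ⟨1, zero_le_one, fun i => by
    refine ⟨by simp, by simp, by simp, by simp [hδ i], ?_⟩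
    simp only [Pi.one_apply, Prod.fst_one, Prod.snd_one]
    norm_num
    positivity⟩
  neg_mem' := by
    rintro g ⟨C, hC, h⟩
    refine ⟨C, hC, fun i => ?_⟩
    obtain ⟨h1, h2, h3, h4, h5⟩ := h i
    simp only [Pi.neg_apply, Prod.fst_neg, Prod.snd_neg, norm_neg]
    refine ⟨h1, h2, h3, ?_, ?_⟩
    · rwa [show -(g i).2.1 - -(g i).2.2 = -((g i).2.1 - (g i).2.2) by ring, norm_neg]
    · rwa [show -(g i).1 - 3 * -(g i).2.1 + 2 * -(g i).2.2 =
        -((g i).1 - 3 * (g i).2.1 + 2 * (g i).2.2) by ring, norm_neg]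
  add_mem' := by
    rintro g k ⟨C, hC, h⟩ ⟨D, hD, h'⟩
    refine ⟨C + D, by positivity, fun i => ?_⟩
    obtain ⟨h1, h2, h3, h4, h5⟩ := h i
    obtain ⟨k1, k2, k3, k4, k5⟩ := h' i
    simp only [Pi.add_apply, Prod.fst_add, Prod.snd_add, add_mul]
    refine ⟨norm_add_le_of_le h1 k1, norm_add_le_of_le h2 k2, norm_add_le_of_le h3 k3, ?_, ?_⟩
    · rw [add_sub_add_comm]
      exact norm_add_le_of_le h4 k4
    · rw [show (g i).1 + (k i).1 - 3 * ((g i).2.1 + (k i).2.1) + 2 * ((g i).2.2 + (k i).2.2) =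
        ((g i).1 - 3 * (g i).2.1 + 2 * (g i).2.2) +
          ((k i).1 - 3 * (k i).2.1 + 2 * (k i).2.2) by ring]
      exact norm_add_le_of_le h5 k5
  mul_mem' := by
    rintro g k ⟨C, hC, h⟩ ⟨D, hD, h'⟩
    refine ⟨18 * C * D, by positivity, fun i => ?_⟩
    obtain ⟨h1, h2, h3, h4, h5⟩ := h i
    obtain ⟨k1, k2, k3, k4, k5⟩ := h' i
    simp only [Pi.mul_apply, Prod.fst_mul, Prod.snd_mul]
    generalize (g i).1 = a1 at *
    generalize (g i).2.1 = a2 at *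
    generalize (g i).2.2 = a3 at *
    generalize (k i).1 = b1 at *
    generalize (k i).2.1 = b2 at *
    generalize (k i).2.2 = b3 at *
    have hd := hδ i
    generalize δ i = d at *
    have mul_le : ∀ {x y : ℂ} {c e : ℝ}, 0 ≤ c → ‖x‖ ≤ c → ‖y‖ ≤ e → ‖x * y‖ ≤ c * e := by
      intro x y c e hc hx hy
      rw [norm_mul]
      exact mul_le_mul hx hy (norm_nonneg _) hc
    have hCD : 0 ≤ C * D := by positivity
    refine ⟨(mul_le hC h1 k1).trans (by nlinarith), (mul_le hC h2 k2).trans (by nlinarith),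
      (mul_le hC h3 k3).trans (by nlinarith), ?_, ?_⟩
    · have e : a2 * b2 - a3 * b3 = (a2 - a3) * b2 + a3 * (b2 - b3) := by ring
      rw [e]
      refine (norm_add_le_of_le (mul_le (by positivity) h4 k2) (mul_le hC h3 k4)).trans ?_
      nlinarith [mul_nonneg hCD hd]
    · have e : a1 * b1 - 3 * (a2 * b2) + 2 * (a3 * b3) = (a1 - 3 * a2 + 2 * a3) * b1 +
          (b1 - 3 * b2 + 2 * b3) * (3 * a2 - 2 * a3) + (6 * (a2 - a3)) * (b2 - b3) := by ring
      have h6 : ‖3 * a2 - 2 * a3‖ ≤ 5 * C := by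
        refine (norm_sub_le _ _).trans ?_
        simp only [norm_mul, Complex.norm_ofNat]
        linarith
      have h7 : ‖6 * (a2 - a3)‖ ≤ 6 * (C * d) := by
        simp only [norm_mul, Complex.norm_ofNat]
        linarith
      rw [e]
      refine (norm_add_le_of_le (norm_add_le_of_le (mul_le (by positivity) h5 k1)
        (mul_le (by positivity) k5 h6)) (mul_le (by positivity) h7 k4)).trans ?_
      nlinarith [mul_nonneg hCD (sq_nonneg d)]

theorem det_mem_extrapolationSubring {ι : Type*} {δ : ι → ℝ} {hδ : ∀ i, 0 ≤ δ i} {n : ℕ}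
    {M : Matrix (Fin n) (Fin n) (ι → ℂ × ℂ × ℂ)}
    (hM : ∀ i j, M i j ∈ extrapolationSubring δ hδ) : M.det ∈ extrapolationSubring δ hδ := by
  rw [Matrix.det_apply']
  refine Subring.sum_mem _ fun s _ => Subring.mul_mem _ (intCast_mem _ _) ?_
  exact Subring.prod_mem _ fun i _ => hM _ _

/-- Second order extrapolation of the vanishing of a determinant. -/
theorem exists_norm_det_le {ι : Type*} {δ : ι → ℝ} (hδ : ∀ i, 0 ≤ δ i) {n : ℕ}
    (a b c : Fin n → Fin n → ι → ℂ) {C : ℝ} (hC : 0 ≤ C)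
    (ha : ∀ i j x, ‖a i j x‖ ≤ C) (hb : ∀ i j x, ‖b i j x‖ ≤ C) (hc : ∀ i j x, ‖c i j x‖ ≤ C)
    (hbc : ∀ i j x, ‖b i j x - c i j x‖ ≤ C * δ x)
    (habc : ∀ i j x, ‖a i j x - 3 * b i j x + 2 * c i j x‖ ≤ C * δ x ^ 2)
    (hb0 : ∀ x, (Matrix.of fun i j => b i j x).det = 0)
    (hc0 : ∀ x, (Matrix.of fun i j => c i j x).det = 0) :
    ∃ D, 0 ≤ D ∧ ∀ x, ‖(Matrix.of fun i j => a i j x).det‖ ≤ D * δ x ^ 2 := by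
  let M : Matrix (Fin n) (Fin n) (ι → ℂ × ℂ × ℂ) :=
    Matrix.of fun i j x => (a i j x, b i j x, c i j x)
  have hM : M.det ∈ extrapolationSubring δ hδ := det_mem_extrapolationSubring fun i j =>
    ⟨C, hC, fun x => ⟨ha i j x, hb i j x, hc i j x, hbc i j x, habc i j x⟩⟩
  obtain ⟨D, hD, h⟩ := hM
  refine ⟨D, hD, fun x => ?_⟩
  have h1 : (M.det x).1 = (Matrix.of fun i j => a i j x).det := by
    have := RingHom.map_det ((RingHom.fst ℂ (ℂ × ℂ)).comp (Pi.evalRingHom _ x)) M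
    exact this
  have h2 : (M.det x).2.1 = (Matrix.of fun i j => b i j x).det := by
    have := RingHom.map_det ((RingHom.fst ℂ ℂ).comp ((RingHom.snd ℂ (ℂ × ℂ)).comp
      (Pi.evalRingHom _ x))) M
    exact this
  have h3 : (M.det x).2.2 = (Matrix.of fun i j => c i j x).det := by
    have := RingHom.map_det ((RingHom.snd ℂ ℂ).comp ((RingHom.snd ℂ (ℂ × ℂ)).comp
      (Pi.evalRingHom _ x))) M
    exact this
  have := (h x).2.2.2.2
  rw [h1, h2, h3, hb0, hc0] at this
  simpa using this

end Triples

section Tube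

/-- Coordinates near a plane curve `ζ` with velocity close to `v`. -/
def tubeMap (ζ : ℝ → ℂ) (v : ℂ) (x : ℂ) : ℂ := ζ x.re + v * (x.im * Complex.I)

variable {ζ : ℝ → ℂ} {v : ℂ} {t₀ ε : ℝ}

theorem norm_tubeMap_sub_sub_le
    (hz : ∀ t ∈ Metric.ball t₀ ε, ∀ t' ∈ Metric.ball t₀ ε,
      ‖ζ t - ζ t' - v * (t - t' : ℝ)‖ ≤ ‖v‖ / 2 * |t - t'|) {x y : ℂ}
    (hx : x.re ∈ Metric.ball t₀ ε) (hy : y.re ∈ Metric.ball t₀ ε) :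
    ‖tubeMap ζ v x - tubeMap ζ v y - v * (x - y)‖ ≤ ‖v‖ / 2 * ‖x - y‖ := by
  have h := hz _ hx _ hy
  have h2 : |x.re - y.re| ≤ ‖x - y‖ := by simpa using Complex.abs_re_le_norm (x - y)
  have e : tubeMap ζ v x - tubeMap ζ v y - v * (x - y) =
      ζ x.re - ζ y.re - v * (x.re - y.re : ℝ) := by
    have hxy : x - y = (x.re - y.re : ℝ) + (x.im - y.im : ℝ) * Complex.I := by
      apply Complex.ext <;> simp
    unfold tubeMap
    rw [hxy]
    push_cast
    ring
  rw [e]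
  exact h.trans (by gcongr)

theorem le_norm_tubeMap_sub
    (hz : ∀ t ∈ Metric.ball t₀ ε, ∀ t' ∈ Metric.ball t₀ ε,
      ‖ζ t - ζ t' - v * (t - t' : ℝ)‖ ≤ ‖v‖ / 2 * |t - t'|) {x y : ℂ}
    (hx : x.re ∈ Metric.ball t₀ ε) (hy : y.re ∈ Metric.ball t₀ ε) :
    ‖v‖ / 2 * ‖x - y‖ ≤ ‖tubeMap ζ v x - tubeMap ζ v y‖ := by
  have h := norm_tubeMap_sub_sub_le hz hx hy
  have h2 := norm_sub_norm_le (v * (x - y)) (v * (x - y) - (tubeMap ζ v x - tubeMap ζ v y))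
  rw [norm_sub_rev (v * (x - y)), sub_sub_cancel, norm_mul] at h2
  linarith

theorem isOpen_image_tubeMap (hv : v ≠ 0)
    (hz : ∀ t ∈ Metric.ball t₀ ε, ∀ t' ∈ Metric.ball t₀ ε,
      ‖ζ t - ζ t' - v * (t - t' : ℝ)‖ ≤ ‖v‖ / 2 * |t - t'|) {S : Set ℂ} (hS : IsOpen S)
    (hSε : ∀ x ∈ S, x.re ∈ Metric.ball t₀ ε) : IsOpen (tubeMap ζ v '' S) := by
  let f' : ℂ →L[ℂ] ℂ := ContinuousLinearMap.mul ℂ ℂ v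
  have happ : ApproximatesLinearOn (tubeMap ζ v) f' S (‖v‖₊ / 2) := by
    intro x hx y hy
    simpa [f'] using norm_tubeMap_sub_sub_le hz (hSε x hx) (hSε y hy)
  let g : f'.NonlinearRightInverse :=
    { toFun := fun y => v⁻¹ * y
      nnnorm := ‖v‖₊⁻¹
      bound' := fun y => by simp
      right_inv' := fun y => by simp [f', hv] }
  refine happ.open_image g hS (Or.inr ?_)
  change ‖v‖₊ / 2 < (‖v‖₊⁻¹)⁻¹
  rw [inv_inv]
  exact NNReal.half_lt_self (by simpa using hv)

theorem injOn_tubeMap (hv : v ≠ 0)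
    (hz : ∀ t ∈ Metric.ball t₀ ε, ∀ t' ∈ Metric.ball t₀ ε,
      ‖ζ t - ζ t' - v * (t - t' : ℝ)‖ ≤ ‖v‖ / 2 * |t - t'|) :
    Set.InjOn (tubeMap ζ v) {x | x.re ∈ Metric.ball t₀ ε} := by
  intro x hx y hy h
  have := le_norm_tubeMap_sub hz hx hy
  rw [h, sub_self, norm_zero] at this
  have hv' : 0 < ‖v‖ := norm_pos_iff.2 hv
  have h0 : ‖x - y‖ ≤ 0 := by
    by_contra! hpos
    nlinarith
  exact sub_eq_zero.1 (norm_le_zero_iff.1 h0)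

theorem continuousOn_tubeMap
    (hz : ∀ t ∈ Metric.ball t₀ ε, ∀ t' ∈ Metric.ball t₀ ε,
      ‖ζ t - ζ t' - v * (t - t' : ℝ)‖ ≤ ‖v‖ / 2 * |t - t'|) :
    ContinuousOn (tubeMap ζ v) {x | x.re ∈ Metric.ball t₀ ε} := by
  have happ : ApproximatesLinearOn (tubeMap ζ v) (ContinuousLinearMap.mul ℂ ℂ v)
      {x | x.re ∈ Metric.ball t₀ ε} (‖v‖₊ / 2) := by
    intro x hx y hy
    simpa using norm_tubeMap_sub_sub_le hz hx hy
  exact happ.continuousOn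

theorem isPreconnected_image_tubeMap
    (hz : ∀ t ∈ Metric.ball t₀ ε, ∀ t' ∈ Metric.ball t₀ ε,
      ‖ζ t - ζ t' - v * (t - t' : ℝ)‖ ≤ ‖v‖ / 2 * |t - t'|) {J : Set ℝ} (hJ : Convex ℝ J) :
    IsPreconnected (tubeMap ζ v '' (Metric.ball t₀ ε ×ℂ J)) :=
  (((convex_ball t₀ ε).linear_preimage Complex.reLm).inter
    (hJ.linear_preimage Complex.imLm)).isPreconnected.image _
    ((continuousOn_tubeMap hz).mono fun _ hx => hx.1)

/-- A holomorphic function on one side of a curve which vanishes to first order at the curve is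
identically zero. -/
theorem eq_zero_of_norm_tubeMap_le (hv : v ≠ 0) (hε : 0 < ε)
    (hz : ∀ t ∈ Metric.ball t₀ ε, ∀ t' ∈ Metric.ball t₀ ε,
      ‖ζ t - ζ t' - v * (t - t' : ℝ)‖ ≤ ‖v‖ / 2 * |t - t'|) {D : ℂ → ℂ}
    (hD : ∀ x ∈ Metric.ball t₀ ε ×ℂ Set.Ioo 0 ε, DifferentiableAt ℂ D (tubeMap ζ v x)) {C : ℝ}
    (hC : ∀ x ∈ Metric.ball t₀ ε ×ℂ Set.Ioo 0 (ε / 2), ‖D (tubeMap ζ v x)‖ ≤ C * x.im) {x : ℂ}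
    (hx : x ∈ Metric.ball t₀ ε ×ℂ Set.Ioo 0 ε) : D (tubeMap ζ v x) = 0 := by
  classical
  set Ψ := tubeMap ζ v with hΨ
  set Sp : Set ℂ := Metric.ball t₀ ε ×ℂ Set.Ioo 0 ε with hSp
  set Sm : Set ℂ := Metric.ball t₀ ε ×ℂ Set.Ioo (-ε) 0 with hSm
  set S : Set ℂ := Metric.ball t₀ ε ×ℂ Set.Ioo (-ε) ε with hS
  have oSp : IsOpen (Ψ '' Sp) := isOpen_image_tubeMap hv hz
    (Metric.isOpen_ball.reProdIm isOpen_Ioo) fun _ h => h.1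
  have oSm : IsOpen (Ψ '' Sm) := isOpen_image_tubeMap hv hz
    (Metric.isOpen_ball.reProdIm isOpen_Ioo) fun _ h => h.1
  have oS : IsOpen (Ψ '' S) := isOpen_image_tubeMap hv hz
    (Metric.isOpen_ball.reProdIm isOpen_Ioo) fun _ h => h.1
  have hinj := injOn_tubeMap hv hz
  let T : ℂ → ℂ := fun a => if a ∈ Ψ '' Sp then D a ^ 2 else 0
  have hTp : ∀ y ∈ Sp, T (Ψ y) = D (Ψ y) ^ 2 := fun y hy => if_pos ⟨y, hy, rfl⟩
  have hT0 : ∀ y ∈ S, y.im ≤ 0 → T (Ψ y) = 0 := by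
    intro y hy hy0
    refine if_neg ?_
    rintro ⟨z, hz', hzy⟩
    have : z = y := hinj hz'.1 hy.1 hzy
    subst this
    exact absurd hz'.2.1 (not_lt.2 hy0)
  have hdiff : DifferentiableOn ℂ T (Ψ '' S) := by
    rintro _ ⟨y, hy, rfl⟩
    apply DifferentiableAt.differentiableWithinAt
    rcases lt_trichotomy y.im 0 with h | h | h
    · have hmem : Ψ y ∈ Ψ '' Sm := ⟨y, ⟨hy.1, hy.2.1, h⟩, rfl⟩
      have : T =ᶠ[𝓝 (Ψ y)] fun _ => 0 := by
        filter_upwards [oSm.mem_nhds hmem]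
        rintro _ ⟨z, hz', rfl⟩
        exact hT0 z ⟨hz'.1, hz'.2.1, hz'.2.2.trans hε⟩ hz'.2.2.le
      exact (differentiableAt_const (0 : ℂ)).congr_of_eventuallyEq this
    · have hfd : HasFDerivAt T (0 : ℂ →L[ℂ] ℂ) (Ψ y) := by
        refine Asymptotics.IsBigO.hasFDerivAt (n := 2) ?_ one_lt_two
        have hv' : 0 < ‖v‖ := norm_pos_iff.2 hv
        have hnear : ∀ᶠ b in 𝓝 (Ψ y), ‖b - Ψ y‖ < ‖v‖ / 2 * (ε / 2) := by
          have := Metric.ball_mem_nhds (Ψ y) (ε := ‖v‖ / 2 * (ε / 2)) (by positivity)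
          filter_upwards [this] with b hb
          rwa [← dist_eq_norm]
        refine Asymptotics.IsBigO.of_bound ((|C| / (‖v‖ / 2)) ^ 2) ?_
        filter_upwards [oS.mem_nhds ⟨y, hy, rfl⟩, hnear]
        rintro _ ⟨z, hz', rfl⟩ hb
        rw [norm_pow, norm_norm]
        rcases le_or_gt z.im 0 with h0 | h0
        · rw [hT0 z hz' h0, norm_zero]
          positivity
        · have hlow := le_norm_tubeMap_sub hz hz'.1 hy.1
          have him : z.im ≤ ‖z - y‖ := by
            have := Complex.abs_im_le_norm (z - y)
            rw [Complex.sub_im, h, sub_zero] at this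
            exact (le_abs_self _).trans this
          have hle : z.im ≤ ‖Ψ z - Ψ y‖ / (‖v‖ / 2) := by
            rw [le_div_iff₀ (by positivity)]
            refine le_trans ?_ hlow
            rw [mul_comm]
            gcongr
          have hlt : z.im < ε / 2 := by
            refine hle.trans_lt ?_
            rw [div_lt_iff₀ (by positivity)]
            linarith
          have hb' := hC z ⟨hz'.1, h0, hlt⟩
          rw [hTp z ⟨hz'.1, h0, hz'.2.2⟩, norm_pow, ← mul_pow]
          gcongr
          refine hb'.trans ?_
          calc C * z.im ≤ |C| * z.im := by gcongr; exact le_abs_self C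
            _ ≤ |C| * (‖Ψ z - Ψ y‖ / (‖v‖ / 2)) := by gcongr
            _ = _ := by ring
      exact hfd.differentiableAt
    · have hmem : Ψ y ∈ Ψ '' Sp := ⟨y, ⟨hy.1, h, hy.2.2⟩, rfl⟩
      have : T =ᶠ[𝓝 (Ψ y)] fun a => D a ^ 2 := by
        filter_upwards [oSp.mem_nhds hmem]
        rintro _ ⟨z, hz', rfl⟩
        exact hTp z hz'
      exact ((hD y ⟨hy.1, h, hy.2.2⟩).pow 2).congr_of_eventuallyEq this
  have han := hdiff.analyticOnNhd oS
  let y₀ : ℂ := ⟨t₀, -(ε / 2)⟩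
  have hy₀ : y₀ ∈ Sm := ⟨by simpa [y₀] using hε, by simp only [y₀]; constructor <;> linarith⟩
  have hy₀S : y₀ ∈ S := ⟨hy₀.1, hy₀.2.1, hy₀.2.2.trans hε⟩
  have hev : T =ᶠ[𝓝 (Ψ y₀)] 0 := by
    filter_upwards [oSm.mem_nhds ⟨y₀, hy₀, rfl⟩]
    rintro _ ⟨z, hz', rfl⟩
    exact hT0 z ⟨hz'.1, hz'.2.1, hz'.2.2.trans hε⟩ hz'.2.2.le
  have hzero := han.eqOn_zero_of_preconnected_of_eventuallyEq_zero
    (isPreconnected_image_tubeMap hz (convex_Ioo _ _)) ⟨y₀, hy₀S, rfl⟩ hev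
  have hxS : x ∈ S := ⟨hx.1, by linarith [hx.2.1], hx.2.2⟩
  have := hzero ⟨x, hxS, rfl⟩
  rw [hTp x hx] at this
  exact pow_eq_zero_iff two_ne_zero |>.1 this

end Tube

section Separation

theorem exists_tube_separation {X : Type*} {L : X → ℂ} {c : ℝ → X} {t₀ ρ : ℝ} (hρ : 0 < ρ)
    (hL : ∀ t ∈ Metric.ball t₀ ρ, ContDiffAt ℝ (⊤ : ℕ∞) (fun t => L (c t)) t) {v : ℂ}
    (hv : deriv (fun t => L (c t)) t₀ = v) (hv0 : v ≠ 0)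
    (hsimple : ∀ ε > 0, ∃ r > 0, ∀ x, ‖L x - L (c t₀)‖ < r → ∃ t, |t - t₀| < ε ∧ x = c t) :
    ∃ ε₀ ε₁ r, 0 < ε₀ ∧ ε₀ ≤ ε₁ ∧ ε₁ < ρ ∧ 0 < r ∧
      (∀ t ∈ Metric.ball t₀ ε₁, ∀ t' ∈ Metric.ball t₀ ε₁,
        ‖L (c t) - L (c t') - v * (t - t' : ℝ)‖ ≤ ‖v‖ / 2 * |t - t'|) ∧
      (∀ t ∈ Metric.ball t₀ ε₁, ‖v‖ / 2 ≤ ‖deriv (fun t => L (c t)) t‖) ∧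
      (∀ t ∈ Metric.ball t₀ ε₀, ∀ x, (∃ t' ∈ Metric.ball t₀ ε₁, x = c t') ∨ r ≤ ‖L x - L (c t)‖) ∧
      (∀ t ∈ Metric.ball t₀ ε₀, ∀ s : ℝ, |s| < 2 * ε₀ → ∀ x,
        ‖v * (s * Complex.I)‖ / 3 ≤ ‖L x - L (c t) - v * (s * Complex.I)‖ ∧
        ‖L x - L (c t)‖ / 3 ≤ ‖L x - L (c t) - v * (s * Complex.I)‖) := by
  set ζ : ℝ → ℂ := fun t => L (c t) with hζ
  have hv' : 0 < ‖v‖ := norm_pos_iff.2 hv0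
  have h0 := hL t₀ (Metric.mem_ball_self hρ)
  have hstrict : HasStrictDerivAt ζ v t₀ := by
    have := h0.hasStrictDerivAt (by simp)
    rwa [hv] at this
  have hev : ∀ᶠ p : ℝ × ℝ in 𝓝 (t₀, t₀),
      ‖ζ p.1 - ζ p.2 - v * (p.1 - p.2 : ℝ)‖ ≤ ‖v‖ / 2 * |p.1 - p.2| := by
    have := (hasStrictDerivAt_iff_hasStrictFDerivAt.1 hstrict).isLittleO.bound
      (show 0 < ‖v‖ / 2 by positivity)
    filter_upwards [this] with p hp
    simpa [mul_comm] using hp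
  obtain ⟨ε₁, hε₁, h₁⟩ : ∃ ε₁ > 0, ∀ t ∈ Metric.ball t₀ ε₁, ∀ t' ∈ Metric.ball t₀ ε₁,
      ‖ζ t - ζ t' - v * (t - t' : ℝ)‖ ≤ ‖v‖ / 2 * |t - t'| := by
    obtain ⟨ε₁, hε₁, h⟩ := Metric.eventually_nhds_iff_ball.1 hev
    refine ⟨ε₁, hε₁, fun t ht t' ht' => h (t, t') ?_⟩
    rw [← ball_prod_same]
    exact ⟨ht, ht'⟩
  obtain ⟨ε₂, hε₂, h₂⟩ : ∃ ε₂ > 0, ∀ t ∈ Metric.ball t₀ ε₂, ‖v‖ / 2 ≤ ‖deriv ζ t‖ := by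
    have hcont : ContinuousAt (fun t => ‖deriv ζ t‖) t₀ := (contDiffAt_deriv h0).continuousAt.norm
    have : ∀ᶠ t in 𝓝 t₀, ‖v‖ / 2 < ‖deriv ζ t‖ := by
      apply hcont.eventually (lt_mem_nhds _)
      change ‖v‖ / 2 < ‖deriv ζ t₀‖
      rw [hv]
      linarith
    obtain ⟨ε₂, hε₂, h⟩ := Metric.eventually_nhds_iff_ball.1 this
    exact ⟨ε₂, hε₂, fun t ht => (h t ht).le⟩
  obtain ⟨ε₃, hε₃, hl31, hl32, hl3ρ⟩ : ∃ ε₃ > 0, ε₃ ≤ ε₁ ∧ ε₃ ≤ ε₂ ∧ ε₃ < ρ :=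
    ⟨min (min ε₁ ε₂) (ρ / 2), by positivity, (min_le_left _ _).trans (min_le_left _ _),
      (min_le_left _ _).trans (min_le_right _ _), (min_le_right _ _).trans_lt (by linarith)⟩
  replace h₁ : ∀ t ∈ Metric.ball t₀ ε₃, ∀ t' ∈ Metric.ball t₀ ε₃,
      ‖ζ t - ζ t' - v * (t - t' : ℝ)‖ ≤ ‖v‖ / 2 * |t - t'| := fun t ht t' ht' =>
    h₁ t (Metric.ball_subset_ball hl31 ht) t' (Metric.ball_subset_ball hl31 ht')
  replace h₂ : ∀ t ∈ Metric.ball t₀ ε₃, ‖v‖ / 2 ≤ ‖deriv ζ t‖ := fun t ht =>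
    h₂ t (Metric.ball_subset_ball hl32 ht)
  obtain ⟨r, hr, hsr⟩ := hsimple ε₃ hε₃
  obtain ⟨ε₀, hε₀, hl1, hlr⟩ : ∃ ε₀ > 0, ε₀ ≤ ε₃ ∧ 8 * ‖v‖ * ε₀ ≤ r := by
    refine ⟨min ε₃ (r / (8 * ‖v‖)), by positivity, min_le_left _ _, ?_⟩
    have : min ε₃ (r / (8 * ‖v‖)) ≤ r / (8 * ‖v‖) := min_le_right _ _
    rw [le_div_iff₀ (by positivity)] at this
    linarith
  have hb1 := Metric.ball_subset_ball (x := t₀) hl1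
  have hupper : ∀ t ∈ Metric.ball t₀ ε₃, ∀ t' ∈ Metric.ball t₀ ε₃,
      ‖ζ t - ζ t'‖ ≤ 3 / 2 * ‖v‖ * |t - t'| := by
    intro t ht t' ht'
    have h1 := h₁ t ht t' ht'
    have h2 := norm_le_norm_add_norm_sub' (ζ t - ζ t') (v * (t - t' : ℝ))
    rw [norm_mul, Complex.norm_real, Real.norm_eq_abs] at h2
    linarith
  have hfar : ∀ t ∈ Metric.ball t₀ ε₀, ∀ x, r ≤ ‖L x - L (c t₀)‖ →
      r * (3 / 4) ≤ ‖L x - L (c t)‖ := by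
    intro t ht x hx
    have hup := hupper t (hb1 ht) t₀ (Metric.mem_ball_self hε₃)
    have ht2 : |t - t₀| ≤ ε₀ := by
      rw [Metric.mem_ball, Real.dist_eq] at ht
      exact ht.le
    have hup2 : ‖L (c t) - L (c t₀)‖ ≤ r / 4 := by
      change ‖ζ t - ζ t₀‖ ≤ _
      nlinarith
    have := norm_sub_le_norm_sub_add_norm_sub (L x) (L (c t)) (L (c t₀))
    linarith
  refine ⟨ε₀, ε₃, r * (3 / 4), hε₀, hl1, hl3ρ, by positivity, h₁, h₂, fun t ht x => ?_,
    fun t ht s hs x => ?_⟩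
  · by_cases hx : ‖L x - L (c t₀)‖ < r
    · obtain ⟨t', ht', rfl⟩ := hsr x hx
      exact Or.inl ⟨t', by rwa [Metric.mem_ball, Real.dist_eq], rfl⟩
    · push Not at hx
      exact Or.inr (hfar t ht x hx)
  have hnorm : ‖v * (s * Complex.I)‖ = ‖v‖ * |s| := by simp
  have hsr' : ‖v‖ * |s| ≤ r / 4 := by nlinarith
  by_cases hx : ‖L x - L (c t₀)‖ < r
  · obtain ⟨t', ht', rfl⟩ := hsr x hx
    have ht'b : t' ∈ Metric.ball t₀ ε₃ := by rwa [Metric.mem_ball, Real.dist_eq]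
    let p : ℂ := ⟨t, s⟩
    have key := le_norm_tubeMap_sub h₁ (x := (t' : ℂ)) (y := p) (by simpa using ht'b) (hb1 ht)
    have e1 : tubeMap ζ v t' - tubeMap ζ v p = L (c t') - L (c t) - v * (s * Complex.I) := by
      simp [tubeMap, p, hζ]
      ring
    rw [e1] at key
    have hre : |t' - t| ≤ ‖(t' : ℂ) - p‖ := by
      simpa [p] using Complex.abs_re_le_norm ((t' : ℂ) - p)
    have him : |s| ≤ ‖(t' : ℂ) - p‖ := by
      simpa [p] using Complex.abs_im_le_norm ((t' : ℂ) - p)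
    have hup := hupper t' ht'b t (hb1 ht)
    rw [hnorm]
    have him' := mul_le_mul_of_nonneg_left him hv'.le
    have hre' := mul_le_mul_of_nonneg_left hre hv'.le
    constructor
    · linarith [mul_nonneg hv'.le (norm_nonneg ((t' : ℂ) - p))]
    · change ‖ζ t' - ζ t‖ / 3 ≤ _
      linarith
  · push Not at hx
    have hy := hfar t ht x hx
    have h3 := norm_sub_norm_le (L x - L (c t)) (v * (s * Complex.I))
    rw [hnorm] at h3 ⊢
    constructor <;> linarith

end Separation

section Resolvent

theorem resolvent_difference_bounds {u y η : ℂ} {C B : ℝ} (hC : 0 ≤ C) (hB : 0 ≤ B) (hη : η ≠ 0)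
    (hu : ‖u‖ ≤ C * ‖y‖ ^ 3) (hy : ‖y‖ ≤ B)
    (h1 : ‖η‖ / 3 ≤ ‖y - η‖ ∧ ‖y‖ / 3 ≤ ‖y - η‖) (h2 : ‖η‖ / 3 ≤ ‖y + η‖ ∧ ‖y‖ / 3 ≤ ‖y + η‖)
    (h3 : ‖η‖ / 3 ≤ ‖y + 2 * η‖ ∧ ‖y‖ / 3 ≤ ‖y + 2 * η‖) :
    ‖u / (y - η)‖ ≤ 3 * C * B ^ 2 ∧ ‖u / (y + η)‖ ≤ 3 * C * B ^ 2 ∧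
      ‖u / (y + 2 * η)‖ ≤ 3 * C * B ^ 2 ∧
      ‖u / (y + η) - u / (y + 2 * η)‖ ≤ 9 * C * B * ‖η‖ ∧
      ‖u / (y - η) - 3 * (u / (y + η)) + 2 * (u / (y + 2 * η))‖ ≤ 162 * C * ‖η‖ ^ 2 := by
  have hη' : 0 < ‖η‖ := norm_pos_iff.2 hη
  have p1 : 0 < ‖y - η‖ := lt_of_lt_of_le (by positivity) h1.1
  have p2 : 0 < ‖y + η‖ := lt_of_lt_of_le (by positivity) h2.1
  have p3 : 0 < ‖y + 2 * η‖ := lt_of_lt_of_le (by positivity) h3.1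
  have n1 := norm_pos_iff.1 p1
  have n2 := norm_pos_iff.1 p2
  have n3 := norm_pos_iff.1 p3
  have basic : ∀ z : ℂ, 0 < ‖z‖ → ‖y‖ / 3 ≤ ‖z‖ → ‖u / z‖ ≤ 3 * C * B ^ 2 := by
    intro z hz hyz
    rw [norm_div, div_le_iff₀ hz]
    calc ‖u‖ ≤ C * ‖y‖ ^ 3 := hu
      _ = 3 * C * ‖y‖ ^ 2 * (‖y‖ / 3) := by ring
      _ ≤ 3 * C * B ^ 2 * ‖z‖ := by gcongr
  refine ⟨basic _ p1 h1.2, basic _ p2 h2.2, basic _ p3 h3.2, ?_, ?_⟩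
  · have e : u / (y + η) - u / (y + 2 * η) = u * η / ((y + η) * (y + 2 * η)) := by
      rw [div_sub_div _ _ n2 n3]
      congr 1
      ring
    rw [e, norm_div, norm_mul, norm_mul, div_le_iff₀ (by positivity)]
    calc ‖u‖ * ‖η‖ ≤ C * ‖y‖ ^ 3 * ‖η‖ := by gcongr
      _ = 9 * C * ‖y‖ * ‖η‖ * ((‖y‖ / 3) * (‖y‖ / 3)) := by ring
      _ ≤ 9 * C * B * ‖η‖ * (‖y + η‖ * ‖y + 2 * η‖) := by
        gcongr
        exacts [h2.2, h3.2]
  · have e : u / (y - η) - 3 * (u / (y + η)) + 2 * (u / (y + 2 * η)) =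
        6 * u * η ^ 2 / ((y - η) * (y + η) * (y + 2 * η)) := by
      obtain ⟨z, hz⟩ : ∃ z, z = y + 2 * η := ⟨_, rfl⟩
      rw [← hz] at n3 ⊢
      field_simp
      rw [hz]
      ring
    rw [e, norm_div]
    simp only [norm_mul, norm_pow, Complex.norm_ofNat]
    rw [div_le_iff₀ (by positivity)]
    calc 6 * ‖u‖ * ‖η‖ ^ 2 ≤ 6 * (C * ‖y‖ ^ 3) * ‖η‖ ^ 2 := by gcongr
      _ = 162 * C * ‖η‖ ^ 2 * ((‖y‖ / 3) * (‖y‖ / 3) * (‖y‖ / 3)) := by ring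
      _ ≤ 162 * C * ‖η‖ ^ 2 * (‖y - η‖ * ‖y + η‖ * ‖y + 2 * η‖) := by
        gcongr
        exacts [h1.2, h2.2, h3.2]

end Resolvent

section Crossing

theorem ringInverse_continuousMap_apply {X : Type*} [TopologicalSpace X] {F : C(X, ℂ)}
    (h : ∀ x, F x ≠ 0) (x : X) : Ring.inverse F x = (F x)⁻¹ := by
  have := congrArg (fun G : C(X, ℂ) => G x)
    (Ring.inverse_mul_cancel F ((ContinuousMap.isUnit_iff_forall_ne_zero F).2 h))
  exact eq_inv_of_mul_eq_one_left (by simpa using this)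

theorem Matrix.det_eq_of_forall_succ_eq_add_mul_zero {R : Type*} [CommRing R] {n : ℕ}
    {M N : Matrix (Fin (n + 1)) (Fin (n + 1)) R} (k : Fin n → R) (h0 : ∀ i, M i 0 = N i 0)
    (hs : ∀ i j, M i (Fin.succ j) = N i (Fin.succ j) + k j * N i 0) : M.det = N.det := by
  rw [← Matrix.det_transpose M, ← Matrix.det_transpose N]
  refine Matrix.det_eq_of_forall_row_eq_smul_add_const (Fin.cons 0 k) 0 rfl fun i j => ?_
  refine Fin.cases ?_ (fun i => ?_) i
  · simp [h0]
  · simp [hs]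

theorem norm_det_le_of_minors {n : ℕ} {M : Matrix (Fin (n + 1)) (Fin (n + 1)) ℂ} {p q : ℝ}
    (hp : ∀ i, ‖M i 0‖ ≤ p) (hq : ∀ i : Fin (n + 1), ‖(M.submatrix i.succAbove Fin.succ).det‖ ≤ q) :
    ‖M.det‖ ≤ (n + 1) * (p * q) := by
  rw [Matrix.det_succ_column_zero]
  refine (norm_sum_le _ _).trans ?_
  have : ∀ i ∈ (Finset.univ : Finset (Fin (n + 1))),
      ‖(-1) ^ (i : ℕ) * M i 0 * (M.submatrix i.succAbove Fin.succ).det‖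
      ≤ p * q := by
    intro i _
    rw [norm_mul, norm_mul, norm_pow, norm_neg, norm_one, one_pow, one_mul]
    exact mul_le_mul (hp i) (hq i) (norm_nonneg _) ((norm_nonneg _).trans (hp i))
  refine (Finset.sum_le_card_nsmul _ _ _ this).trans ?_
  simp

theorem exists_cubic_bound {X : Type*} [TopologicalSpace X] [CompactSpace X] {g L : C(X, ℂ)}
    {c : ℝ → X} {t₀ ρ ε₀ ε₁ r κ : ℝ} (hε₀₁ : ε₀ ≤ ε₁) (hε₁ : ε₁ < ρ) (hr : 0 < r) (hκ : 0 < κ)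
    (hg : ∀ t ∈ Metric.ball t₀ ρ, ContDiffAt ℝ (⊤ : ℕ∞) (fun t => g (c t)) t)
    (hL : ∀ t ∈ Metric.ball t₀ ρ, ContDiffAt ℝ (⊤ : ℕ∞) (fun t => L (c t)) t)
    (hlow : ∀ t ∈ Metric.ball t₀ ε₁, ∀ t' ∈ Metric.ball t₀ ε₁,
      κ * |t - t'| ≤ ‖L (c t) - L (c t')‖)
    (hder : ∀ t ∈ Metric.ball t₀ ε₁, κ ≤ ‖deriv (fun t => L (c t)) t‖)
    (hsep : ∀ t ∈ Metric.ball t₀ ε₀, ∀ x,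
      (∃ t' ∈ Metric.ball t₀ ε₁, x = c t') ∨ r ≤ ‖L x - L (c t)‖) :
    ∃ F c₁ c₂ : ℝ → ℂ, ∃ C, 0 ≤ C ∧ ∀ t ∈ Metric.ball t₀ ε₀, ∀ x,
      ‖g x - F t - c₁ t * (L x - L (c t)) - c₂ t * (L x - L (c t)) ^ 2‖
        ≤ C * ‖L x - L (c t)‖ ^ 3 := by
  obtain ⟨c₁, c₂, C, h⟩ := exists_quadratic_approx hε₁ hκ hg hL hder
  by_cases hne : (Metric.ball t₀ ε₁).Nonempty
  swap
  · rw [Set.not_nonempty_iff_eq_empty] at hne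
    refine ⟨0, 0, 0, 0, le_rfl, fun t ht => ?_⟩
    have := Metric.ball_subset_ball hε₀₁ ht
    simp [hne] at this
  obtain ⟨t₁, ht₁⟩ := hne
  have hC : 0 ≤ C := (norm_nonneg _).trans (h t₁ ht₁).1
  set M : ℝ := ‖g‖ + C + C * (2 * ‖L‖) + C * (2 * ‖L‖) ^ 2 with hM
  have hM0 : 0 ≤ M := by positivity
  refine ⟨fun t => g (c t), c₁, c₂, C / κ ^ 3 + M / r ^ 3, by positivity, fun t ht x => ?_⟩
  obtain ⟨b0, b1, b2, h⟩ := h t (Metric.ball_subset_ball hε₀₁ ht)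
  have hY : ‖L x - L (c t)‖ ≤ 2 * ‖L‖ := by
    have := norm_sub_le (L x) (L (c t))
    have := L.norm_coe_le_norm x
    have := L.norm_coe_le_norm (c t)
    linarith
  set y := L x - L (c t) with hy
  rw [add_mul]
  rcases hsep t ht x with ⟨t', ht', rfl⟩ | hfar
  · have h1 := h t' ht'
    have h2 := hlow t' ht' t (Metric.ball_subset_ball hε₀₁ ht)
    have h3 : |t' - t| ^ 3 ≤ (‖y‖ / κ) ^ 3 := by
      gcongr
      rw [le_div_iff₀ hκ]
      linarith
    have h4 : C * |t' - t| ^ 3 ≤ C / κ ^ 3 * ‖y‖ ^ 3 := by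
      calc _ ≤ C * (‖y‖ / κ) ^ 3 := by gcongr
        _ = _ := by rw [div_pow]; ring
    have h5 : 0 ≤ M / r ^ 3 * ‖y‖ ^ 3 := by positivity
    linarith
  · have h1 : ‖g x - g (c t) - c₁ t * y - c₂ t * y ^ 2‖ ≤ M := by
      have e1 := norm_sub_le (g x - g (c t) - c₁ t * y) (c₂ t * y ^ 2)
      have e2 := norm_sub_le (g x - g (c t)) (c₁ t * y)
      have e3 := norm_sub_le (g x) (g (c t))
      have e4 := g.norm_coe_le_norm x
      have e5 : ‖c₁ t * y‖ ≤ C * (2 * ‖L‖) := by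
        rw [norm_mul]
        gcongr
      have e6 : ‖c₂ t * y ^ 2‖ ≤ C * (2 * ‖L‖) ^ 2 := by
        rw [norm_mul, norm_pow]
        gcongr
      linarith
    have h2 : M ≤ M / r ^ 3 * ‖y‖ ^ 3 := by
      calc M = M / r ^ 3 * r ^ 3 := by field_simp
        _ ≤ _ := by gcongr
    have h3 : 0 ≤ C / κ ^ 3 * ‖y‖ ^ 3 := by positivity
    change ‖g x - g (c t) - c₁ t * y - c₂ t * y ^ 2‖ ≤ _
    linarith

end Crossing

section HalfCrossing

variable {X : Type*} [TopologicalSpace X] [CompactSpace X] {A : Subalgebra ℂ C(X, ℂ)}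

theorem norm_apply_le_of_forall_norm_le {σ : C(X, ℂ) →L[ℂ] ℂ} {S B : ℝ} (hS : ‖σ‖ ≤ S) (hB : 0 ≤ B)
    {φ : C(X, ℂ)} (hφ : ∀ x, ‖φ x‖ ≤ B) : ‖σ φ‖ ≤ S * B := by
  refine (σ.le_opNorm φ).trans ?_
  have : ‖φ‖ ≤ B := (ContinuousMap.norm_le _ hB).2 hφ
  exact mul_le_mul hS this (norm_nonneg _) ((norm_nonneg _).trans hS)

set_option maxHeartbeats 800000 in
theorem exists_norm_resolvent_det_le {L : A} {ζ : ℝ → ℂ} {v : ℂ} {t₀ ε B : ℝ} (hv0 : v ≠ 0)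
    (hB0 : 0 ≤ B) (hB : ∀ t ∈ Metric.ball t₀ ε, ∀ x, ‖(L : C(X, ℂ)) x - ζ t‖ ≤ B)
    (hsep : ∀ t ∈ Metric.ball t₀ ε, ∀ s : ℝ, |s| < 2 * ε → ∀ x,
        ‖v * (s * Complex.I)‖ / 3 ≤ ‖(L : C(X, ℂ)) x - ζ t - v * (s * Complex.I)‖ ∧
        ‖(L : C(X, ℂ)) x - ζ t‖ / 3 ≤ ‖(L : C(X, ℂ)) x - ζ t - v * (s * Complex.I)‖)
    {m : ℕ} (g : Fin (m + 1) → A)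
    (hcubic : ∀ j, ∃ F c₁ c₂ : ℝ → ℂ, ∃ C, 0 ≤ C ∧ ∀ t ∈ Metric.ball t₀ ε, ∀ x,
      ‖(g j : C(X, ℂ)) x - F t - c₁ t * ((L : C(X, ℂ)) x - ζ t)
        - c₂ t * ((L : C(X, ℂ)) x - ζ t) ^ 2‖ ≤ C * ‖(L : C(X, ℂ)) x - ζ t‖ ^ 3)
    (hm : ∀ t ∈ Metric.ball t₀ ε, ∀ s ∈ Set.Ioo 0 ε,
      mulIndex A (L - algebraMap ℂ A (ζ t - v * (s * Complex.I))) ≤ m)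
    (σ : Fin (m + 2) → C(X, ℂ) →L[ℂ] ℂ) (hσ : ∀ i, ∀ g : A, σ i g = 0) :
    ∃ D, ∀ t ∈ Metric.ball t₀ ε, ∀ s ∈ Set.Ioo 0 (ε / 2),
      ‖(Matrix.of fun i j => σ i (((Fin.cons 1 g : Fin (m + 2) → A) j : C(X, ℂ)) *
        Ring.inverse ((L : C(X, ℂ)) - algebraMap ℂ C(X, ℂ) (ζ t + v * (s * Complex.I))))).det‖
        ≤ D * s := by
  choose F c₁ c₂ C hC hcub using hcubic
  set C' : ℝ := ∑ j, C j with hC'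
  have hC'0 : 0 ≤ C' := Finset.sum_nonneg fun j _ => hC j
  have hCC' : ∀ j, C j ≤ C' := fun j =>
    Finset.single_le_sum (f := C) (fun j _ => hC j) (Finset.mem_univ j)
  set S : ℝ := ∑ i, ‖σ i‖ with hS
  have hS0 : 0 ≤ S := Finset.sum_nonneg fun j _ => norm_nonneg _
  have hSS : ∀ i, ‖σ i‖ ≤ S := fun i =>
    Finset.single_le_sum (f := fun i => ‖σ i‖) (fun j _ => norm_nonneg _) (Finset.mem_univ i)
  let Y : ℝ → A := fun t => L - algebraMap ℂ A (ζ t)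
  have hY : ∀ t x, (Y t : C(X, ℂ)) x = (L : C(X, ℂ)) x - ζ t := fun t x => by simp [Y]
  let u : Fin (m + 1) → ℝ → A := fun j t =>
    g j - algebraMap ℂ A (F j t) - c₁ j t • Y t - c₂ j t • Y t ^ 2
  have hu : ∀ j t x, (u j t : C(X, ℂ)) x = (g j : C(X, ℂ)) x - F j t
      - c₁ j t * ((L : C(X, ℂ)) x - ζ t) - c₂ j t * ((L : C(X, ℂ)) x - ζ t) ^ 2 := by
    intro j t x
    simp [u, ← hY]
  let R : ℝ → ℂ → C(X, ℂ) := fun t w =>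
    Ring.inverse ((L : C(X, ℂ)) - algebraMap ℂ C(X, ℂ) (ζ t + w))
  let η : ℝ → ℂ := fun s => v * (s * Complex.I)
  have hηnorm : ∀ s : ℝ, 0 < s → ‖η s‖ = ‖v‖ * s := fun s hs => by simp [η, abs_of_pos hs]
  have hη0 : ∀ s : ℝ, 0 < s → η s ≠ 0 := fun s hs => by
    simp [η, hv0, hs.ne']
  have hpos : ∀ t ∈ Metric.ball t₀ ε, ∀ s : ℝ, |s| < 2 * ε → s ≠ 0 → ∀ x,
      ((L : C(X, ℂ)) - algebraMap ℂ C(X, ℂ) (ζ t + η s)) x ≠ 0 := by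
    intro t ht s hs hs0 x h
    have h1 := (hsep t ht s hs x).1
    have h2 : (L : C(X, ℂ)) x - ζ t - v * (s * Complex.I) = 0 := by
      have : (L : C(X, ℂ)) x - (ζ t + v * (s * Complex.I)) = 0 := by simpa [η] using h
      linear_combination this
    rw [h2, norm_zero] at h1
    have : 0 < ‖v * (s * Complex.I)‖ := by simp [hv0, hs0]
    linarith
  have hR : ∀ t ∈ Metric.ball t₀ ε, ∀ s : ℝ, |s| < 2 * ε → s ≠ 0 → ∀ x,
      R t (η s) x = ((L : C(X, ℂ)) x - ζ t - η s)⁻¹ := by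
    intro t ht s hs hs0 x
    simp only [R]
    rw [ringInverse_continuousMap_apply (hpos t ht s hs hs0)]
    congr 1
    simp [sub_sub]
  -- pointwise bounds for the resolvents
  have hneg : ∀ s : ℝ, η (-s) = -η s := fun s => by simp [η]
  have hneg2 : ∀ s : ℝ, η (-(2 * s)) = -(2 * η s) := fun s => by simp [η]; ring
  have hrange : ∀ s ∈ Set.Ioo 0 (ε / 2),
      (|s| < 2 * ε ∧ s ≠ 0) ∧ (|(-s)| < 2 * ε ∧ -s ≠ 0) ∧
        (|(-(2 * s))| < 2 * ε ∧ -(2 * s) ≠ 0) := by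
    rintro s ⟨h0, h1⟩
    refine ⟨⟨?_, by linarith⟩, ⟨?_, by linarith⟩, ⟨?_, by linarith⟩⟩ <;>
      rw [abs_lt] <;> constructor <;> linarith
  have hbounds : ∀ t ∈ Metric.ball t₀ ε, ∀ s ∈ Set.Ioo 0 (ε / 2), ∀ j x,
      ‖((u j t : C(X, ℂ)) * R t (η s)) x‖ ≤ 3 * C' * B ^ 2 ∧
      ‖((u j t : C(X, ℂ)) * R t (-η s)) x‖ ≤ 3 * C' * B ^ 2 ∧
      ‖((u j t : C(X, ℂ)) * R t (-(2 * η s))) x‖ ≤ 3 * C' * B ^ 2 ∧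
      ‖((u j t : C(X, ℂ)) * R t (-η s) - (u j t : C(X, ℂ)) * R t (-(2 * η s))) x‖
        ≤ 9 * C' * B * ‖η s‖ ∧
      ‖((u j t : C(X, ℂ)) * R t (η s) - (3 : ℂ) • ((u j t : C(X, ℂ)) * R t (-η s))
        + (2 : ℂ) • ((u j t : C(X, ℂ)) * R t (-(2 * η s)))) x‖ ≤ 162 * C' * ‖η s‖ ^ 2 := by
    intro t ht s hs j x
    obtain ⟨⟨r1, r1'⟩, ⟨r2, r2'⟩, ⟨r3, r3'⟩⟩ := hrange s hs
    have e1 := hR t ht s r1 r1' x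
    have e2 := hR t ht _ r2 r2' x
    have e3 := hR t ht _ r3 r3' x
    rw [hneg] at e2
    rw [hneg2] at e3
    have k1 := hsep t ht s r1 x
    have k2 := hsep t ht _ r2 x
    have k3 := hsep t ht _ r3 x
    change ‖η s‖ / 3 ≤ ‖_ - η s‖ ∧ _ ≤ ‖_ - η s‖ at k1
    change ‖η (-s)‖ / 3 ≤ ‖_ - η (-s)‖ ∧ _ ≤ ‖_ - η (-s)‖ at k2
    change ‖η (-(2 * s))‖ / 3 ≤ ‖_ - η (-(2 * s))‖ ∧ _ ≤ ‖_ - η (-(2 * s))‖ at k3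
    rw [hneg, norm_neg, sub_neg_eq_add] at k2
    rw [hneg2, norm_neg, sub_neg_eq_add, norm_mul, Complex.norm_ofNat] at k3
    have hcu : ‖(u j t : C(X, ℂ)) x‖ ≤ C' * ‖(L : C(X, ℂ)) x - ζ t‖ ^ 3 := by
      rw [hu]
      refine (hcub j t ht x).trans ?_
      gcongr
      exact hCC' j
    have := resolvent_difference_bounds hC'0 hB0 (hη0 s hs.1) hcu (hB t ht x) k1 k2
      ⟨by linarith [k3.1, norm_nonneg (η s)], k3.2⟩
    simpa only [ContinuousMap.mul_apply, ContinuousMap.sub_apply, ContinuousMap.add_apply,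
      ContinuousMap.smul_apply, e1, e2, e3, sub_neg_eq_add, smul_eq_mul, div_eq_mul_inv] using this
  set K : ℝ := S * (3 * C' * B ^ 2 + 9 * C' * B + 162 * C') with hK
  have hK0 : 0 ≤ K := by positivity
  have hK1 : S * (3 * C' * B ^ 2) ≤ K := by
    apply mul_le_mul_of_nonneg_left _ hS0
    have : 0 ≤ 9 * C' * B := by positivity
    linarith
  have hK2 : S * (9 * C' * B) ≤ K := by
    apply mul_le_mul_of_nonneg_left _ hS0
    have : 0 ≤ 3 * C' * B ^ 2 := by positivity
    linarith
  have hK3 : S * (162 * C') ≤ K := by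
    apply mul_le_mul_of_nonneg_left _ hS0
    have : 0 ≤ 9 * C' * B := by positivity
    have : 0 ≤ 3 * C' * B ^ 2 := by positivity
    linarith
  -- the minors vanish to second order
  have hminor : ∀ i : Fin (m + 2), ∃ D, 0 ≤ D ∧
      ∀ x : {x : ℝ × ℝ // x.1 ∈ Metric.ball t₀ ε ∧ x.2 ∈ Set.Ioo 0 (ε / 2)},
      ‖(Matrix.of fun p q : Fin (m + 1) => σ (i.succAbove p)
        ((u q x.1.1 : C(X, ℂ)) * R x.1.1 (η x.1.2))).det‖ ≤ D * ‖η x.1.2‖ ^ 2 := by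
    intro i
    have hvanish : ∀ x : {x : ℝ × ℝ // x.1 ∈ Metric.ball t₀ ε ∧ x.2 ∈ Set.Ioo 0 (ε / 2)},
        ∀ s ∈ Set.Ioo 0 ε, (Matrix.of fun p q : Fin (m + 1) => σ (i.succAbove p)
        ((u q x.1.1 : C(X, ℂ)) * R x.1.1 (-η s))).det = 0 := by
      rintro ⟨⟨t, s'⟩, ht, -⟩ s hs
      refine det_eq_zero_of_mulIndex_le (hm t ht s hs) (Finv := R t (-η s)) ?_
        (fun p => (σ (i.succAbove p)).toLinearMap) (fun p => hσ _) fun q => u q t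
      have : ((L - algebraMap ℂ A (ζ t - v * (s * Complex.I)) : A) : C(X, ℂ)) =
          (L : C(X, ℂ)) - algebraMap ℂ C(X, ℂ) (ζ t + -η s) := by
        simp [η, sub_eq_add_neg]
      rw [this]
      apply Ring.inverse_mul_cancel
      rw [← hneg]
      exact isUnit_continuousMap_of_ne_zero (hpos t ht (-s)
        (by rw [abs_neg, abs_of_pos hs.1]; linarith [hs.1, hs.2]) (by linarith [hs.1]))
    refine exists_norm_det_le
      (δ := fun x : {x : ℝ × ℝ // x.1 ∈ Metric.ball t₀ ε ∧ x.2 ∈ Set.Ioo 0 (ε / 2)} => ‖η x.1.2‖)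
      (fun x => norm_nonneg (η x.1.2))
      (fun p q x => σ (i.succAbove p) ((u q x.1.1 : C(X, ℂ)) * R x.1.1 (η x.1.2)))
      (fun p q x => σ (i.succAbove p) ((u q x.1.1 : C(X, ℂ)) * R x.1.1 (-η x.1.2)))
      (fun p q x => σ (i.succAbove p) ((u q x.1.1 : C(X, ℂ)) * R x.1.1 (-(2 * η x.1.2))))
      hK0 ?_ ?_ ?_ ?_ ?_ (fun x => hvanish x _ ?_) (fun x => ?_)
    · rintro p q ⟨⟨t, s⟩, ht, hs⟩
      exact (norm_apply_le_of_forall_norm_le (hSS _) (by positivity)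
        fun x => (hbounds t ht s hs q x).1).trans hK1
    · rintro p q ⟨⟨t, s⟩, ht, hs⟩
      exact (norm_apply_le_of_forall_norm_le (hSS _) (by positivity)
        fun x => (hbounds t ht s hs q x).2.1).trans hK1
    · rintro p q ⟨⟨t, s⟩, ht, hs⟩
      exact (norm_apply_le_of_forall_norm_le (hSS _) (by positivity)
        fun x => (hbounds t ht s hs q x).2.2.1).trans hK1
    · rintro p q ⟨⟨t, s⟩, ht, hs⟩
      dsimp only
      rw [← map_sub]
      refine (norm_apply_le_of_forall_norm_le (hSS _) (by positivity)
        fun x => (hbounds t ht s hs q x).2.2.2.1).trans ?_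
      rw [← mul_assoc]
      gcongr
    · rintro p q ⟨⟨t, s⟩, ht, hs⟩
      dsimp only
      have := norm_apply_le_of_forall_norm_le (hSS (i.succAbove p)) (by positivity)
        fun x => (hbounds t ht s hs q x).2.2.2.2
      rw [map_add, map_sub, map_smul, map_smul, smul_eq_mul, smul_eq_mul] at this
      refine this.trans ?_
      rw [← mul_assoc]
      gcongr
    · exact ⟨x.2.2.1, by linarith [x.2.2.1, x.2.2.2]⟩
    · rw [← hvanish x (2 * x.1.2) ⟨by linarith [x.2.2.1], by linarith [x.2.2.2]⟩]
      simp [η]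
      congr! 8
      ring
  choose D hD0 hD using hminor
  set D' := ∑ i, D i with hD'
  have hDD : ∀ i, D i ≤ D' := fun i =>
    Finset.single_le_sum (f := D) (fun j _ => hD0 j) (Finset.mem_univ i)
  have hv' : 0 < ‖v‖ := norm_pos_iff.2 hv0
  refine ⟨((m + 1 : ℕ) + 1) * (S * 3 * D') * ‖v‖, fun t ht s hs => ?_⟩
  obtain ⟨⟨r1, r1'⟩, -⟩ := hrange s hs
  have hηs := hηnorm s hs.1
  have hηs0 : 0 < ‖η s‖ := norm_pos_iff.2 (hη0 s hs.1)
  let N : Matrix (Fin (m + 2)) (Fin (m + 2)) ℂ := Matrix.of fun i j =>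
    σ i (((Fin.cons 1 (fun j => u j t) : Fin (m + 2) → A) j : C(X, ℂ)) * R t (η s))
  have hRY : (Y t : C(X, ℂ)) * R t (η s) = 1 + η s • R t (η s) := by
    ext x
    have h1 := hR t ht s r1 r1' x
    have h2 : (L : C(X, ℂ)) x - ζ t - η s ≠ 0 := by
      have := hpos t ht s r1 r1' x
      simpa [sub_sub] using this
    simp only [ContinuousMap.mul_apply, ContinuousMap.add_apply, ContinuousMap.smul_apply, hY, h1,
      ContinuousMap.one_apply, smul_eq_mul]
    field_simp
    ring
  have hdet : (Matrix.of fun i j => σ i (((Fin.cons 1 g : Fin (m + 2) → A) j : C(X, ℂ)) *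
      R t (η s))).det = N.det := by
    refine Matrix.det_eq_of_forall_succ_eq_add_mul_zero
      (fun j => F j t + c₁ j t * η s + c₂ j t * η s ^ 2) (fun i => by simp [N]) fun i j => ?_
    simp only [N, Matrix.of_apply, Fin.cons_succ, Fin.cons_zero, OneMemClass.coe_one, one_mul]
    have e : (g j : C(X, ℂ)) * R t (η s) = (u j t : C(X, ℂ)) * R t (η s)
        + (F j t + c₁ j t * η s + c₂ j t * η s ^ 2) • R t (η s)
        + ((algebraMap ℂ A (c₁ j t) + algebraMap ℂ A (c₂ j t) * Y t +
            algebraMap ℂ A (c₂ j t * η s) : A) : C(X, ℂ)) := by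
      ext x
      have h1 := congrArg (fun G : C(X, ℂ) => G x) hRY
      simp [hY] at h1
      simp [hu, hY]
      linear_combination (c₁ j t + c₂ j t * ((L : C(X, ℂ)) x - ζ t) + c₂ j t * η s) * h1
    rw [e, map_add, map_add, hσ, add_zero, map_smul, smul_eq_mul]
  change ‖(Matrix.of fun i j => σ i (((Fin.cons 1 g : Fin (m + 2) → A) j : C(X, ℂ)) *
      R t (η s))).det‖ ≤ _
  rw [hdet]
  have h0 : ∀ i, ‖N i 0‖ ≤ S * (3 / ‖η s‖) := by
    intro i
    simp only [N, Matrix.of_apply, Fin.cons_zero, OneMemClass.coe_one, one_mul]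
    refine norm_apply_le_of_forall_norm_le (hSS i) (by positivity) fun x => ?_
    rw [hR t ht s r1 r1', norm_inv, ← inv_div]
    exact inv_anti₀ (by positivity) (hsep t ht s r1 x).1
  have h1 : ∀ i : Fin (m + 1 + 1),
      ‖(N.submatrix i.succAbove Fin.succ).det‖ ≤ D' * ‖η s‖ ^ 2 := by
    intro i
    have h := hD i ⟨(t, s), ht, hs⟩
    have e : N.submatrix i.succAbove Fin.succ = Matrix.of fun p q : Fin (m + 1) =>
        σ (i.succAbove p) ((u q t : C(X, ℂ)) * R t (η s)) := by
      ext p q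
      simp [N]
    rw [e]
    refine h.trans ?_
    gcongr
    exact hDD i
  refine (norm_det_le_of_minors h0 h1).trans (le_of_eq ?_)
  rw [mul_assoc _ ‖v‖ s, ← hηs]
  field_simp

theorem mulIndex_le_succ_across {A₀ : Set A} (hA : IsClosed (A : Set C(X, ℂ))) (hA₀ : Dense A₀)
    {L : A} {ζ : ℝ → ℂ} {v : ℂ} {t₀ ε B : ℝ} (hv0 : v ≠ 0) (hε : 0 < ε)
    (hB0 : 0 ≤ B) (hB : ∀ t ∈ Metric.ball t₀ ε, ∀ x, ‖(L : C(X, ℂ)) x - ζ t‖ ≤ B)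
    (hz : ∀ t ∈ Metric.ball t₀ ε, ∀ t' ∈ Metric.ball t₀ ε,
      ‖ζ t - ζ t' - v * (t - t' : ℝ)‖ ≤ ‖v‖ / 2 * |t - t'|)
    (hsep : ∀ t ∈ Metric.ball t₀ ε, ∀ s : ℝ, |s| < 2 * ε → ∀ x,
        ‖v * (s * Complex.I)‖ / 3 ≤ ‖(L : C(X, ℂ)) x - ζ t - v * (s * Complex.I)‖ ∧
        ‖(L : C(X, ℂ)) x - ζ t‖ / 3 ≤ ‖(L : C(X, ℂ)) x - ζ t - v * (s * Complex.I)‖)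
    (hcubic : ∀ g ∈ A₀, ∃ F c₁ c₂ : ℝ → ℂ, ∃ C, 0 ≤ C ∧ ∀ t ∈ Metric.ball t₀ ε, ∀ x,
      ‖(g : C(X, ℂ)) x - F t - c₁ t * ((L : C(X, ℂ)) x - ζ t)
        - c₂ t * ((L : C(X, ℂ)) x - ζ t) ^ 2‖ ≤ C * ‖(L : C(X, ℂ)) x - ζ t‖ ^ 3)
    {m : ℕ} (hm : ∀ t ∈ Metric.ball t₀ ε, ∀ s ∈ Set.Ioo 0 ε,
      mulIndex A (L - algebraMap ℂ A (ζ t - v * (s * Complex.I))) ≤ m) {t s : ℝ}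
    (ht : t ∈ Metric.ball t₀ ε) (hs : s ∈ Set.Ioo 0 ε) :
    mulIndex A (L - algebraMap ℂ A (ζ t + v * (s * Complex.I))) ≤ (m + 1 : ℕ) := by
  have hunit : ∀ x ∈ Metric.ball t₀ ε ×ℂ Set.Ioo 0 ε,
      IsUnit ((L : C(X, ℂ)) - algebraMap ℂ C(X, ℂ) (tubeMap ζ v x)) := by
    rintro x ⟨hx1, hx2 : x.im ∈ Set.Ioo 0 ε⟩
    refine isUnit_continuousMap_of_ne_zero fun y hy => ?_
    have h1 := (hsep x.re hx1 x.im
      (by rw [abs_of_pos hx2.1]; linarith [hx2.1, hx2.2]) y).1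
    have h2 : (L : C(X, ℂ)) y - ζ x.re - v * (x.im * Complex.I) = 0 := by
      have : (L : C(X, ℂ)) y - tubeMap ζ v x = 0 := by simpa using hy
      rw [tubeMap] at this
      linear_combination this
    rw [h2, norm_zero] at h1
    have : 0 < ‖v * (x.im * Complex.I)‖ := by simp [hv0, hx2.1.ne']
    linarith
  by_contra! hlt
  have hmem : (⟨t, s⟩ : ℂ) ∈ Metric.ball t₀ ε ×ℂ Set.Ioo 0 ε := ⟨ht, hs⟩
  let D : (Fin (m + 1) → A) → (Fin (m + 2) → C(X, ℂ) →L[ℂ] ℂ) → ℂ → ℂ := fun g σ a =>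
    (Matrix.of fun i j => σ i (((Fin.cons 1 g : Fin (m + 2) → A) j : C(X, ℂ)) *
        Ring.inverse ((L : C(X, ℂ)) - algebraMap ℂ C(X, ℂ) a))).det
  obtain ⟨σ, f, hσ, hf0, hdet⟩ := exists_det_ne_zero_of_lt_mulIndex hA hlt
    (Finv := Ring.inverse ((L : C(X, ℂ)) - algebraMap ℂ C(X, ℂ) (tubeMap ζ v ⟨t, s⟩)))
    (by simpa [tubeMap] using Ring.inverse_mul_cancel _ (hunit ⟨t, s⟩ hmem))
  obtain ⟨g, hg, hgA⟩ : ∃ g, D g σ (tubeMap ζ v ⟨t, s⟩) ≠ 0 ∧ ∀ j, g j ∈ A₀ := by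
    have hcont : Continuous fun g => D g σ (tubeMap ζ v ⟨t, s⟩) := by
      refine Continuous.matrix_det (continuous_pi fun i => continuous_pi fun j => ?_)
      refine Fin.cases ?_ (fun j => ?_) j
      · simpa using continuous_const
      · simp only [Matrix.of_apply, Fin.cons_succ]
        fun_prop
    have hopen : IsOpen {g | D g σ (tubeMap ζ v ⟨t, s⟩) ≠ 0} := isOpen_ne_fun hcont continuous_const
    have hne : {g | D g σ (tubeMap ζ v ⟨t, s⟩) ≠ 0}.Nonempty := by
      refine ⟨fun j => f j.succ, ?_⟩
      have : (Fin.cons 1 (fun j => f j.succ) : Fin (m + 2) → A) = f := by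
        rw [← hf0]
        exact Fin.cons_self_tail f
      simp only [Set.mem_ofPred_eq, D, this]
      exact hdet
    obtain ⟨g, hg, hg'⟩ := (dense_pi Set.univ fun (_ : Fin (m + 1)) _ => hA₀).inter_open_nonempty
      _ hopen hne
    exact ⟨g, hg, fun j => hg' j trivial⟩
  obtain ⟨C, hC⟩ := exists_norm_resolvent_det_le hv0 hB0 hB hsep g
    (fun j => hcubic _ (hgA j)) hm σ hσ
  refine hg (eq_zero_of_norm_tubeMap_le (D := D g σ) (C := C) hv0 hε hz (fun x hx => ?_)
    (fun x hx => hC x.re hx.1 x.im hx.2) hmem)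
  have hinv : DifferentiableAt ℂ
      (fun a : ℂ => Ring.inverse ((L : C(X, ℂ)) - algebraMap ℂ C(X, ℂ) a)) (tubeMap ζ v x) := by
    refine DifferentiableAt.comp (f := fun a : ℂ => (L : C(X, ℂ)) - algebraMap ℂ C(X, ℂ) a) _
      (differentiableAt_inverse (𝕜 := ℂ) (hunit x hx)) ?_
    simp only [Algebra.algebraMap_eq_smul_one]
    fun_prop
  simp only [D, Matrix.det_apply, Matrix.of_apply]
  fun_prop

theorem exists_tube_crossing {A₀ : Set A} (hA : IsClosed (A : Set C(X, ℂ))) (hA₀ : Dense A₀)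
    {L : A} {c : ℝ → X} {t₀ ρ : ℝ} (hρ : 0 < ρ)
    (hc : ∀ h ∈ A₀, ∀ t ∈ Metric.ball t₀ ρ,
      ContDiffAt ℝ (⊤ : ℕ∞) (fun t => (h : C(X, ℂ)) (c t)) t)
    (hL : ∀ t ∈ Metric.ball t₀ ρ, ContDiffAt ℝ (⊤ : ℕ∞) (fun t => (L : C(X, ℂ)) (c t)) t) {v : ℂ}
    (hv : deriv (fun t => (L : C(X, ℂ)) (c t)) t₀ = v) (hv0 : v ≠ 0)
    (hsimple : ∀ ε > 0, ∃ r > 0, ∀ x, ‖(L : C(X, ℂ)) x - (L : C(X, ℂ)) (c t₀)‖ < r →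
      ∃ t, |t - t₀| < ε ∧ x = c t) :
    ∃ ε₀ > 0, ∀ ε, 0 < ε → ε ≤ ε₀ →
      (∀ t ∈ Metric.ball t₀ ε, ∀ t' ∈ Metric.ball t₀ ε,
        ‖(L : C(X, ℂ)) (c t) - (L : C(X, ℂ)) (c t') - v * (t - t' : ℝ)‖ ≤ ‖v‖ / 2 * |t - t'|) ∧
      (∀ t ∈ Metric.ball t₀ ε, ∀ s : ℝ, |s| < ε → s ≠ 0 →
        (L : C(X, ℂ)) (c t) + v * (s * Complex.I) ∉ Set.range (L : C(X, ℂ))) ∧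
      ∀ m : ℕ, (∀ t ∈ Metric.ball t₀ ε, ∀ s ∈ Set.Ioo 0 ε,
          mulIndex A (L - algebraMap ℂ A ((L : C(X, ℂ)) (c t) - v * (s * Complex.I))) ≤ m) →
        ∀ t ∈ Metric.ball t₀ ε, ∀ s ∈ Set.Ioo 0 ε,
          mulIndex A (L - algebraMap ℂ A ((L : C(X, ℂ)) (c t) + v * (s * Complex.I)))
            ≤ (m + 1 : ℕ) := by
  obtain ⟨ε₀, ε₁, r, hε₀, hε₀₁, hε₁, hr, hz, hder, hsep, hsep'⟩ :=
    exists_tube_separation hρ hL hv hv0 hsimple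
  refine ⟨ε₀, hε₀, fun ε hε hεε₀ => ?_⟩
  have hb := Metric.ball_subset_ball (x := t₀) hεε₀
  have hb' := Metric.ball_subset_ball (x := t₀) (hεε₀.trans hε₀₁)
  have hv' : 0 < ‖v‖ := norm_pos_iff.2 hv0
  have hzε := fun t ht t' ht' => hz t (hb' ht) t' (hb' ht')
  refine ⟨hzε, fun t ht s hs hs0 => ?_, fun m hm t ht s hs => ?_⟩
  · rintro ⟨x, hx⟩
    have h1 := (hsep' t (hb ht) s (by linarith [abs_nonneg s]) x).1
    rw [show (L : C(X, ℂ)) x - (L : C(X, ℂ)) (c t) - v * (s * Complex.I) = 0 by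
      linear_combination hx, norm_zero] at h1
    have : 0 < ‖v * (s * Complex.I)‖ := by simp [hv0, hs0]
    linarith
  refine mulIndex_le_succ_across hA hA₀ (ζ := fun t => (L : C(X, ℂ)) (c t)) hv0 hε
    (B := 2 * ‖(L : C(X, ℂ))‖) (by positivity) (fun t _ x => ?_) hzε
    (fun t ht s hs x => hsep' t (hb ht) s (by linarith) x) (fun g hg => ?_) hm ht hs
  · have := norm_sub_le ((L : C(X, ℂ)) x) ((L : C(X, ℂ)) (c t))
    have := (L : C(X, ℂ)).norm_coe_le_norm x
    have := (L : C(X, ℂ)).norm_coe_le_norm (c t)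
    linarith
  · have hlow : ∀ t ∈ Metric.ball t₀ ε₁, ∀ t' ∈ Metric.ball t₀ ε₁,
        ‖v‖ / 2 * |t - t'| ≤ ‖(L : C(X, ℂ)) (c t) - (L : C(X, ℂ)) (c t')‖ := by
      intro t ht t' ht'
      have h1 := hz t ht t' ht'
      have h2 := norm_sub_norm_le (v * (t - t' : ℝ)) ((L : C(X, ℂ)) (c t) - (L : C(X, ℂ)) (c t'))
      rw [norm_mul, Complex.norm_real, Real.norm_eq_abs, ← norm_neg (v * _ - _), neg_sub] at h2
      linarith
    obtain ⟨F, c₁, c₂, C, hC, h⟩ := exists_cubic_bound (κ := ‖v‖ / 2) hε₀₁ hε₁ hr (by positivity)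
      (hc g hg) hL hlow hder hsep
    exact ⟨F, c₁, c₂, C, hC, fun t ht => h t (hb ht)⟩

end HalfCrossing

section CrossingLemma

variable {X : Type*} [TopologicalSpace X] [CompactSpace X] {A : Subalgebra ℂ C(X, ℂ)}

theorem mulIndex_sub_algebraMap_le_of_preconnected (hA : IsClosed (A : Set C(X, ℂ))) {L : A}
    {U : Set ℂ} (hU : IsOpen U) (hU' : IsPreconnected U)
    (hUL : ∀ a ∈ U, a ∉ Set.range (L : C(X, ℂ))) {a₀ : ℂ} (ha₀ : a₀ ∈ U) {n : ℕ}
    (hn : mulIndex A (L - algebraMap ℂ A a₀) ≤ n) {a : ℂ} (ha : a ∈ U) :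
    mulIndex A (L - algebraMap ℂ A a) ≤ n := by
  have key : ∀ w : ℂ, L + w • (-1 : A) = L - algebraMap ℂ A w := fun w => by
    rw [smul_neg, sub_eq_add_neg, Algebra.algebraMap_eq_smul_one]
  rw [← key] at hn ⊢
  refine mulIndex_le_of_preconnected hA hU hU' (fun w hw => ?_) ha₀ hn ha
  refine isUnit_continuousMap_of_ne_zero fun x hx => hUL w hw ⟨x, ?_⟩
  have : (L : C(X, ℂ)) x + w * (-1) = 0 := by simpa using hx
  linear_combination this

theorem exists_nhds_mulIndex_ne_top_across {A₀ : Set A} (hA : IsClosed (A : Set C(X, ℂ)))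
    (hA₀ : Dense A₀) {L : A} {c : ℝ → X} {t₀ ρ : ℝ} (hρ : 0 < ρ)
    (hc : ∀ h ∈ A₀, ∀ t ∈ Metric.ball t₀ ρ,
      ContDiffAt ℝ (⊤ : ℕ∞) (fun t => (h : C(X, ℂ)) (c t)) t)
    (hL : ∀ t ∈ Metric.ball t₀ ρ, ContDiffAt ℝ (⊤ : ℕ∞) (fun t => (L : C(X, ℂ)) (c t)) t)
    (hv0 : deriv (fun t => (L : C(X, ℂ)) (c t)) t₀ ≠ 0)
    (hsimple : ∀ ε > 0, ∃ r > 0, ∀ x, ‖(L : C(X, ℂ)) x - (L : C(X, ℂ)) (c t₀)‖ < r →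
      ∃ t, |t - t₀| < ε ∧ x = c t) :
    ∃ B ∈ 𝓝 ((L : C(X, ℂ)) (c t₀)),
      (∃ a ∈ B, a ∉ Set.range (L : C(X, ℂ)) ∧ mulIndex A (L - algebraMap ℂ A a) ≠ ⊤) →
      ∀ a ∈ B, a ∉ Set.range (L : C(X, ℂ)) → mulIndex A (L - algebraMap ℂ A a) ≠ ⊤ := by
  obtain ⟨v, hv⟩ : ∃ v, deriv (fun t => (L : C(X, ℂ)) (c t)) t₀ = v := ⟨_, rfl⟩
  rw [hv] at hv0
  have hball : ∀ {ε t : ℝ}, t ∈ Metric.ball (-t₀) ε ↔ -t ∈ Metric.ball t₀ ε := by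
    intro ε t
    rw [Metric.mem_ball, Metric.mem_ball, Real.dist_eq, Real.dist_eq, ← abs_neg]
    ring_nf
  have hreflect : ∀ {f : ℝ → ℂ}, (∀ t ∈ Metric.ball t₀ ρ, ContDiffAt ℝ (⊤ : ℕ∞) f t) →
      ∀ t ∈ Metric.ball (-t₀) ρ, ContDiffAt ℝ (⊤ : ℕ∞) (fun t => f (-t)) t := fun hf t ht =>
    (hf (-t) (hball.1 ht)).comp (f := fun t : ℝ => -t) t contDiffAt_id.neg
  obtain ⟨δ₁, hδ₁, h₁⟩ := exists_tube_crossing hA hA₀ hρ hc hL hv hv0 hsimple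
  obtain ⟨δ₂, hδ₂, h₂⟩ := exists_tube_crossing hA hA₀ (c := fun t => c (-t)) (t₀ := -t₀) (v := -v)
    hρ (fun h hh => hreflect (hc h hh)) (hreflect hL)
    (by rw [deriv_comp_neg (fun t => (L : C(X, ℂ)) (c t)), neg_neg, hv]) (neg_ne_zero.2 hv0)
    (fun ε hε => by
      obtain ⟨r, hr, h⟩ := hsimple ε hε
      refine ⟨r, hr, fun x hx => ?_⟩
      obtain ⟨t, ht, rfl⟩ := h x (by simpa using hx)
      exact ⟨-t, by rw [← abs_neg]; convert ht using 2; ring, by simp⟩)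
  set ε := min δ₁ δ₂ with hε
  have hε0 : 0 < ε := lt_min hδ₁ hδ₂
  obtain ⟨hz, havoid, hplus⟩ := h₁ ε hε0 (min_le_left _ _)
  obtain ⟨-, -, hminus⟩ := h₂ ε hε0 (min_le_right _ _)
  set ζ : ℝ → ℂ := fun t => (L : C(X, ℂ)) (c t) with hζ
  let S : Set ℝ → Set ℂ := fun J => tubeMap ζ v '' (Metric.ball t₀ ε ×ℂ J)
  have hSopen : ∀ J, IsOpen J → IsOpen (S J) := fun J hJ =>
    isOpen_image_tubeMap hv0 hz (Metric.isOpen_ball.reProdIm hJ) fun x hx => hx.1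
  have hSL : ∀ J ⊆ Set.Ioo (-ε) ε, (0 : ℝ) ∉ J → ∀ a ∈ S J, a ∉ Set.range (L : C(X, ℂ)) := by
    rintro J hJ hJ0 _ ⟨x, ⟨hx1, hx2⟩, rfl⟩
    exact havoid x.re hx1 x.im (abs_lt.2 (hJ hx2)) fun h => hJ0 (h ▸ hx2)
  have hsub1 : Set.Ioo 0 ε ⊆ Set.Ioo (-ε) ε := Set.Ioo_subset_Ioo_left (by linarith)
  have hsub2 : Set.Ioo (-ε) 0 ⊆ Set.Ioo (-ε) ε := Set.Ioo_subset_Ioo_right (by linarith)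
  have hprop : ∀ J ⊆ Set.Ioo (-ε) ε, (0 : ℝ) ∉ J → IsOpen J → Convex ℝ J → ∀ {n : ℕ} {a₀ a : ℂ},
      a₀ ∈ S J → mulIndex A (L - algebraMap ℂ A a₀) ≤ n → a ∈ S J →
      mulIndex A (L - algebraMap ℂ A a) ≤ n := fun J hJ hJ0 hJo hJc n a₀ a ha₀ hn ha =>
    mulIndex_sub_algebraMap_le_of_preconnected hA (hSopen J hJo)
      (isPreconnected_image_tubeMap hz hJc) (hSL J hJ hJ0) ha₀ hn ha
  have mem_plus : ∀ t ∈ Metric.ball t₀ ε, ∀ s ∈ Set.Ioo 0 ε,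
      ζ t + v * (s * Complex.I) ∈ S (Set.Ioo 0 ε) := fun t ht s hs =>
    ⟨⟨t, s⟩, ⟨ht, hs⟩, rfl⟩
  have mem_minus : ∀ t ∈ Metric.ball t₀ ε, ∀ s ∈ Set.Ioo 0 ε,
      ζ t - v * (s * Complex.I) ∈ S (Set.Ioo (-ε) 0) := fun t ht s hs =>
    ⟨⟨t, -s⟩, ⟨ht, by simpa using ⟨hs.2, hs.1⟩⟩, by simp [tubeMap, sub_eq_add_neg]⟩
  have plus_to_minus : ∀ n : ℕ, (∀ a ∈ S (Set.Ioo 0 ε), mulIndex A (L - algebraMap ℂ A a) ≤ n) →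
      ∀ a ∈ S (Set.Ioo (-ε) 0), mulIndex A (L - algebraMap ℂ A a) ≤ (n + 1 : ℕ) := by
    rintro n hn _ ⟨x, ⟨hx1, hx2⟩, rfl⟩
    have := hminus n (fun t ht s hs => by
      have := hn _ (mem_plus (-t) (hball.1 ht) s hs)
      rwa [neg_mul, sub_neg_eq_add]) (-x.re) (hball.2 (by simpa using hx1)) (-x.im)
        ⟨by simpa using hx2.2, by linarith [hx2.1]⟩
    convert this using 3
    simp [tubeMap, hζ]
  have minus_to_plus : ∀ n : ℕ,
      (∀ a ∈ S (Set.Ioo (-ε) 0), mulIndex A (L - algebraMap ℂ A a) ≤ n) →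
      ∀ a ∈ S (Set.Ioo 0 ε), mulIndex A (L - algebraMap ℂ A a) ≤ (n + 1 : ℕ) := by
    rintro n hn _ ⟨x, ⟨hx1, hx2⟩, rfl⟩
    exact hplus n (fun t ht s hs => hn _ (mem_minus t ht s hs)) x.re hx1 x.im hx2
  have hsplit : ∀ a ∈ S (Set.Ioo (-ε) ε), a ∉ Set.range (L : C(X, ℂ)) →
      a ∈ S (Set.Ioo 0 ε) ∨ a ∈ S (Set.Ioo (-ε) 0) := by
    rintro _ ⟨x, ⟨hx1, hx2⟩, rfl⟩ hx
    rcases lt_trichotomy x.im 0 with h | h | h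
    · exact Or.inr ⟨x, ⟨hx1, hx2.1, h⟩, rfl⟩
    · exact absurd ⟨c x.re, by simp [tubeMap, h, hζ]⟩ hx
    · exact Or.inl ⟨x, ⟨hx1, h, hx2.2⟩, rfl⟩
  refine ⟨S (Set.Ioo (-ε) ε), (hSopen _ isOpen_Ioo).mem_nhds
    ⟨t₀, ⟨by simpa using hε0, by simpa using hε0⟩, by simp [tubeMap, hζ]⟩, ?_⟩
  rintro ⟨a₀, ha₀, ha₀L, hfin⟩ a ha haL
  lift mulIndex A (L - algebraMap ℂ A a₀) to ℕ using hfin with n hn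
  suffices ∃ k : ℕ, mulIndex A (L - algebraMap ℂ A a) ≤ k by
    obtain ⟨k, hk⟩ := this
    exact ne_top_of_le_ne_top (by simp) hk
  rcases hsplit a₀ ha₀ ha₀L with h₀ | h₀ <;> rcases hsplit a ha haL with h | h
  · exact ⟨n, hprop _ hsub1 (by simp) isOpen_Ioo (convex_Ioo _ _) h₀ hn.ge h⟩
  · exact ⟨n + 1, plus_to_minus n (fun b hb =>
      hprop _ hsub1 (by simp) isOpen_Ioo (convex_Ioo _ _) h₀ hn.ge hb) a h⟩
  · exact ⟨n + 1, minus_to_plus n (fun b hb =>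
      hprop _ hsub2 (by simp) isOpen_Ioo (convex_Ioo _ _) h₀ hn.ge hb) a h⟩
  · exact ⟨n, hprop _ hsub2 (by simp) isOpen_Ioo (convex_Ioo _ _) h₀ hn.ge h⟩

end CrossingLemma

section Finiteness

variable {X : Type*} [TopologicalSpace X] [CompactSpace X] {A : Subalgebra ℂ C(X, ℂ)}

theorem isPreconnected_compl_of_countable_complex {S : Set ℂ} (hS : S.Countable) :
    IsPreconnected Sᶜ :=
  (hS.isPathConnected_compl_of_one_lt_rank (by rw [Complex.rank_real_complex]; norm_num)
    ).isConnected.isPreconnected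

theorem mulIndex_sub_algebraMap_eq_zero (hA : IsClosed (A : Set C(X, ℂ))) {L : A} {a : ℂ}
    (ha : ‖L‖ * ‖(1 : A)‖ < ‖a‖) : mulIndex A (L - algebraMap ℂ A a) = 0 := by
  have : CompleteSpace A := hA.completeSpace_coe
  have h : IsUnit (algebraMap ℂ A a - L) := spectrum.mem_resolventSet_of_norm_lt_mul ha
  rw [← IsUnit.neg_iff, neg_sub] at h
  obtain ⟨G, hG⟩ := h.exists_right_inv
  exact mulIndex_eq_zero_iff.2 ⟨G, hG⟩

theorem mulIndex_ne_top_of_countable (hA : IsClosed (A : Set C(X, ℂ))) {L : A} {S : Set ℂ}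
    (hS : S.Countable) (hint : Dense (Set.range (L : C(X, ℂ)))ᶜ)
    (hcross : ∀ a₀ ∈ Set.range (L : C(X, ℂ)), a₀ ∉ S → ∃ B ∈ 𝓝 a₀,
      (∃ a ∈ B, a ∉ Set.range (L : C(X, ℂ)) ∧ mulIndex A (L - algebraMap ℂ A a) ≠ ⊤) →
      ∀ a ∈ B, a ∉ Set.range (L : C(X, ℂ)) → mulIndex A (L - algebraMap ℂ A a) ≠ ⊤)
    {a : ℂ} (ha : a ∉ Set.range (L : C(X, ℂ))) : mulIndex A (L - algebraMap ℂ A a) ≠ ⊤ := by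
  set Γ := Set.range (L : C(X, ℂ)) with hΓ
  have hΓc : IsClosed Γ := (isCompact_range (L : C(X, ℂ)).continuous).isClosed
  let 𝓕 : Set ℂ := {a | ∀ᶠ b in 𝓝 a, b ∉ Γ → mulIndex A (L - algebraMap ℂ A b) ≠ ⊤}
  have h𝓕 : IsOpen 𝓕 := isOpen_setOfPred_eventually_nhds
  have hloc : ∀ a₀ ∉ S ∩ Γ, ∃ B ∈ 𝓝 a₀,
      (∃ a ∈ B, a ∉ Γ ∧ mulIndex A (L - algebraMap ℂ A a) ≠ ⊤) →
      ∀ a ∈ B, a ∉ Γ → mulIndex A (L - algebraMap ℂ A a) ≠ ⊤ := by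
    intro a₀ ha₀
    by_cases haΓ : a₀ ∈ Γ
    · exact hcross a₀ haΓ fun h => ha₀ ⟨h, haΓ⟩
    obtain ⟨r, hr, hball⟩ := Metric.isOpen_iff.1 hΓc.isOpen_compl a₀ haΓ
    refine ⟨Metric.ball a₀ r, Metric.ball_mem_nhds _ hr, ?_⟩
    rintro ⟨b, hb, -, hfin⟩ b' hb' -
    lift mulIndex A (L - algebraMap ℂ A b) to ℕ using hfin with n hn
    exact ne_top_of_le_ne_top (by simp) (mulIndex_sub_algebraMap_le_of_preconnected hA
      Metric.isOpen_ball (convex_ball a₀ r).isPreconnected (fun _ h => hball h) hb hn.ge hb')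
  have hsub : (S ∩ Γ)ᶜ ⊆ 𝓕 := by
    refine (isPreconnected_compl_of_countable_complex
      (hS.mono Set.inter_subset_left)).subset_of_closure_inter_subset h𝓕 ?_ ?_
    · set M := ‖L‖ * ‖(1 : A)‖ + ‖L‖ with hM
      have hM1 : ‖L‖ * ‖(1 : A)‖ ≤ M := by linarith [norm_nonneg L]
      have hM2 : ‖L‖ ≤ M := by nlinarith [norm_nonneg L, norm_nonneg (1 : A)]
      have hMn : ‖((M + 1 : ℝ) : ℂ)‖ = M + 1 := by
        rw [Complex.norm_real, Real.norm_of_nonneg]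
        linarith [norm_nonneg L]
      refine ⟨((M + 1 : ℝ) : ℂ), ?_, ?_⟩
      · rintro ⟨-, x, hx⟩
        have h1 := (L : C(X, ℂ)).norm_coe_le_norm x
        rw [hx, hMn] at h1
        have h2 : ‖(L : C(X, ℂ))‖ = ‖L‖ := rfl
        linarith
      · have : ∀ᶠ b in 𝓝 ((M + 1 : ℝ) : ℂ), M < ‖b‖ :=
          continuous_norm.continuousAt.eventually (lt_mem_nhds
            (show M < ‖((M + 1 : ℝ) : ℂ)‖ by rw [hMn]; linarith))
        filter_upwards [this] with b hb _
        rw [mulIndex_sub_algebraMap_eq_zero hA (hM1.trans_lt hb)]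
        exact ENat.zero_ne_top
    · rintro a₀ ⟨hcl, ha₀⟩
      obtain ⟨B, hB, hcr⟩ := hloc a₀ ha₀
      obtain ⟨b, hbB, hb𝓕⟩ := mem_closure_iff_nhds.1 hcl _ (interior_mem_nhds.2 hB)
      have hfreq : ∃ᶠ x in 𝓝 b, x ∈ Γᶜ := mem_closure_iff_frequently.1 (hint b)
      have hb𝓕' : ∀ᶠ x in 𝓝 b, x ∉ Γ → mulIndex A (L - algebraMap ℂ A x) ≠ ⊤ := hb𝓕
      obtain ⟨b', hb'1, hb'2, hb'3⟩ :=
        (hfreq.and_eventually (hb𝓕'.and (isOpen_interior.mem_nhds hbB))).exists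
      filter_upwards [hB] with y hy
      exact hcr ⟨b', interior_subset hb'3, hb'1, hb'2 hb'1⟩ y hy
  have := (hsub fun h : a ∈ S ∩ Γ => ha h.2).self_of_nhds
  exact this ha

end Finiteness

section Sard

theorem volume_image_eq_zero_of_differentiableAt {g : ℝ → ℂ} {S : Set ℝ}
    (hg : ∀ t ∈ S, DifferentiableAt ℝ g t) : volume (g '' S) = 0 := by
  have himage : g '' S = (fun x : ℂ => g x.re) '' {x | x.re ∈ S ∧ x.im = 0} := by
    ext y
    constructor
    · rintro ⟨t, ht, rfl⟩
      exact ⟨t, ⟨by simpa using ht, by simp⟩, by simp⟩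
    · rintro ⟨x, ⟨hx, -⟩, rfl⟩
      exact ⟨x.re, hx, rfl⟩
  rw [himage]
  refine addHaar_image_eq_zero_of_differentiableOn_of_addHaar_eq_zero volume ?_ ?_
  · rintro x ⟨hx, -⟩
    exact ((hg _ hx).comp (f := fun x : ℂ => x.re) x
      Complex.reCLM.differentiableAt).differentiableWithinAt
  · refine measure_mono_null (t := (LinearMap.ker Complex.imLm : Submodule ℝ ℂ))
      (fun x hx => hx.2) (Measure.addHaar_submodule volume _ fun h => ?_)
    have : Complex.I ∈ LinearMap.ker Complex.imLm := by rw [h]; trivial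
    simp at this

theorem countable_of_eventually_nhdsWithin_notMem {α : Type*} [TopologicalSpace α]
    [SecondCountableTopology α] {S : Set α} (h : ∀ x ∈ S, ∀ᶠ y in 𝓝[≠] x, y ∉ S) :
    S.Countable := by
  refine (HereditarilyLindelofSpace.isLindelof S).countable ?_
  rw [discreteTopology_subtype_iff]
  intro x hx
  rw [← disjoint_iff, Filter.disjoint_principal_right]
  exact h x hx

theorem ae_countable_fiber {Φ : ℂ → ℂ} {U : Set ℂ} (hΦ : ∀ x ∈ U, DifferentiableAt ℝ Φ x) :
    ∀ᵐ c, (U ∩ Φ ⁻¹' {c}).Countable := by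
  have hnull : volume (Φ '' {x | x ∈ U ∧ (fderiv ℝ Φ x).det = 0}) = 0 :=
    addHaar_image_eq_zero_of_det_fderivWithin_eq_zero volume
      (fun x hx => (hΦ x hx.1).hasFDerivAt.hasFDerivWithinAt) fun x hx => hx.2
  rw [ae_iff]
  refine measure_mono_null (fun c hc => ?_) hnull
  by_contra hcrit
  refine hc (countable_of_eventually_nhdsWithin_notMem ?_)
  rintro x ⟨hxU, hxc : Φ x = c⟩
  have hdet : (fderiv ℝ Φ x).det ≠ 0 := fun h => hcrit ⟨x, ⟨hxU, h⟩, hxc⟩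
  let e := (fderiv ℝ Φ x).toContinuousLinearEquivOfDetNeZero hdet
  have hev : ∀ᶠ y in 𝓝[≠] x, Φ y ≠ c :=
    (hΦ x hxU).hasFDerivAt.eventually_ne ⟨_, e.antilipschitz⟩
  filter_upwards [hev] with y hy hyU
  exact hy hyU.2

end Sard

section Slopes

theorem ae_deriv_sub_mul_ne_zero {f : ℝ → ℂ × ℂ} {S : Set ℝ}
    (hf : ∀ t ∈ S, ContDiffAt ℝ (⊤ : ℕ∞) f t ∧ deriv f t ≠ 0) :
    ∀ᵐ c : ℂ, ∀ t ∈ S, deriv (fun t => (f t).2 - c * (f t).1) t ≠ 0 := by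
  have hnull : volume ((fun t => deriv (fun t => (f t).2) t / deriv (fun t => (f t).1) t) ''
      {t | t ∈ S ∧ deriv (fun t => (f t).1) t ≠ 0}) = 0 := by
    refine volume_image_eq_zero_of_differentiableAt fun t ht => ?_
    have h := (hf t ht.1).1
    exact ((contDiffAt_deriv (contDiffAt_snd.comp t h)).differentiableAt (by simp)).div
      ((contDiffAt_deriv (contDiffAt_fst.comp t h)).differentiableAt (by simp)) ht.2
  rw [ae_iff]
  refine measure_mono_null (fun c hc => ?_) hnull
  have hc' : ∃ t ∈ S, deriv (fun t => (f t).2 - c * (f t).1) t = 0 := by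
    by_contra! h
    exact hc h
  obtain ⟨t, ht, hct⟩ := hc'
  obtain ⟨hsm, hne⟩ := hf t ht
  have hd := hsm.differentiableAt (by simp)
  have h1 : HasDerivAt (fun t => (f t).1) (deriv f t).1 t :=
    (hasFDerivAt_fst (𝕜 := ℝ) (p := f t)).comp_hasDerivAt t hd.hasDerivAt
  have h2 : HasDerivAt (fun t => (f t).2) (deriv f t).2 t :=
    (hasFDerivAt_snd (𝕜 := ℝ) (p := f t)).comp_hasDerivAt t hd.hasDerivAt
  rw [HasDerivAt.deriv (h2.fun_sub (h1.const_mul c))] at hct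
  have hz : (deriv f t).1 ≠ 0 := fun h => hne (Prod.ext h (by simpa [h] using hct))
  refine ⟨t, ⟨ht, by rwa [h1.deriv]⟩, ?_⟩
  simp only [h1.deriv, h2.deriv]
  field_simp
  linear_combination hct

theorem ae_countable_double_values {f g : ℝ → ℂ × ℂ} {S T : Set ℝ}
    (hf : ∀ t ∈ S, DifferentiableAt ℝ f t) (hg : ∀ t ∈ T, DifferentiableAt ℝ g t) :
    ∀ᵐ c : ℂ, {a | ∃ s ∈ S, ∃ t ∈ T, f s ≠ g t ∧ (f s).2 - c * (f s).1 = a ∧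
      (g t).2 - c * (g t).1 = a}.Countable := by
  let U : Set ℂ := {x | x.re ∈ S ∧ x.im ∈ T ∧ (f x.re).1 - (g x.im).1 ≠ 0}
  let Φ : ℂ → ℂ := fun x => ((f x.re).2 - (g x.im).2) / ((f x.re).1 - (g x.im).1)
  have hΦ : ∀ x ∈ U, DifferentiableAt ℝ Φ x := by
    rintro x ⟨h1, h2, h3⟩
    have hf' : DifferentiableAt ℝ (fun x : ℂ => f x.re) x :=
      (hf _ h1).comp x Complex.reCLM.differentiableAt
    have hg' : DifferentiableAt ℝ (fun x : ℂ => g x.im) x :=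
      (hg _ h2).comp x Complex.imCLM.differentiableAt
    simp only [Φ, div_eq_mul_inv]
    exact (hf'.snd.fun_sub hg'.snd).fun_mul ((hf'.fst.fun_sub hg'.fst).inv h3)
  filter_upwards [ae_countable_fiber hΦ] with c hc
  refine (hc.image fun x => (f x.re).2 - c * (f x.re).1).mono ?_
  rintro a ⟨s, hs, t, ht, hne, h1, h2⟩
  have hz : (f s).1 - (g t).1 ≠ 0 := by
    intro h
    have h' : (f s).1 = (g t).1 := sub_eq_zero.1 h
    exact hne (Prod.ext h' (by rw [h'] at h1; linear_combination h1 - h2))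
  refine ⟨⟨s, t⟩, ⟨⟨hs, ht, hz⟩, ?_⟩, h1⟩
  change ((f s).2 - (g t).2) / ((f s).1 - (g t).1) = c
  field_simp
  linear_combination h1 - h2

end Slopes

section PolynomialAlgebra

variable (K : Set (ℂ × ℂ))

/-- The restriction of a polynomial to `K`. -/
def polyRestrict : MvPolynomial (Fin 2) ℂ →ₐ[ℂ] C(K, ℂ) :=
  MvPolynomial.aeval ![⟨fun x => x.1.1, by fun_prop⟩, ⟨fun x => x.1.2, by fun_prop⟩]

theorem polyRestrict_apply (P : MvPolynomial (Fin 2) ℂ) (x : K) :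
    polyRestrict K P x = MvPolynomial.eval ![x.1.1, x.1.2] P := by
  induction P using MvPolynomial.induction_on with
  | C a => simp [polyRestrict]
  | add p q hp hq => simp [hp, hq]
  | mul_X p i hp =>
    rw [map_mul, map_mul, ContinuousMap.mul_apply, hp]
    congr 1
    fin_cases i <;> simp [polyRestrict]

variable [CompactSpace K]

/-- The uniform closure of the polynomials on `K`. -/
def polyClosure : Subalgebra ℂ C(K, ℂ) :=
  (polyRestrict K).range.topologicalClosure

theorem isClosed_polyClosure : IsClosed (polyClosure K : Set C(K, ℂ)) :=
  Subalgebra.isClosed_topologicalClosure _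

theorem polyRestrict_mem (P : MvPolynomial (Fin 2) ℂ) : polyRestrict K P ∈ polyClosure K :=
  Subalgebra.le_topologicalClosure _ ⟨P, rfl⟩

theorem dense_polyRestrict :
    Dense {h : polyClosure K | ∃ P, (h : C(K, ℂ)) = polyRestrict K P} := by
  intro h
  rw [closure_subtype]
  have := h.2
  refine closure_mono ?_ this
  rintro _ ⟨P, rfl⟩
  exact ⟨⟨_, polyRestrict_mem K P⟩, ⟨P, rfl⟩, rfl⟩

/-- The linear function `w - c z` on `K`. -/
def slopeFun (c : ℂ) : polyClosure K :=
  ⟨polyRestrict K (MvPolynomial.X 1 - MvPolynomial.C c * MvPolynomial.X 0), polyRestrict_mem K _⟩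

theorem slopeFun_apply (c : ℂ) (x : K) : (slopeFun K c : C(K, ℂ)) x = x.1.2 - c * x.1.1 := by
  simp [slopeFun, polyRestrict_apply]

end PolynomialAlgebra

theorem contDiffAt_eval {f : ℝ → ℂ × ℂ} {t : ℝ} (hf : ContDiffAt ℝ (⊤ : ℕ∞) f t)
    (P : MvPolynomial (Fin 2) ℂ) :
    ContDiffAt ℝ (⊤ : ℕ∞) (fun t => MvPolynomial.eval ![(f t).1, (f t).2] P) t := by
  induction P using MvPolynomial.induction_on with
  | C a => simpa using contDiffAt_const
  | add p q hp hq => simpa using hp.add hq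
  | mul_X p i hp =>
    simp only [map_mul, MvPolynomial.eval_X]
    refine hp.mul ?_
    fin_cases i
    · exact contDiffAt_fst.comp t hf
    · exact contDiffAt_snd.comp t hf

section ArcSystem

/-- A system of arcs, parametrized by `[0, 1]`, which meet at most at the origin and are smooth
away from it. -/
structure IsArcSystem {ι : Type*} (f : ι → ℝ → ℂ × ℂ) : Prop where
  continuousOn : ∀ i, ContinuousOn (f i) (Set.Icc 0 1)
  eq_of_eq : ∀ i j, ∀ s ∈ Set.Icc (0 : ℝ) 1, ∀ t ∈ Set.Icc (0 : ℝ) 1,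
    f i s = f j t → f i s ≠ 0 → i = j ∧ s = t
  contDiffAt : ∀ i, ∀ t ∈ Set.Icc (0 : ℝ) 1, f i t ≠ 0 → ContDiffAt ℝ (⊤ : ℕ∞) (f i) t
  deriv_ne_zero : ∀ i, ∀ t ∈ Set.Icc (0 : ℝ) 1, f i t ≠ 0 → deriv (f i) t ≠ 0

variable {ι : Type*} {f : ι → ℝ → ℂ × ℂ}

/-- The union of a system of arcs. -/
def arcUnion (f : ι → ℝ → ℂ × ℂ) : Set (ℂ × ℂ) := ⋃ i, f i '' Set.Icc 0 1

/-- The point with parameter `t` on the `i`-th arc. -/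
def arcPoint (f : ι → ℝ → ℂ × ℂ) (i : ι) (t : ℝ) : arcUnion f :=
  ⟨f i (Set.projIcc 0 1 zero_le_one t), Set.mem_iUnion.2 ⟨i, _, Subtype.coe_prop _, rfl⟩⟩

theorem arcPoint_coe {i : ι} {t : ℝ} (ht : t ∈ Set.Icc (0 : ℝ) 1) :
    (arcPoint f i t : ℂ × ℂ) = f i t := by
  simp [arcPoint, Set.projIcc_of_mem zero_le_one ht]

theorem exists_eq_arcPoint (x : arcUnion f) : ∃ i, ∃ t ∈ Set.Icc (0 : ℝ) 1, x = arcPoint f i t := by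
  obtain ⟨i, t, ht, h⟩ := Set.mem_iUnion.1 x.2
  exact ⟨i, t, ht, Subtype.ext (by rw [arcPoint_coe ht, h])⟩

theorem IsArcSystem.continuous_arcPoint (hf : IsArcSystem f) (i : ι) :
    Continuous (arcPoint f i) := by
  refine Continuous.subtype_mk ?_ _
  exact (continuousOn_iff_continuous_domRestrict.1 (hf.continuousOn i)).comp
    (continuous_projIcc (h := zero_le_one))

variable [Finite ι]

theorem IsArcSystem.isCompact (hf : IsArcSystem f) : IsCompact (arcUnion f) :=
  isCompact_iUnion fun i => isCompact_Icc.image_of_continuousOn (hf.continuousOn i)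

theorem IsArcSystem.exists_simple (hf : IsArcSystem f) {L : C(arcUnion f, ℂ)} {i : ι} {t₀ : ℝ}
    (hinj : ∀ j, ∀ t ∈ Set.Icc (0 : ℝ) 1, L (arcPoint f j t) = L (arcPoint f i t₀) →
      j = i ∧ t = t₀) {ε : ℝ} (hε : 0 < ε) :
    ∃ r > 0, ∀ x, ‖L x - L (arcPoint f i t₀)‖ < r → ∃ t, |t - t₀| < ε ∧ x = arcPoint f i t := by
  have key : ∀ j, ∀ᶠ r in 𝓝[>] (0 : ℝ), ∀ t ∈ Set.Icc (0 : ℝ) 1,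
      ‖L (arcPoint f j t) - L (arcPoint f i t₀)‖ < r → j = i ∧ |t - t₀| < ε := by
    intro j
    let C : Set ℝ := Set.Icc 0 1 ∩ {t | j = i → ε ≤ |t - t₀|}
    have hC : IsCompact C := by
      refine isCompact_Icc.inter_right ?_
      by_cases hj : j = i
      · simp only [hj, forall_const]
        exact isClosed_le continuous_const (by fun_prop)
      · simp [hj]
    have hcont : Continuous fun t => ‖L (arcPoint f j t) - L (arcPoint f i t₀)‖ := by
      have := hf.continuous_arcPoint j
      fun_prop
    rcases C.eq_empty_or_nonempty with hCe | hCne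
    · filter_upwards with r t ht _
      by_contra hcon
      have : t ∈ C := ⟨ht, fun hj => by
        by_contra hlt
        exact hcon ⟨hj, not_le.1 hlt⟩⟩
      rw [hCe] at this
      exact this
    · obtain ⟨t₁, ht₁, hmin⟩ := hC.exists_isMinOn hCne hcont.continuousOn
      have hpos : 0 < ‖L (arcPoint f j t₁) - L (arcPoint f i t₀)‖ := by
        rw [norm_pos_iff, sub_ne_zero]
        intro h
        obtain ⟨hj, ht⟩ := hinj j t₁ ht₁.1 h
        have := ht₁.2 hj
        rw [ht, sub_self, abs_zero] at this
        linarith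
      filter_upwards [Ioo_mem_nhdsGT hpos] with r hr t ht hlt
      by_contra hcon
      have htC : t ∈ C := ⟨ht, fun hj => by
        by_contra hlt
        exact hcon ⟨hj, not_le.1 hlt⟩⟩
      have := hmin htC
      simp only [Set.mem_ofPred_eq] at this
      linarith [hr.2]
  obtain ⟨r, hr, hr0⟩ := ((eventually_all.2 key).and self_mem_nhdsWithin).exists
  refine ⟨r, hr0, fun x hx => ?_⟩
  obtain ⟨j, t, ht, rfl⟩ := exists_eq_arcPoint x
  obtain ⟨rfl, h⟩ := hr j t ht hx
  exact ⟨t, h, rfl⟩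

end ArcSystem

section ArcSystem

variable {ι : Type*} {f : ι → ℝ → ℂ × ℂ} [CompactSpace (arcUnion f)]

theorem slopeFun_arcPoint (c : ℂ) (i : ι) {t : ℝ} (ht : t ∈ Set.Icc (0 : ℝ) 1) :
    (slopeFun (arcUnion f) c : C(arcUnion f, ℂ)) (arcPoint f i t) = (f i t).2 - c * (f i t).1 := by
  rw [slopeFun_apply, arcPoint_coe ht]

variable [Finite ι]

theorem IsArcSystem.volume_range_slopeFun (hf : IsArcSystem f) (c : ℂ) :
    volume (Set.range (slopeFun (arcUnion f) c : C(arcUnion f, ℂ))) = 0 := by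
  have hsub : Set.range (slopeFun (arcUnion f) c : C(arcUnion f, ℂ)) ⊆
      {0} ∪ ⋃ i, (fun t => (f i t).2 - c * (f i t).1) '' {t | t ∈ Set.Icc 0 1 ∧ f i t ≠ 0} := by
    rintro _ ⟨x, rfl⟩
    obtain ⟨i, t, ht, rfl⟩ := exists_eq_arcPoint x
    rw [slopeFun_arcPoint c i ht]
    by_cases h0 : f i t = 0
    · left
      simp [h0]
    · exact Or.inr (Set.mem_iUnion.2 ⟨i, t, ⟨ht, h0⟩, rfl⟩)
  refine measure_mono_null hsub (measure_union_null (by simp) (measure_iUnion_null fun i => ?_))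
  refine volume_image_eq_zero_of_differentiableAt fun t ht => ?_
  have := (hf.contDiffAt i t ht.1 ht.2).differentiableAt (by simp)
  exact this.snd.fun_sub (this.fst.const_mul c)

theorem IsArcSystem.exists_nhds_mulIndex_ne_top (hf : IsArcSystem f) {c : ℂ} {i : ι} {t₀ : ℝ}
    (ht₀ : t₀ ∈ Set.Ioo (0 : ℝ) 1) (h0 : f i t₀ ≠ 0)
    (hd : deriv (fun t => (f i t).2 - c * (f i t).1) t₀ ≠ 0)
    (hinj : ∀ j, ∀ t ∈ Set.Icc (0 : ℝ) 1, (f j t).2 - c * (f j t).1 = (f i t₀).2 - c * (f i t₀).1 →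
      j = i ∧ t = t₀) :
    ∃ B ∈ 𝓝 ((f i t₀).2 - c * (f i t₀).1),
      (∃ a ∈ B, a ∉ Set.range (slopeFun (arcUnion f) c : C(arcUnion f, ℂ)) ∧
        mulIndex (polyClosure (arcUnion f))
          (slopeFun (arcUnion f) c - algebraMap ℂ (polyClosure (arcUnion f)) a) ≠ ⊤) →
      ∀ a ∈ B, a ∉ Set.range (slopeFun (arcUnion f) c : C(arcUnion f, ℂ)) →
        mulIndex (polyClosure (arcUnion f))
          (slopeFun (arcUnion f) c - algebraMap ℂ (polyClosure (arcUnion f)) a) ≠ ⊤ := by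
  have hIcc := Set.Ioo_subset_Icc_self ht₀
  obtain ⟨ρ, hρ, hball⟩ : ∃ ρ > 0, ∀ t ∈ Metric.ball t₀ ρ, t ∈ Set.Ioo (0 : ℝ) 1 ∧ f i t ≠ 0 := by
    have hc : ContinuousAt (f i) t₀ :=
      (hf.continuousOn i).continuousAt (Icc_mem_nhds ht₀.1 ht₀.2)
    have hI : ∀ᶠ t in 𝓝 t₀, t ∈ Set.Ioo (0 : ℝ) 1 := isOpen_Ioo.mem_nhds ht₀
    exact Metric.eventually_nhds_iff_ball.1 (hI.and (hc.eventually_ne h0))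
  have heq : ∀ P : MvPolynomial (Fin 2) ℂ, ∀ t ∈ Set.Ioo (0 : ℝ) 1,
      (fun t => polyRestrict (arcUnion f) P (arcPoint f i t)) =ᶠ[𝓝 t]
        fun t => MvPolynomial.eval ![(f i t).1, (f i t).2] P := by
    intro P t ht
    filter_upwards [isOpen_Ioo.mem_nhds ht] with s hs
    rw [polyRestrict_apply, arcPoint_coe (Set.Ioo_subset_Icc_self hs)]
  have hsmooth : ∀ P : MvPolynomial (Fin 2) ℂ, ∀ t ∈ Metric.ball t₀ ρ, ContDiffAt ℝ (⊤ : ℕ∞)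
      (fun t => polyRestrict (arcUnion f) P (arcPoint f i t)) t := by
    intro P t ht
    have := contDiffAt_eval
      (hf.contDiffAt i t (Set.Ioo_subset_Icc_self (hball t ht).1) (hball t ht).2) P
    exact this.congr_of_eventuallyEq (heq P t (hball t ht).1)
  have hder : deriv (fun t => (slopeFun (arcUnion f) c : C(arcUnion f, ℂ)) (arcPoint f i t)) t₀
      ≠ 0 := by
    have he : (fun t => (slopeFun (arcUnion f) c : C(arcUnion f, ℂ)) (arcPoint f i t)) =ᶠ[𝓝 t₀]
        fun t => (f i t).2 - c * (f i t).1 := by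
      filter_upwards [isOpen_Ioo.mem_nhds ht₀] with s hs
      exact slopeFun_arcPoint c i (Set.Ioo_subset_Icc_self hs)
    rwa [he.deriv_eq]
  have := exists_nhds_mulIndex_ne_top_across (isClosed_polyClosure _)
    (dense_polyRestrict (arcUnion f)) (L := slopeFun (arcUnion f) c) (c := arcPoint f i) hρ
    (fun h ⟨P, hP⟩ t ht => by rw [hP]; exact hsmooth P t ht) (hsmooth _) hder
    (fun ε hε => hf.exists_simple (fun j t ht h => hinj j t ht
      (by rwa [slopeFun_arcPoint c j ht, slopeFun_arcPoint c i hIcc] at h)) hε)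
  rwa [slopeFun_arcPoint c i hIcc] at this

theorem IsArcSystem.ae_mulIndex_ne_top (hf : IsArcSystem f) :
    ∀ᵐ c : ℂ, ∀ a ∉ Set.range (slopeFun (arcUnion f) c : C(arcUnion f, ℂ)),
      mulIndex (polyClosure (arcUnion f))
        (slopeFun (arcUnion f) c - algebraMap ℂ (polyClosure (arcUnion f)) a) ≠ ⊤ := by
  let S : ι → Set ℝ := fun i => {t | t ∈ Set.Icc 0 1 ∧ f i t ≠ 0}
  have h1 : ∀ᵐ c : ℂ, ∀ i, ∀ t ∈ S i, deriv (fun t => (f i t).2 - c * (f i t).1) t ≠ 0 :=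
    ae_all_iff.2 fun i => ae_deriv_sub_mul_ne_zero fun t ht =>
      ⟨hf.contDiffAt i t ht.1 ht.2, hf.deriv_ne_zero i t ht.1 ht.2⟩
  have hdiff : ∀ i, ∀ t ∈ S i, DifferentiableAt ℝ (f i) t := fun i t ht =>
    (hf.contDiffAt i t ht.1 ht.2).differentiableAt (by simp)
  have h2 : ∀ᵐ c : ℂ, ∀ i j, {a | ∃ s ∈ S i, ∃ t ∈ S j, f i s ≠ f j t ∧
      (f i s).2 - c * (f i s).1 = a ∧ (f j t).2 - c * (f j t).1 = a}.Countable :=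
    ae_all_iff.2 fun i => ae_all_iff.2 fun j => ae_countable_double_values (hdiff i) (hdiff j)
  filter_upwards [h1, h2] with c hc1 hc2 a ha
  let D : Set ℂ := {0} ∪ (⋃ i, {(f i 0).2 - c * (f i 0).1, (f i 1).2 - c * (f i 1).1}) ∪
    ⋃ i, ⋃ j, {a | ∃ s ∈ S i, ∃ t ∈ S j, f i s ≠ f j t ∧
      (f i s).2 - c * (f i s).1 = a ∧ (f j t).2 - c * (f j t).1 = a}
  have hD : D.Countable :=
    ((Set.countable_singleton _).union (Set.countable_iUnion fun i =>
      (Set.countable_singleton _).insert _)).union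
      (Set.countable_iUnion fun i => Set.countable_iUnion fun j => hc2 i j)
  refine mulIndex_ne_top_of_countable (isClosed_polyClosure _) hD ?_ ?_ ha
  · refine Measure.dense_of_ae (μ := volume) ?_
    exact measure_eq_zero_iff_ae_notMem.1 (hf.volume_range_slopeFun c)
  · rintro _ ⟨x, rfl⟩ hxD
    obtain ⟨i, t₀, ht₀, rfl⟩ := exists_eq_arcPoint x
    rw [slopeFun_arcPoint c i ht₀] at hxD ⊢
    have hne : ∀ j, ∀ t ∈ Set.Icc (0 : ℝ) 1,
        (f j t).2 - c * (f j t).1 = (f i t₀).2 - c * (f i t₀).1 → f j t ≠ 0 := by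
      intro j t _ h h0
      refine hxD (Or.inl (Or.inl ?_))
      rw [← h, h0]
      simp
    have h0 := hne i t₀ ht₀ rfl
    have hend : ∀ e : ℝ, (e = 0 ∨ e = 1) → t₀ ≠ e := by
      rintro e he rfl
      refine hxD (Or.inl (Or.inr (Set.mem_iUnion.2 ⟨i, ?_⟩)))
      rcases he with rfl | rfl <;> simp
    refine hf.exists_nhds_mulIndex_ne_top
      ⟨lt_of_le_of_ne ht₀.1 (hend 0 (Or.inl rfl)).symm, lt_of_le_of_ne ht₀.2 (hend 1 (Or.inr rfl))⟩
      h0 (hc1 i t₀ ⟨ht₀, h0⟩) fun j t ht h => ?_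
    refine hf.eq_of_eq j i t ht t₀ ht₀ ?_ (hne j t ht h)
    by_contra hne'
    exact hxD (Or.inr (Set.mem_iUnion.2 ⟨j, Set.mem_iUnion.2 ⟨i, t, ⟨ht, hne j t ht h⟩, t₀,
      ⟨ht₀, h0⟩, hne', h, rfl⟩⟩))

end ArcSystem

section CauchyTransform

theorem integrableOn_inv_sub (z : ℂ) (ρ : ℝ) :
    IntegrableOn (fun ζ : ℂ => (z - ζ)⁻¹) (Metric.ball 0 ρ) := by
  have h1 : ∀ r : ℝ, IntegrableOn (fun ζ : ℂ => ‖ζ‖⁻¹) (Metric.ball 0 r) := by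
    intro r
    refine (integrableOn_fun_norm_addHaar volume (f := fun y => y⁻¹)).2 ?_
    have : IntegrableOn (fun _ : ℝ => (1 : ℝ)) (Set.Ioo 0 r) := by simp
    refine this.congr_fun (fun y hy => ?_) measurableSet_Ioo
    have : y ≠ 0 := hy.1.ne'
    simp [Complex.finrank_real_complex, this]
  have h2 : IntegrableOn (fun ζ : ℂ => ζ⁻¹) (Metric.ball 0 (‖z‖ + ρ)) :=
    (h1 _).mono' (by fun_prop) (by simp)
  have h3 := (Measure.measurePreserving_sub_left volume z).integrableOn_comp_preimage
    (MeasurableEquiv.subLeft z).measurableEmbedding (f := fun ζ : ℂ => ζ⁻¹)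
    (s := Metric.ball 0 (‖z‖ + ρ)) |>.2 h2
  refine h3.mono_set fun ζ hζ => ?_
  rw [mem_ball_zero_iff] at hζ
  simp only [Set.mem_preimage, mem_ball_zero_iff]
  linarith [norm_sub_le z ζ]

theorem circleAverage_inv_sub_of_lt {z : ℂ} {r : ℝ} (hr : 0 < r) (h : r < ‖z‖) :
    Real.circleAverage (fun ζ => (z - ζ)⁻¹) 0 r = z⁻¹ := by
  have hd : DiffContOnCl ℂ (fun ζ => (z - ζ)⁻¹) (Metric.ball 0 |r|) := by
    refine DifferentiableOn.diffContOnCl fun ζ hζ => ?_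
    rw [closure_ball _ (abs_pos.2 hr.ne').ne', abs_of_pos hr, mem_closedBall_zero_iff] at hζ
    have : z - ζ ≠ 0 := by
      rintro h0
      rw [sub_eq_zero.1 h0] at h
      linarith
    exact (((differentiableAt_const z).sub differentiableAt_id).inv this).differentiableWithinAt
  rw [hd.circleAverage, sub_zero]

theorem circleAverage_inv_sub_of_gt {z : ℂ} {r : ℝ} (h : ‖z‖ < r) :
    Real.circleAverage (fun ζ => (z - ζ)⁻¹) 0 r = 0 := by
  have hr : 0 < r := (norm_nonneg z).trans_lt h
  rw [Real.circleAverage_eq_circleIntegral hr.ne']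
  have key : (∮ ζ in C(0, r), (ζ - 0)⁻¹ • (z - ζ)⁻¹) = 0 := by
    have hne : ∀ ζ ∈ Metric.sphere (0 : ℂ) r, ζ ≠ 0 ∧ ζ - z ≠ 0 := by
      intro ζ hζ
      rw [mem_sphere_zero_iff_norm] at hζ
      refine ⟨?_, ?_⟩
      · rintro rfl
        simp at hζ
        linarith
      · intro h0
        rw [← sub_eq_zero.1 h0] at h
        linarith
    rcases eq_or_ne z 0 with rfl | hz
    · rw [circleIntegral.integral_congr (g := fun ζ => -((ζ - 0) ^ (-2 : ℤ))) hr.le]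
      · have := circleIntegral.integral_sub_zpow_of_ne (n := -2) (by norm_num) 0 0 r
        simp only [circleIntegral, smul_neg, intervalIntegral.integral_neg] at this ⊢
        rw [this, neg_zero]
      · intro ζ hζ
        have := (hne ζ hζ).1
        simp only [sub_zero, zero_sub, smul_eq_mul]
        rw [show (-2 : ℤ) = -((2 : ℕ) : ℤ) from rfl, zpow_neg, zpow_natCast]
        field_simp
    · rw [circleIntegral.integral_congr (g := fun ζ => z⁻¹ * ((ζ - 0)⁻¹ - (ζ - z)⁻¹)) hr.le]
      · rw [circleIntegral.integral_const_mul, circleIntegral.integral_sub,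
          circleIntegral.integral_sub_inv_of_mem_ball (by simpa using hr),
          circleIntegral.integral_sub_inv_of_mem_ball (by simpa using h), sub_self, mul_zero]
        · exact circleIntegrable_sub_inv_iff.2 (Or.inr (by simp [abs_of_pos hr, hr.ne]))
        · exact circleIntegrable_sub_inv_iff.2 (Or.inr (by simp [abs_of_pos hr, h.ne]))
      · intro ζ hζ
        obtain ⟨h1, h2⟩ := hne ζ hζ
        have h3 : z - ζ ≠ 0 := by
          rw [← neg_sub]
          exact neg_ne_zero.2 h2
        simp only [sub_zero, smul_eq_mul]
        field_simp
        ring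
  rw [key, smul_zero]

/-- The Cauchy transform of a disc. -/
theorem setIntegral_ball_inv_sub {z : ℂ} {ρ : ℝ} (h : ‖z‖ < ρ) :
    ∫ ζ in Metric.ball (0 : ℂ) ρ, (z - ζ)⁻¹ = Real.pi * (starRingEnd ℂ) z := by
  set F : ℂ → ℂ := (Metric.ball (0 : ℂ) ρ).indicator fun ζ => (z - ζ)⁻¹ with hF
  have hFi : Integrable F := (integrableOn_inv_sub z ρ).integrable_indicator measurableSet_ball
  have hFm : Measurable F := by
    refine Measurable.indicator ?_ measurableSet_ball
    fun_prop
  have hs : Measurable Complex.polarCoord.symm := by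
    have : ⇑Complex.polarCoord.symm =
        fun p : ℝ × ℝ => (p.1 : ℂ) * (Real.cos p.2 + Real.sin p.2 * Complex.I) := by
      ext1 p
      exact Complex.polarCoord_symm_apply p
    rw [this]
    fun_prop
  have hint : IntegrableOn (fun p : ℝ × ℝ => p.1 • F (Complex.polarCoord.symm p))
      (Set.Ioi (0 : ℝ) ×ˢ Set.Ioo (-Real.pi) Real.pi) := by
    refine ⟨by fun_prop, ?_⟩
    have h1 := hFi.2
    rw [hasFiniteIntegral_iff_enorm, ← Complex.lintegral_comp_polarCoord_symm] at h1
    rw [hasFiniteIntegral_iff_enorm]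
    refine lt_of_le_of_lt (le_of_eq (setLIntegral_congr_fun
      (measurableSet_Ioi.prod measurableSet_Ioo) fun p hp => ?_)) h1
    have hp1 : 0 < p.1 := hp.1
    simp only [enorm_smul, smul_eq_mul, Real.enorm_of_nonneg hp1.le]
  rw [← integral_indicator measurableSet_ball, ← hF, ← Complex.integral_comp_polarCoord_symm]
  change ∫ p in Set.Ioi (0 : ℝ) ×ˢ Set.Ioo (-Real.pi) Real.pi, _ = _
  rw [Measure.volume_eq_prod, setIntegral_prod _ hint]
  have hinner : ∀ r ∈ Set.Ioi (0 : ℝ), r ≠ ‖z‖ →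
      ∫ θ in Set.Ioo (-Real.pi) Real.pi, (r, θ).1 • F (Complex.polarCoord.symm (r, θ)) =
        (Set.Ioo 0 ‖z‖).indicator (fun r => (r : ℂ) * (2 * Real.pi * z⁻¹)) r := by
    intro r hr hrz
    rw [Set.mem_Ioi] at hr
    have hsymm : ∀ θ, Complex.polarCoord.symm (r, θ) = circleMap 0 r θ := by
      intro θ
      rw [Complex.polarCoord_symm_apply, circleMap_zero, Complex.exp_mul_I]
      simp
    simp only [hsymm]
    rcases lt_or_ge r ρ with hrρ | hrρ
    · have hFv : ∀ θ, F (circleMap 0 r θ) = (z - circleMap 0 r θ)⁻¹ := fun θ =>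
        Set.indicator_of_mem (by simp [abs_of_pos hr, hrρ]) _
      have hav := Real.circleAverage_eq_integral_add (f := fun ζ => (z - ζ)⁻¹) (c := 0) (R := r)
        (-Real.pi)
      rw [intervalIntegral.integral_comp_add_right (fun θ => (z - circleMap 0 r θ)⁻¹),
        zero_add, show 2 * Real.pi + -Real.pi = Real.pi by ring,
        intervalIntegral.integral_of_le (by linarith [Real.pi_pos]),
        integral_Ioc_eq_integral_Ioo, eq_inv_smul_iff₀ (by positivity)] at hav
      simp only [hFv]
      rw [integral_smul, ← hav]
      rcases lt_or_gt_of_ne hrz with hlt | hgt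
      · rw [circleAverage_inv_sub_of_lt hr hlt, Set.indicator_of_mem (Set.mem_Ioo.2 ⟨hr, hlt⟩)]
        simp [mul_assoc]
      · rw [circleAverage_inv_sub_of_gt hgt, Set.indicator_of_notMem fun h => hgt.not_gt h.2]
        simp
    · have hFv : ∀ θ, F (circleMap 0 r θ) = 0 := fun θ =>
        Set.indicator_of_notMem (by simp [abs_of_pos hr, hrρ]) _
      rw [Set.indicator_of_notMem fun h' => (h.trans_le hrρ).not_gt h'.2]
      simp [hFv]
  have hae : ∀ᵐ r : ℝ ∂(volume.restrict (Set.Ioi 0)), r ≠ ‖z‖ :=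
    ae_restrict_of_ae (Measure.ae_ne volume _)
  rw [integral_congr_ae ((ae_restrict_iff' measurableSet_Ioi).2 <|
    ((ae_restrict_iff' measurableSet_Ioi).1 hae).mono fun r hr h0 => hinner r h0 (hr h0)),
    setIntegral_indicator measurableSet_Ioo,
    Set.inter_eq_right.2 Set.Ioo_subset_Ioi_self, integral_mul_const,
    ← integral_Ioc_eq_integral_Ioo, ← intervalIntegral.integral_of_le (norm_nonneg z),
    intervalIntegral.integral_ofReal, integral_id]
  rcases eq_or_ne z 0 with rfl | hz
  · simp
  · push_cast
    rw [zero_pow two_ne_zero, sub_zero, ← Complex.mul_conj']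
    field_simp

end CauchyTransform

section HartogsRosenthal

theorem exists_lintegral_inv_sub_lt (ρ : ℝ) {ε : ENNReal} (hε : ε ≠ 0) :
    ∃ δ > 0, ∀ z : ℂ, ‖z‖ < ρ → ∀ S ⊆ Metric.ball (0 : ℂ) ρ, MeasurableSet S → volume S < δ →
      ∫⁻ ζ in S, ‖(z - ζ)⁻¹‖ₑ < ε := by
  have hfin : ∫⁻ ζ in Metric.ball (0 : ℂ) (2 * ρ), ‖(0 - ζ)⁻¹‖ₑ ≠ ⊤ :=
    (integrableOn_inv_sub 0 (2 * ρ)).2.ne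
  obtain ⟨δ, hδ, h⟩ := exists_pos_setLIntegral_lt_of_measure_lt hfin hε
  refine ⟨δ, hδ, fun z hz S hS hSm hSδ => ?_⟩
  have hp := Measure.measurePreserving_sub_left volume z
  have hsub : (fun ζ => z - ζ) ⁻¹' S ⊆ Metric.ball 0 (2 * ρ) := by
    intro ζ hζ
    have := mem_ball_zero_iff.1 (hS hζ)
    have h2 := norm_sub_le z (z - ζ)
    rw [sub_sub_cancel] at h2
    rw [mem_ball_zero_iff]
    linarith
  have h1 := hp.setLIntegral_comp_preimage hSm (f := fun ζ => ‖(z - ζ)⁻¹‖ₑ) (by fun_prop)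
  rw [← h1]
  simp only [sub_sub_cancel]
  have h2 := h ((fun ζ => z - ζ) ⁻¹' S)
    ((Measure.restrict_apply_le _ _).trans_lt (by rwa [hp.measure_preimage hSm.nullMeasurableSet]))
  rw [Measure.restrict_restrict_of_subset hsub] at h2
  simpa [enorm_inv] using h2

theorem Submodule.integral_mem_of_isClosed {α E : Type*} {m : MeasurableSpace α} {μ : Measure α}
    [NormedAddCommGroup E] [NormedSpace ℂ E] [CompleteSpace E] {M : Submodule ℂ E}
    (hM : IsClosed (M : Set E)) {g : α → E} (hg : Integrable g μ) (h : ∀ᵐ a ∂μ, g a ∈ M) :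
    ∫ a, g a ∂μ ∈ M := by
  have : IsClosed (M : Set E) := hM
  have h1 := M.mkQL.integral_comp_comm hg
  have h2 : (fun a => M.mkQL (g a)) =ᵐ[μ] 0 :=
    h.mono fun a ha => (Submodule.Quotient.mk_eq_zero M).2 ha
  rw [integral_eq_zero_of_ae h2] at h1
  exact (Submodule.Quotient.mk_eq_zero M).1 h1.symm

variable {X : Type*} [TopologicalSpace X] [CompactSpace X]

/-- A form of the Hartogs-Rosenthal theorem. -/
theorem star_mem_of_inverse_mem {M : Submodule ℂ C(X, ℂ)} (hM : IsClosed (M : Set C(X, ℂ)))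
    {L : C(X, ℂ)} (hL : volume (Set.range L) = 0)
    (hinv : ∀ a ∉ Set.range L, Ring.inverse (L - algebraMap ℂ C(X, ℂ) a) ∈ M) :
    star L ∈ M := by
  set ρ : ℝ := ‖L‖ + 1 with hρ
  have hLρ : ∀ x, ‖L x‖ < ρ := fun x => (L.norm_coe_le_norm x).trans_lt (lt_add_one _)
  suffices h : ((Real.pi : ℂ) • star L) ∈ M by
    have := M.smul_mem (Real.pi : ℂ)⁻¹ h
    rwa [inv_smul_smul₀ (by exact_mod_cast Real.pi_ne_zero)] at this
  rw [← SetLike.mem_coe, ← hM.closure_eq, Metric.mem_closure_iff]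
  intro ε hε
  obtain ⟨δ, hδ, hsmall⟩ := exists_lintegral_inv_sub_lt ρ
    (ε := ENNReal.ofReal (ε / 2)) (by simpa using hε)
  obtain ⟨O, hLO, hO, hOδ⟩ := (Set.range L).exists_isOpen_lt_of_lt δ (by rwa [hL])
  have hne : ∀ a ∉ O, ∀ x, (L - algebraMap ℂ C(X, ℂ) a) x ≠ 0 := by
    intro a ha x h0
    refine ha (hLO ⟨x, ?_⟩)
    simpa [sub_eq_zero] using h0
  have hcont : ContinuousOn (fun a => Ring.inverse (L - algebraMap ℂ C(X, ℂ) a))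
      (Metric.closedBall 0 ρ \ O) := by
    intro a ha
    obtain ⟨u, hu⟩ := isUnit_continuousMap_of_ne_zero (hne a ha.2)
    have h1 : ContinuousAt Ring.inverse (L - algebraMap ℂ C(X, ℂ) a) := by
      rw [← hu]
      exact NormedRing.inverse_continuousAt u
    have h2 : ContinuousAt (fun a => L - algebraMap ℂ C(X, ℂ) a) a :=
      (continuous_const.sub (continuous_algebraMap ℂ C(X, ℂ))).continuousAt
    exact (ContinuousAt.comp (f := fun a => L - algebraMap ℂ C(X, ℂ) a) h1 h2).continuousWithinAt
  have hint : IntegrableOn (fun a => Ring.inverse (L - algebraMap ℂ C(X, ℂ) a))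
      (Metric.ball 0 ρ \ O) :=
    (hcont.integrableOn_compact ((isCompact_closedBall 0 ρ).diff hO)).mono_set
      (Set.sdiff_subset_sdiff_left Metric.ball_subset_closedBall)
  have hD : MeasurableSet (Metric.ball (0 : ℂ) ρ \ O) := measurableSet_ball.diff hO.measurableSet
  refine ⟨∫ a in Metric.ball 0 ρ \ O, Ring.inverse (L - algebraMap ℂ C(X, ℂ) a), ?_, ?_⟩
  · exact Submodule.integral_mem_of_isClosed hM hint ((ae_restrict_mem hD).mono fun a ha =>
      hinv a fun h => ha.2 (hLO h))
  · refine lt_of_le_of_lt ?_ (half_lt_self hε)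
    rw [dist_eq_norm, ContinuousMap.norm_le _ (by positivity)]
    intro x
    rw [ContinuousMap.sub_apply, ContinuousMap.integral_apply hint,
      setIntegral_congr_fun (g := fun ζ => (L x - ζ)⁻¹) hD fun a ha => by
        simp only [ringInverse_continuousMap_apply (hne a ha.2)]; simp]
    have hsplit := integral_inter_add_sdiff (f := fun ζ => (L x - ζ)⁻¹) (s := Metric.ball 0 ρ)
      hO.measurableSet (integrableOn_inv_sub (L x) ρ)
    rw [setIntegral_ball_inv_sub (hLρ x)] at hsplit
    have : ((Real.pi : ℂ) • star L) x - ∫ ζ in Metric.ball 0 ρ \ O, (L x - ζ)⁻¹ =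
        ∫ ζ in Metric.ball 0 ρ ∩ O, (L x - ζ)⁻¹ := by
      rw [sub_eq_iff_eq_add, hsplit]
      simp
    rw [this]
    have h1 := (enorm_integral_le_lintegral_enorm _).trans_lt
      (hsmall (L x) (hLρ x) (Metric.ball 0 ρ ∩ O) Set.inter_subset_left
      (measurableSet_ball.inter hO.measurableSet)
      ((measure_mono Set.inter_subset_right).trans_lt hOδ))
    rw [← ofReal_norm, ENNReal.ofReal_lt_ofReal_iff (by positivity)] at h1
    exact h1.le

end HartogsRosenthal

section FiniteIndexQuotients

variable {X : Type*} [TopologicalSpace X]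

/-- The functions `S / R` with `S, R ∈ A`, where `R` has no zeros and finite index. -/
def finiteIndexQuotients (A : Subalgebra ℂ C(X, ℂ)) : Subalgebra ℂ C(X, ℂ) where
  carrier := {g | ∃ S R : A, IsUnit (R : C(X, ℂ)) ∧ mulIndex A R ≠ ⊤ ∧ g * R = S}
  mul_mem' := by
    rintro g g' ⟨S, R, hR, hRi, h⟩ ⟨S', R', hR', hRi', h'⟩
    refine ⟨S * S', R * R', hR.mul hR', ?_, ?_⟩
    · rw [mulIndex_mul hR]
      exact WithTop.add_ne_top.2 ⟨hRi, hRi'⟩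
    · push_cast
      rw [← h, ← h']
      ring
  add_mem' := by
    rintro g g' ⟨S, R, hR, hRi, h⟩ ⟨S', R', hR', hRi', h'⟩
    refine ⟨S * R' + S' * R, R * R', hR.mul hR', ?_, ?_⟩
    · rw [mulIndex_mul hR]
      exact WithTop.add_ne_top.2 ⟨hRi, hRi'⟩
    · push_cast
      rw [← h, ← h']
      ring
  algebraMap_mem' a := ⟨algebraMap ℂ A a, 1, isUnit_one, by simp [mulIndex_one], by simp⟩

variable {A : Subalgebra ℂ C(X, ℂ)}

theorem mem_finiteIndexQuotients_of_mem {g : C(X, ℂ)} (hg : g ∈ A) :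
    g ∈ finiteIndexQuotients A :=
  ⟨⟨g, hg⟩, 1, isUnit_one, by simp [mulIndex_one], by simp⟩

theorem inverse_mem_finiteIndexQuotients {R : A} (hR : IsUnit (R : C(X, ℂ)))
    (h : mulIndex A R ≠ ⊤) : Ring.inverse (R : C(X, ℂ)) ∈ finiteIndexQuotients A :=
  ⟨1, R, hR, h, by simp [Ring.inverse_mul_cancel _ hR]⟩

variable [CompactSpace X]

theorem star_mem_closure_finiteIndexQuotients {L : A}
    (hL : volume (Set.range (L : C(X, ℂ))) = 0)
    (h : ∀ a ∉ Set.range (L : C(X, ℂ)), mulIndex A (L - algebraMap ℂ A a) ≠ ⊤) :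
    star (L : C(X, ℂ)) ∈ (finiteIndexQuotients A).topologicalClosure := by
  refine star_mem_of_inverse_mem
    (M := Subalgebra.toSubmodule (finiteIndexQuotients A).topologicalClosure)
    (Subalgebra.isClosed_topologicalClosure _) hL fun a ha => ?_
  refine Subalgebra.le_topologicalClosure _
    (inverse_mem_finiteIndexQuotients (R := L - algebraMap ℂ A a) ?_ (h a ha))
  refine isUnit_continuousMap_of_ne_zero fun x h0 => ha ⟨x, ?_⟩
  simpa [sub_eq_zero] using h0

/-- If the quotients of finite index are dense, then zero-free elements of `A` which have a
logarithm are invertible in `A`. -/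
theorem exists_mul_eq_one_of_dense (hA : IsClosed (A : Set C(X, ℂ)))
    (hd : Dense (finiteIndexQuotients A : Set C(X, ℂ))) {Q : A} {g : C(X, ℂ)}
    (hg : ∀ x, (Q : C(X, ℂ)) x = Complex.exp (g x)) : ∃ G : A, Q * G = 1 := by
  have hQ0 : ∀ x, (Q : C(X, ℂ)) x ≠ 0 := fun x => by
    rw [hg]
    exact Complex.exp_ne_zero _
  have hQ := isUnit_continuousMap_of_ne_zero hQ0
  obtain ⟨N, hN⟩ := exists_nat_gt (4 * ‖g‖ + 1)
  have hN0 : (0 : ℝ) < N := by linarith [norm_nonneg g]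
  let e : C(X, ℂ) := ⟨fun x => Complex.exp (g x / N), by fun_prop⟩
  have heN : e ^ N = Q := by
    ext x
    rw [ContinuousMap.pow_apply, hg]
    simp only [e, ContinuousMap.coe_mk]
    rw [← Complex.exp_nat_mul, mul_div_cancel₀]
    exact_mod_cast hN0.ne'
  have he1 : ‖e - 1‖ < 1 := by
    refine lt_of_le_of_lt ((ContinuousMap.norm_le _ (by norm_num)).2 fun x => ?_)
      (by norm_num : (1 / 2 : ℝ) < 1)
    have h1 : ‖g x / N‖ ≤ 1 / 4 := by
      rw [norm_div, Complex.norm_natCast, div_le_iff₀ hN0]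
      linarith [g.norm_coe_le_norm x]
    have h2 := Complex.norm_exp_sub_one_le (x := g x / N) (by linarith)
    simp only [ContinuousMap.sub_apply, ContinuousMap.one_apply, e, ContinuousMap.coe_mk]
    linarith
  have hopen : IsOpen
      {q : C(X, ℂ) | ‖q - 1‖ < 1 ∧ ‖q ^ N * Ring.inverse (Q : C(X, ℂ)) - 1‖ < 1} := by
    refine IsOpen.inter (s := {q : C(X, ℂ) | ‖q - 1‖ < 1})
      (t := {q : C(X, ℂ) | ‖q ^ N * Ring.inverse (Q : C(X, ℂ)) - 1‖ < 1})
      (isOpen_lt ?_ continuous_const)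
      (isOpen_lt ?_ continuous_const)
    · fun_prop
    · fun_prop
  obtain ⟨q, ⟨hq1, hq2⟩, S, R, hR, hRi, hq⟩ := hd.inter_open_nonempty _ hopen
    ⟨e, he1, by simp [heN, Ring.mul_inverse_cancel _ hQ]⟩
  have hR0 : ∀ x, (R : C(X, ℂ)) x ≠ 0 := fun x =>
    (ContinuousMap.isUnit_iff_forall_ne_zero _).1 hR x
  have hSR : ∀ x, ‖(S : C(X, ℂ)) x - (R : C(X, ℂ)) x‖ < ‖(R : C(X, ℂ)) x‖ := by
    intro x
    have h1 := ((q - 1).norm_coe_le_norm x).trans_lt hq1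
    have h2 : (S : C(X, ℂ)) x - (R : C(X, ℂ)) x = (q - 1) x * (R : C(X, ℂ)) x := by
      rw [← hq]
      simp [sub_mul]
    rw [h2, norm_mul]
    exact mul_lt_of_lt_one_left (norm_pos_iff.2 (hR0 x)) h1
  have hS : IsUnit (S : C(X, ℂ)) := isUnit_continuousMap_of_ne_zero fun x h0 => by
    have := hSR x
    simp [h0] at this
  have hSQ : ∀ x, ‖((S ^ N : A) : C(X, ℂ)) x - ((Q * R ^ N : A) : C(X, ℂ)) x‖ <
      ‖((Q * R ^ N : A) : C(X, ℂ)) x‖ := by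
    intro x
    have h1 := ((q ^ N * Ring.inverse (Q : C(X, ℂ)) - 1).norm_coe_le_norm x).trans_lt hq2
    have h2 : ((S ^ N : A) : C(X, ℂ)) - ((Q * R ^ N : A) : C(X, ℂ)) =
        (q ^ N * Ring.inverse (Q : C(X, ℂ)) - 1) * ((Q * R ^ N : A) : C(X, ℂ)) := by
      push_cast
      rw [← hq]
      linear_combination (-(q ^ N * (R : C(X, ℂ)) ^ N)) * Ring.inverse_mul_cancel _ hQ
    rw [← ContinuousMap.sub_apply, h2, ContinuousMap.mul_apply, norm_mul]
    refine mul_lt_of_lt_one_left (norm_pos_iff.2 ?_) h1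
    simpa using ⟨hQ0 x, fun h => absurd h (hR0 x)⟩
  have hi := mulIndex_eq_of_norm_sub_lt hA hSQ
  rw [mulIndex_pow hS, mulIndex_mul hQ, mulIndex_pow hR, mulIndex_eq_of_norm_sub_lt hA hSR] at hi
  refine mulIndex_eq_zero_iff.1 ?_
  obtain ⟨k, hk⟩ := ENat.ne_top_iff_exists.1 hRi
  rw [← hk, ← Nat.cast_mul] at hi
  refine ENat.add_left_injective_of_ne_top (ENat.natCast_ne_top (N * k)) ?_
  simpa using hi.symm

end FiniteIndexQuotients

section ArcSystem

variable {ι : Type*} {f : ι → ℝ → ℂ × ℂ}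

theorem dense_of_star_mem {K : Set (ℂ × ℂ)} [CompactSpace K] {B : Subalgebra ℂ C(K, ℂ)}
    (hB : IsClosed (B : Set C(K, ℂ))) {c c' : ℂ} (hc : c ≠ c')
    (h1 : (slopeFun K c : C(K, ℂ)) ∈ B) (h2 : (slopeFun K c' : C(K, ℂ)) ∈ B)
    (h3 : star (slopeFun K c : C(K, ℂ)) ∈ B) (h4 : star (slopeFun K c' : C(K, ℂ)) ∈ B) :
    B = ⊤ := by
  let T := StarAlgebra.adjoin ℂ {(slopeFun K c : C(K, ℂ)), (slopeFun K c' : C(K, ℂ))}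
  have hT : T.toSubalgebra ≤ B := by
    rw [StarAlgebra.adjoin_toSubalgebra, Algebra.adjoin_le_iff]
    rintro g (hg | hg)
    · rcases hg with rfl | rfl
      exacts [h1, h2]
    · rcases hg with hg | hg
      · rw [← star_star g, hg]
        exact h3
      · rw [← star_star g, Set.mem_singleton_iff.1 hg]
        exact h4
  have hsep : T.SeparatesPoints := by
    intro x y hxy
    by_contra! hcon
    have e1 := hcon _ ⟨_, StarAlgebra.subset_adjoin ℂ _ (Set.mem_insert _ _), rfl⟩
    have e2 := hcon _ ⟨_, StarAlgebra.subset_adjoin ℂ _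
      (Set.mem_insert_of_mem _ (Set.mem_singleton _)), rfl⟩
    simp only [slopeFun_apply] at e1 e2
    have e3 : x.1.1 = y.1.1 := by
      have : (c' - c) * (x.1.1 - y.1.1) = 0 := by linear_combination e1 - e2
      exact sub_eq_zero.1 ((mul_eq_zero.1 this).resolve_left (sub_ne_zero.2 hc.symm))
    refine hxy (Subtype.ext (Prod.ext e3 ?_))
    rw [e3] at e1
    exact sub_left_injective e1
  have htop := ContinuousMap.starSubalgebra_topologicalClosure_eq_top_of_separatesPoints T hsep
  refine eq_top_iff.2 fun g _ => ?_
  have hg : g ∈ closure (T : Set C(K, ℂ)) := by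
    rw [← StarSubalgebra.topologicalClosure_coe, htop]
    trivial
  exact closure_minimal hT hB hg

theorem IsArcSystem.dense_finiteIndexQuotients [Finite ι] [CompactSpace (arcUnion f)]
    (hf : IsArcSystem f) :
    Dense (finiteIndexQuotients (polyClosure (arcUnion f)) : Set C(arcUnion f, ℂ)) := by
  obtain ⟨c, hc⟩ := hf.ae_mulIndex_ne_top.exists
  obtain ⟨c', hc', hne⟩ := (hf.ae_mulIndex_ne_top.and (Measure.ae_ne volume c)).exists
  have hmem := fun c => Subalgebra.le_topologicalClosure _ (mem_finiteIndexQuotients_of_mem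
    (slopeFun (arcUnion f) c).2)
  have := dense_of_star_mem (Subalgebra.isClosed_topologicalClosure _) hne (hmem c') (hmem c)
    (star_mem_closure_finiteIndexQuotients (hf.volume_range_slopeFun c') hc')
    (star_mem_closure_finiteIndexQuotients (hf.volume_range_slopeFun c) hc)
  rw [dense_iff_closure_eq, ← Subalgebra.topologicalClosure_coe, this]
  rfl

theorem exists_continuous_log {F : C(ℝ, ℂ)} (hF : ∀ t, F t ≠ 0) (τ : ℝ) {b : ℂ}
    (hb : Complex.exp b = F τ) : ∃ g : C(ℝ, ℂ), g τ = b ∧ ∀ t, Complex.exp (g t) = F t := by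
  obtain ⟨g, ⟨hg, hgF⟩, -⟩ := Complex.isCoveringMapOn_exp.existsUnique_continuousMap_lifts F hb hF
  exact ⟨g, hg, congrFun hgF⟩

theorem IsArcSystem.exists_log [Finite ι] (hf : IsArcSystem f)
    (h0 : ∀ i, ∃ τ ∈ Set.Icc (0 : ℝ) 1, ∀ t ∈ Set.Icc (0 : ℝ) 1, f i t = 0 ↔ t = τ)
    {Q : C(arcUnion f, ℂ)} (hQ : ∀ x, Q x ≠ 0) :
    ∃ g : C(arcUnion f, ℂ), ∀ x, Q x = Complex.exp (g x) := by
  choose τ hτ hτ0 using h0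
  have hlog : ∀ i, ∃ g : C(ℝ, ℂ), g (τ i) = Complex.log (Q (arcPoint f i (τ i))) ∧
      ∀ t, Complex.exp (g t) = Q (arcPoint f i t) := fun i =>
    exists_continuous_log (F := Q.comp ⟨arcPoint f i, hf.continuous_arcPoint i⟩)
      (fun t => hQ _) (τ i) (Complex.exp_log (hQ _))
  choose g hg0 hg using hlog
  let Φ : C((Σ _ : ι, Set.Icc (0 : ℝ) 1), arcUnion f) :=
    ⟨fun p => arcPoint f p.1 p.2, continuous_sigma fun i =>
      (hf.continuous_arcPoint i).comp continuous_subtype_val⟩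
  have hΦ : IsQuotientMap Φ := by
    refine IsQuotientMap.of_surjective_continuous ?_ Φ.continuous
    intro x
    obtain ⟨i, t, ht, rfl⟩ := exists_eq_arcPoint x
    exact ⟨⟨i, t, ht⟩, rfl⟩
  let G : C((Σ _ : ι, Set.Icc (0 : ℝ) 1), ℂ) :=
    ⟨fun p => g p.1 p.2, continuous_sigma fun i => (g i).continuous.comp continuous_subtype_val⟩
  have hfac : Function.FactorsThrough G Φ := by
    rintro ⟨i, s, hs⟩ ⟨j, t, ht⟩ h
    change arcPoint f i s = arcPoint f j t at h
    change g i s = g j t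
    have h' : f i s = f j t := by
      rw [← arcPoint_coe (f := f) hs, ← arcPoint_coe (f := f) ht, h]
    by_cases hz : f i s = 0
    · obtain rfl := (hτ0 i s hs).1 hz
      obtain rfl := (hτ0 j t ht).1 (h' ▸ hz)
      rw [hg0, hg0, h]
    · obtain ⟨rfl, rfl⟩ := hf.eq_of_eq i j s hs t ht h' hz
      rfl
  refine ⟨hΦ.lift G hfac, fun x => ?_⟩
  obtain ⟨i, t, ht, rfl⟩ := exists_eq_arcPoint x
  have := DFunLike.congr_fun (hΦ.lift_comp G hfac) ⟨i, t, ht⟩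
  change hΦ.lift G hfac (arcPoint f i t) = g i t at this
  rw [this, hg]

theorem IsArcSystem.exists_slope [Countable ι] [CompactSpace (arcUnion f)]
    (hf : IsArcSystem f) {p : ℂ × ℂ} (hp : p ∉ arcUnion f) :
    ∃ c : ℂ, p.2 - c * p.1 ∉ Set.range (slopeFun (arcUnion f) c : C(arcUnion f, ℂ)) := by
  let S : ι → Set ℝ := fun i => {t | t ∈ Set.Icc 0 1 ∧ f i t ≠ 0 ∧ (f i t).1 - p.1 ≠ 0}
  have hnull : volume ({(0 - p.2) / (0 - p.1)} ∪
      ⋃ i, (fun t => ((f i t).2 - p.2) * ((f i t).1 - p.1)⁻¹) '' S i) = 0 := by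
    refine measure_union_null (by simp) (measure_iUnion_null fun i => ?_)
    refine volume_image_eq_zero_of_differentiableAt fun t ht => ?_
    have := (hf.contDiffAt i t ht.1 ht.2.1).differentiableAt (by simp)
    exact (this.snd.sub_const _).fun_mul ((this.fst.sub_const _).inv ht.2.2)
  obtain ⟨c, hc⟩ := (measure_eq_zero_iff_ae_notMem.1 hnull).exists
  refine ⟨c, ?_⟩
  rintro ⟨x, hx⟩
  rw [slopeFun_apply] at hx
  have hx' : x.1.2 - p.2 = c * (x.1.1 - p.1) := by linear_combination hx
  by_cases h1 : x.1.1 - p.1 = 0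
  · rw [h1, mul_zero] at hx'
    exact hp ((Prod.ext (sub_eq_zero.1 h1) (sub_eq_zero.1 hx') : x.1 = p) ▸ x.2)
  · have hceq : c = (x.1.2 - p.2) / (x.1.1 - p.1) := by rw [hx', mul_div_cancel_right₀ _ h1]
    refine hc ?_
    obtain ⟨i, t, ht, rfl⟩ := exists_eq_arcPoint x
    rw [arcPoint_coe ht] at h1 hceq
    by_cases h0 : f i t = 0
    · left
      rw [hceq, h0]
      rfl
    · refine Or.inr (Set.mem_iUnion.2 ⟨i, t, ⟨ht, h0, h1⟩, ?_⟩)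
      rw [hceq, div_eq_mul_inv]

end ArcSystem

section PolynomialHull

theorem subset_polyHull2 {K : Set (ℂ × ℂ)} (hK : IsCompact K) : K ⊆ polyHull2 K := by
  intro z hz P
  have hc : Continuous fun w : ℂ × ℂ => ‖MvPolynomial.eval ![w.1, w.2] P‖ := by
    refine (MvPolynomial.continuous_eval P |>.comp (continuous_pi fun i => ?_)).norm
    fin_cases i
    · exact continuous_fst
    · exact continuous_snd
  exact le_csSup (hK.image hc).bddAbove ⟨z, hz, rfl⟩

theorem notMem_polyHull2_of_mul_eq_one {K : Set (ℂ × ℂ)} [CompactSpace K]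
    {Q : MvPolynomial (Fin 2) ℂ} {p : ℂ × ℂ} (hQ : MvPolynomial.eval ![p.1, p.2] Q = 0)
    (h : ∃ G ∈ polyClosure K, polyRestrict K Q * G = 1) : p ∉ polyHull2 K := by
  intro hp
  obtain ⟨G, hG, hQG⟩ := h
  have hopen : IsOpen {g : C(K, ℂ) | ‖polyRestrict K Q * g - 1‖ < 1} :=
    isOpen_lt (by fun_prop) continuous_const
  obtain ⟨_, hP, P, rfl⟩ := mem_closure_iff.1 hG _ hopen (by simp [hQG])
  have h1 := hp (Q * P - 1)
  have h2 : sSup ((fun w : ℂ × ℂ => ‖MvPolynomial.eval ![w.1, w.2] (Q * P - 1)‖) '' K) ≤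
      ‖polyRestrict K Q * polyRestrict K P - 1‖ := by
    refine Real.sSup_le ?_ (norm_nonneg _)
    rintro _ ⟨w, hw, rfl⟩
    have := (polyRestrict K Q * polyRestrict K P - 1).norm_coe_le_norm ⟨w, hw⟩
    simpa [polyRestrict_apply] using this
  have h3 := h1.trans h2
  rw [map_sub, map_mul, hQ, zero_mul, map_one, zero_sub, norm_neg, norm_one] at h3
  exact absurd (h3.trans_lt hP) (lt_irrefl 1)

theorem IsArcSystem.polyHull2_eq {ι : Type*} [Finite ι] {f : ι → ℝ → ℂ × ℂ} (hf : IsArcSystem f)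
    (h0 : ∀ i, ∃ τ ∈ Set.Icc (0 : ℝ) 1, ∀ t ∈ Set.Icc (0 : ℝ) 1, f i t = 0 ↔ t = τ) :
    polyHull2 (arcUnion f) = arcUnion f := by
  refine Set.Subset.antisymm (fun p hp => ?_) (subset_polyHull2 hf.isCompact)
  by_contra hpK
  have : CompactSpace (arcUnion f) := isCompact_iff_compactSpace.1 hf.isCompact
  obtain ⟨c, hc⟩ := hf.exists_slope hpK
  let Q : MvPolynomial (Fin 2) ℂ :=
    MvPolynomial.X 1 - MvPolynomial.C c * MvPolynomial.X 0 - MvPolynomial.C (p.2 - c * p.1)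
  have hQ0 : ∀ x, polyRestrict (arcUnion f) Q x ≠ 0 := by
    intro x h
    refine hc ⟨x, ?_⟩
    rw [slopeFun_apply]
    simpa [Q, polyRestrict_apply, sub_eq_zero] using h
  obtain ⟨g, hg⟩ := hf.exists_log h0 hQ0
  obtain ⟨G, hG⟩ := exists_mul_eq_one_of_dense (isClosed_polyClosure (arcUnion f))
    hf.dense_finiteIndexQuotients (Q := ⟨_, polyRestrict_mem _ Q⟩) hg
  exact notMem_polyHull2_of_mul_eq_one (Q := Q) (by simp [Q]) ⟨G, G.2, congrArg Subtype.val hG⟩ hp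

theorem IsRectifiableArc.exists_unique_zero {γ : Set (ℂ × ℂ)} {f : ℝ → ℂ × ℂ}
    (h : IsRectifiableArc γ f) (h0 : (0 : ℂ × ℂ) ∈ γ) :
    ∃ τ ∈ Set.Icc (0 : ℝ) 1, ∀ t ∈ Set.Icc (0 : ℝ) 1, f t = 0 ↔ t = τ := by
  rw [h.1] at h0
  obtain ⟨τ, hτ, hτ0⟩ := h0
  exact ⟨τ, hτ, fun t ht => ⟨fun h' => h.2.1 ht hτ (h'.trans hτ0.symm), fun h' => h' ▸ hτ0⟩⟩

end PolynomialHull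

/-- If `γ₁`, `γ₂` are rectifiable arcs in `ℂ²`, each smooth (with nonvanishing
derivative of the parametrization) at all of its points except possibly the origin,
with `γ₁ ∩ γ₂ = {0}`, then `γ₁ ∪ γ₂` is polynomially convex. -/
theorem union_of_arcs_polynomially_convex (γ₁ γ₂ : Set (ℂ × ℂ)) (f₁ f₂ : ℝ → ℂ × ℂ)
    (h₁ : IsRectifiableArc γ₁ f₁) (h₂ : IsRectifiableArc γ₂ f₂)
    (hs₁ : ∀ x ∈ Set.Icc (0 : ℝ) 1, f₁ x ≠ 0 → ContDiffAt ℝ (⊤ : ℕ∞) f₁ x ∧ deriv f₁ x ≠ 0)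
    (hs₂ : ∀ x ∈ Set.Icc (0 : ℝ) 1, f₂ x ≠ 0 → ContDiffAt ℝ (⊤ : ℕ∞) f₂ x ∧ deriv f₂ x ≠ 0)
    (hint : γ₁ ∩ γ₂ = {0}) :
    polyHull2 (γ₁ ∪ γ₂) = γ₁ ∪ γ₂ := by
  have h0 : (0 : ℂ × ℂ) ∈ γ₁ ∩ γ₂ := by simp [hint]
  have hdisj : ∀ s ∈ Set.Icc (0 : ℝ) 1, ∀ t ∈ Set.Icc (0 : ℝ) 1, f₁ s = f₂ t → f₁ s = 0 := by
    intro s hs t ht h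
    have : f₁ s ∈ γ₁ ∩ γ₂ := ⟨h₁.1 ▸ ⟨s, hs, rfl⟩, h₂.1 ▸ ⟨t, ht, h.symm⟩⟩
    rwa [hint] at this
  have hf : IsArcSystem (fun i : Bool => cond i f₁ f₂) := by
    refine ⟨?_, ?_, ?_, ?_⟩
    · rintro (_ | _)
      · exact h₂.2.2.choose_spec.continuousOn
      · exact h₁.2.2.choose_spec.continuousOn
    · rintro (_ | _) (_ | _) s hs t ht h hne
      · exact ⟨rfl, h₂.2.1 hs ht h⟩
      · exact absurd (h.trans (hdisj t ht s hs h.symm)) hne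
      · exact absurd (hdisj s hs t ht h) hne
      · exact ⟨rfl, h₁.2.1 hs ht h⟩
    · rintro (_ | _) t ht hne
      exacts [(hs₂ t ht hne).1, (hs₁ t ht hne).1]
    · rintro (_ | _) t ht hne
      exacts [(hs₂ t ht hne).2, (hs₁ t ht hne).2]
  have hK : arcUnion (fun i : Bool => cond i f₁ f₂) = γ₁ ∪ γ₂ := by
    rw [h₁.1, h₂.1, Set.union_eq_iUnion]
    exact Set.iUnion_congr fun i => by cases i <;> rfl
  rw [← hK]
  refine hf.polyHull2_eq ?_
  rintro (_ | _)
  exacts [h₂.exists_unique_zero h0.2, h₁.exists_unique_zero h0.1]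
end
end

section
/- Let M = [[A,B],[C,D]] be a real 4×4 symplectic matrix with 2×2 blocks (MᵗJM = J, J = [[0,−I₂],[I₂,0]]), and set Ψ = [[Dᵗ, −Bᵗ],[Bᵗ, Dᵗ]]. Then Ψ commutes with J (ΨJ = JΨ, so the linear map defined by Ψ is complex linear), and the product ΨM has the block form [[I₂, 0],[E, G]] for some 2×2 real matrix E, where G = BᵗB + DᵗD. -/
open Matrix

noncomputable section

/-- The 4×4 matrix (indexed by `Fin 2 ⊕ Fin 2`) `J = [[0,−I₂],[I₂,0]]` of the standard complex structure on `ℝ⁴ ≅ ℂ²`. -/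
def J4 : Matrix (Fin 2 ⊕ Fin 2) (Fin 2 ⊕ Fin 2) ℝ :=
  Matrix.fromBlocks 0 (-1) 1 0

/-- If `M = [[A,B],[C,D]]` is a real symplectic 4×4 matrix (`MᵗJM = J`) and
`Ψ = [[Dᵗ,−Bᵗ],[Bᵗ,Dᵗ]]`, then `Ψ` commutes with `J` (so the linear map defined by `Ψ`
is complex linear) and `ΨM = [[I₂,0],[E,G]]` for some 2×2 matrix `E`, where
`G = BᵗB + DᵗD`. -/
theorem psi_complex_linear_and_block_form (A B C D : Matrix (Fin 2) (Fin 2) ℝ)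
    (hsymp : (Matrix.fromBlocks A B C D)ᵀ * J4 * Matrix.fromBlocks A B C D = J4) :
    Matrix.fromBlocks Dᵀ (-Bᵀ) Bᵀ Dᵀ * J4 = J4 * Matrix.fromBlocks Dᵀ (-Bᵀ) Bᵀ Dᵀ ∧
    ∃ E : Matrix (Fin 2) (Fin 2) ℝ,
      Matrix.fromBlocks Dᵀ (-Bᵀ) Bᵀ Dᵀ * Matrix.fromBlocks A B C D =
        Matrix.fromBlocks 1 0 E (Bᵀ * B + Dᵀ * D) := by
  rw [J4, fromBlocks_transpose, fromBlocks_multiply, fromBlocks_multiply, fromBlocks_inj] at hsymp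
  obtain ⟨-, -, h₂₁, h₂₂⟩ := hsymp
  refine ⟨by simp [J4, fromBlocks_multiply], Bᵀ * A + Dᵀ * C, ?_⟩
  rw [fromBlocks_multiply, fromBlocks_inj]
  exact ⟨by simpa using h₂₁, by simpa using h₂₂, rfl, rfl⟩
end
end

section
/- Let C > 0 and let g₁₁, g₂₂ > 0, g₁₂ ∈ ℝ satisfy g₁₁g₂₂ − g₁₂² > 0. Define α₀₁ = (3C/2)g₂₂, α₂₀ = −Cg₁₂, β₁₁ = −3Cg₁₂, β₃₀ = 2Cg₁₁, let 𝒟 = (β₁₁ − 2α₂₀)² + 8α₀₁β₃₀, y± = (β₁₁ − 2α₂₀ ± √𝒟)/(4α₀₁), and set λ₁± = α₂₀ + α₀₁ y± and λ₂± = β₁₁ − 2α₂₀ − 4α₀₁ y±. Then λ₁⁺ > 0, λ₁⁻ < 0, λ₂⁺ < 0, and λ₂⁻ > 0; in particular, at each of the two singular points (0, y±) of the blown-up system, the two eigenvalues λ₁±, λ₂± have opposite signs (saddle points). -/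
/-- For `C > 0` and a positive-definite matrix `G = (g_{ij})` (`g₁₁, g₂₂ > 0`,
`g₁₁g₂₂ − g₁₂² > 0`), with `α₀₁ = (3C/2)g₂₂`, `α₂₀ = −Cg₁₂`, `β₁₁ = −3Cg₁₂`,
`β₃₀ = 2Cg₁₁`, `𝒟 = (β₁₁ − 2α₂₀)² + 8α₀₁β₃₀`, `y± = (β₁₁ − 2α₂₀ ± √𝒟)/(4α₀₁)`,
`λ₁± = α₂₀ + α₀₁ y±`, `λ₂± = β₁₁ − 2α₂₀ − 4α₀₁ y±`, one has
`λ₁⁺ > 0`, `λ₁⁻ < 0`, `λ₂⁺ < 0`, `λ₂⁻ > 0`: at each singular point `(0, y±)` of the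
blown-up system the two eigenvalues have opposite signs (saddle points). -/
theorem eigenvalues_opposite_signs
    (C g₁₁ g₁₂ g₂₂ : ℝ) (hC : 0 < C) (h₁₁ : 0 < g₁₁) (h₂₂ : 0 < g₂₂)
    (hdet : 0 < g₁₁ * g₂₂ - g₁₂ ^ 2)
    (α₀₁ α₂₀ β₁₁ β₃₀ 𝒟 yp ym l₁p l₁m l₂p l₂m : ℝ)
    (hα₀₁ : α₀₁ = 3 * C / 2 * g₂₂) (hα₂₀ : α₂₀ = -(C * g₁₂))
    (hβ₁₁ : β₁₁ = -(3 * C * g₁₂)) (hβ₃₀ : β₃₀ = 2 * C * g₁₁)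
    (hD : 𝒟 = (β₁₁ - 2 * α₂₀) ^ 2 + 8 * α₀₁ * β₃₀)
    (hyp : yp = (β₁₁ - 2 * α₂₀ + Real.sqrt 𝒟) / (4 * α₀₁))
    (hym : ym = (β₁₁ - 2 * α₂₀ - Real.sqrt 𝒟) / (4 * α₀₁))
    (hl₁p : l₁p = α₂₀ + α₀₁ * yp) (hl₁m : l₁m = α₂₀ + α₀₁ * ym)
    (hl₂p : l₂p = β₁₁ - 2 * α₂₀ - 4 * α₀₁ * yp)
    (hl₂m : l₂m = β₁₁ - 2 * α₂₀ - 4 * α₀₁ * ym) :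
    0 < l₁p ∧ l₁m < 0 ∧ l₂p < 0 ∧ 0 < l₂m := by
  have hα : 0 < α₀₁ := by rw [hα₀₁]; positivity
  have hp : 4 * α₀₁ * yp = β₁₁ - 2 * α₂₀ + √𝒟 := by
    rw [hyp]; field_simp
  have hm : 4 * α₀₁ * ym = β₁₁ - 2 * α₂₀ - √𝒟 := by
    rw [hym]; field_simp
  have hlt : (5 * (C * g₁₂)) ^ 2 < 𝒟 := by
    have h : 0 < C ^ 2 * (g₁₁ * g₂₂ - g₁₂ ^ 2) := by positivity
    rw [hD, hα₀₁, hα₂₀, hβ₁₁, hβ₃₀]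
    linarith
  obtain ⟨hlo, hhi⟩ := abs_lt.mp (Real.lt_sqrt_of_sq_lt (by rwa [sq_abs]) : |5 * (C * g₁₂)| < √𝒟)
  have hs : 0 < √𝒟 := Real.sqrt_pos.mpr ((sq_nonneg _).trans_lt hlt)
  refine ⟨?_, ?_, ?_, ?_⟩ <;> linarith
end
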